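/- arXiv:math/0612138 — 14 statements merged into one kernel-verified Lean document; each statement's English description precedes it below -/
import Mathlib

section
/- Let I ⊆ ℝ be a closed interval containing 0, let k : I → ℝ satisfy 0 ≤ k(x) ≤ 1 for all x ∈ I, and let φ : I → ℝ be a C¹ function such that φ''(x) exists for every x ∈ I with x ≠ 0 and satisfies φ''(x) ≥ k(x)·φ(x) for all x ≠ 0. Assume φ(0) ≥ 0 and φ'(0) = 0. Then: (a) φ'(x) ≥ 0 for all x ∈ I with x ≥ 0 and φ'(x) ≤ 0 for all x ∈ I with x ≤ 0; (b) φ(x) ≥ 0 for all x ∈ I and φ''(x) ≥ 0 for all x ∈ I with x ≠ 0. -/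
open Set

/-- A function with nonnegative second derivative on the interior of `[0, b]` and nonnegative
first derivative at `0` has nonnegative first derivative and is bounded below by its value
at `0`. -/
theorem nonneg_deriv_and_le_of_nonneg_deriv2 {b : ℝ} {f f' f'' : ℝ → ℝ}
    (hf : ContinuousOn f (Icc 0 b)) (hf' : ContinuousOn f' (Icc 0 b))
    (hd : ∀ x ∈ Ioo 0 b, HasDerivAt f (f' x) x)
    (hd' : ∀ x ∈ Ioo 0 b, HasDerivAt f' (f'' x) x)
    (hnonneg : ∀ x ∈ Ioo 0 b, 0 ≤ f'' x) (h0 : 0 ≤ f' 0) :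
    ∀ x ∈ Icc 0 b, 0 ≤ f' x ∧ f 0 ≤ f x := by
  have hmono' : MonotoneOn f' (Icc 0 b) := by
    refine monotoneOn_of_hasDerivWithinAt_nonneg (convex_Icc 0 b) hf' (f' := f'') ?_ ?_ <;>
      rw [interior_Icc]
    · exact fun x hx => (hd' x hx).hasDerivWithinAt
    · exact hnonneg
  have hpos : ∀ x ∈ Icc 0 b, 0 ≤ f' x := fun x hx =>
    h0.trans (hmono' ⟨le_rfl, hx.1.trans hx.2⟩ hx hx.1)
  have hmono : MonotoneOn f (Icc 0 b) := by
    refine monotoneOn_of_hasDerivWithinAt_nonneg (convex_Icc 0 b) hf (f' := f') ?_ ?_ <;>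
      rw [interior_Icc]
    · exact fun x hx => (hd x hx).hasDerivWithinAt
    · exact fun x hx => hpos x (Ioo_subset_Icc_self hx)
  exact fun x hx => ⟨hpos x hx, hmono ⟨le_rfl, hx.1.trans hx.2⟩ hx hx.1⟩

/-- A solution of `f'' ≥ k f` on `[0, b]` with `0 ≤ k ≤ 1`, `f 0 > -ε` and `f' 0 ≥ 0` satisfies
`f + ε exp > 0`. -/
theorem add_mul_exp_pos_of_deriv2_ge {b ε : ℝ} {k f f' f'' : ℝ → ℝ} (hε : 0 < ε)
    (hk : ∀ x ∈ Ioo 0 b, 0 ≤ k x ∧ k x ≤ 1)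
    (hf : ContinuousOn f (Icc 0 b)) (hf' : ContinuousOn f' (Icc 0 b))
    (hd : ∀ x ∈ Ioo 0 b, HasDerivAt f (f' x) x)
    (hd' : ∀ x ∈ Ioo 0 b, HasDerivAt f' (f'' x) x)
    (hineq : ∀ x ∈ Ioo 0 b, k x * f x ≤ f'' x) (hf0 : -ε < f 0) (hf'0 : 0 ≤ f' 0) :
    ∀ x ∈ Icc 0 b, 0 < f x + ε * Real.exp x := by
  have hexp : Continuous fun x => ε * Real.exp x := by fun_prop
  have hψ : ContinuousOn (fun x => f x + ε * Real.exp x) (Icc 0 b) := hf.add hexp.continuousOn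
  have hψ0 : 0 < f 0 + ε * Real.exp 0 := by rw [Real.exp_zero]; linarith
  by_contra! hcon
  obtain ⟨x, hx, hxle⟩ := hcon
  have hcompact : IsCompact (Icc 0 b ∩ (fun x => f x + ε * Real.exp x) ⁻¹' Iic 0) :=
    isCompact_Icc.of_isClosed_subset (hψ.preimage_isClosed_of_isClosed isClosed_Icc isClosed_Iic)
      inter_subset_left
  obtain ⟨c, ⟨hc, hcle⟩, hcmin⟩ := hcompact.exists_isLeast ⟨x, hx, hxle⟩
  have hsub : Icc 0 c ⊆ Icc 0 b := Icc_subset_Icc_right hc.2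
  have hsub' : Ioo 0 c ⊆ Ioo 0 b := Ioo_subset_Ioo_right hc.2
  have hge := (nonneg_deriv_and_le_of_nonneg_deriv2
    (f' := fun x => f' x + ε * Real.exp x) (f'' := fun x => f'' x + ε * Real.exp x)
    (hψ.mono hsub) ((hf'.add hexp.continuousOn).mono hsub)
    (fun y hy => (hd y (hsub' hy)).add ((Real.hasDerivAt_exp y).const_mul ε))
    (fun y hy => (hd' y (hsub' hy)).add ((Real.hasDerivAt_exp y).const_mul ε))
    (fun y hy => by
      have hpos : 0 < f y + ε * Real.exp y := by
        by_contra! hle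
        exact hy.2.not_ge (hcmin ⟨hsub (Ioo_subset_Icc_self hy), hle⟩)
      obtain ⟨hk0, hk1⟩ := hk y (hsub' hy)
      have h := hineq y (hsub' hy)
      have he : 0 < ε * Real.exp y := by positivity
      change 0 ≤ f'' y + ε * Real.exp y
      nlinarith [mul_nonneg hk0 hpos.le, mul_nonneg (sub_nonneg.2 hk1) he.le])
    (by positivity) c ⟨hc.1, le_rfl⟩).2
  exact (hψ0.trans_le hge).not_ge hcle

/-- A solution of `f'' ≥ k f` on `[0, b]` with `0 ≤ k ≤ 1`, `f 0 ≥ 0` and `f' 0 ≥ 0` is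
nonnegative, and so is its derivative. -/
theorem nonneg_of_deriv2_ge {b : ℝ} {k f f' f'' : ℝ → ℝ}
    (hk : ∀ x ∈ Ioo 0 b, 0 ≤ k x ∧ k x ≤ 1)
    (hf : ContinuousOn f (Icc 0 b)) (hf' : ContinuousOn f' (Icc 0 b))
    (hd : ∀ x ∈ Ioo 0 b, HasDerivAt f (f' x) x)
    (hd' : ∀ x ∈ Ioo 0 b, HasDerivAt f' (f'' x) x)
    (hineq : ∀ x ∈ Ioo 0 b, k x * f x ≤ f'' x) (hf0 : 0 ≤ f 0) (hf'0 : 0 ≤ f' 0) :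
    ∀ x ∈ Icc 0 b, 0 ≤ f' x ∧ 0 ≤ f x := by
  have hnonneg : ∀ x ∈ Icc 0 b, 0 ≤ f x := by
    intro x hx
    refine le_of_forall_pos_le_add fun δ hδ => ?_
    have hε : 0 < δ * Real.exp (-x) := by positivity
    have h := add_mul_exp_pos_of_deriv2_ge hε hk hf hf' hd hd' hineq (by linarith) hf'0 x hx
    rw [mul_assoc, ← Real.exp_add, neg_add_cancel, Real.exp_zero, mul_one] at h
    exact h.le
  exact fun x hx => ⟨(nonneg_deriv_and_le_of_nonneg_deriv2 hf hf' hd hd'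
    (fun y hy => (mul_nonneg (hk y hy).1 (hnonneg y (Ioo_subset_Icc_self hy))).trans
      (hineq y hy)) hf'0 x hx).1, hnonneg x hx⟩

/-- Theorem A.1 (Futer–Kalfagianni–Purcell), parts (a) and (b):
differential inequality `φ'' ≥ k·φ` on a closed interval `I` containing `0`,
with `0 ≤ k ≤ 1`, `φ(0) ≥ 0` and `φ'(0) = 0`, forces `φ' ≥ 0` on `I ∩ [0,∞)`,
`φ' ≤ 0` on `I ∩ (-∞,0]`, `φ ≥ 0` on `I`, and `φ'' ≥ 0` on `I \ {0}`. -/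
theorem stmt_0 (I : Set ℝ) (hIclosed : IsClosed I) (hIconn : I.OrdConnected)
    (h0I : (0 : ℝ) ∈ I)
    (k φ φ' φ'' : ℝ → ℝ)
    (hk : ∀ x ∈ I, 0 ≤ k x ∧ k x ≤ 1)
    (hderiv : ∀ x ∈ I, HasDerivWithinAt φ (φ' x) I x)
    (hC1 : ContinuousOn φ' I)
    (hderiv2 : ∀ x ∈ I, x ≠ 0 → HasDerivWithinAt φ' (φ'' x) I x)
    (hineq : ∀ x ∈ I, x ≠ 0 → k x * φ x ≤ φ'' x)
    (hφ0 : 0 ≤ φ 0) (hφ'0 : φ' 0 = 0) :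
    (∀ x ∈ I, 0 ≤ x → 0 ≤ φ' x) ∧
    (∀ x ∈ I, x ≤ 0 → φ' x ≤ 0) ∧
    (∀ x ∈ I, 0 ≤ φ x) ∧
    (∀ x ∈ I, x ≠ 0 → 0 ≤ φ'' x) := by
  have hφ : ContinuousOn φ I := fun x hx => (hderiv x hx).continuousWithinAt
  have hright : ∀ x ∈ I, 0 ≤ x → 0 ≤ φ' x ∧ 0 ≤ φ x := by
    intro x hx hx0
    have hsub : Icc 0 x ⊆ I := hIconn.out h0I hx
    have hmem : ∀ y ∈ Ioo 0 x, y ∈ I := fun y hy => hsub (Ioo_subset_Icc_self hy)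
    have hnhds : ∀ y ∈ Ioo 0 x, I ∈ nhds y := fun y hy =>
      Filter.mem_of_superset (Icc_mem_nhds hy.1 hy.2) hsub
    exact nonneg_of_deriv2_ge (fun y hy => hk y (hmem y hy)) (hφ.mono hsub) (hC1.mono hsub)
      (fun y hy => (hderiv y (hmem y hy)).hasDerivAt (hnhds y hy))
      (fun y hy => (hderiv2 y (hmem y hy) hy.1.ne').hasDerivAt (hnhds y hy))
      (fun y hy => hineq y (hmem y hy) hy.1.ne') hφ0 hφ'0.ge x ⟨hx0, le_rfl⟩
  have hleft : ∀ x ∈ I, x ≤ 0 → φ' x ≤ 0 ∧ 0 ≤ φ x := by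
    intro x hx hx0
    have hsub : Icc x 0 ⊆ I := hIconn.out hx h0I
    have hmaps : MapsTo (fun y : ℝ => -y) (Icc 0 (-x)) I := fun y hy =>
      hsub ⟨by linarith [hy.2], by linarith [hy.1]⟩
    have hmem : ∀ y ∈ Ioo 0 (-x), -y ∈ I := fun y hy => hmaps (Ioo_subset_Icc_self hy)
    have hne : ∀ y ∈ Ioo 0 (-x), -y ≠ 0 := fun y hy => neg_ne_zero.2 hy.1.ne'
    have hnhds : ∀ y ∈ Ioo 0 (-x), I ∈ nhds (-y) := fun y hy =>
      Filter.mem_of_superset (Icc_mem_nhds (by linarith [hy.2]) (by linarith [hy.1])) hsub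
    have h := nonneg_of_deriv2_ge (k := fun y => k (-y)) (f := fun y => φ (-y))
      (f' := fun y => -φ' (-y)) (f'' := fun y => φ'' (-y)) (fun y hy => hk (-y) (hmem y hy))
      (hφ.comp continuous_neg.continuousOn hmaps)
      (hC1.comp continuous_neg.continuousOn hmaps).neg
      (fun y hy => by
        simpa [Function.comp_def] using
          ((hderiv _ (hmem y hy)).hasDerivAt (hnhds y hy)).comp y (hasDerivAt_neg y))
      (fun y hy => by
        simpa using (((hderiv2 _ (hmem y hy) (hne y hy)).hasDerivAt (hnhds y hy)).comp y
          (hasDerivAt_neg y)).fun_neg)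
      (fun y hy => hineq _ (hmem y hy) (hne y hy)) (by simpa using hφ0) (by simp [hφ'0])
      (-x) ⟨by linarith, le_rfl⟩
    simpa using h
  have hnonneg : ∀ x ∈ I, 0 ≤ φ x := fun x hx =>
    (le_total 0 x).elim (fun h => (hright x hx h).2) (fun h => (hleft x hx h).2)
  exact ⟨fun x hx h => (hright x hx h).1, fun x hx h => (hleft x hx h).1, hnonneg,
    fun x hx h => (mul_nonneg (hk x hx).1 (hnonneg x hx)).trans (hineq x hx h)⟩
end

section
/- Let I ⊆ ℝ be a closed interval containing 0, let k : I → ℝ satisfy 0 ≤ k(x) ≤ 1 for all x ∈ I, and let φ : I → ℝ be a C¹ function such that φ''(x) exists for every x ∈ I with x ≠ 0 and satisfies φ''(x) ≥ k(x)·φ(x) for all x ≠ 0. Assume φ(0) ≥ 0 and φ'(0) = 0. If φ''(x₀) > 0 for some x₀ ∈ I with x₀ < 0, then φ(x) > 0 and φ'(x) < 0 for every x ∈ I with x < x₀. -/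
open Set in
/-- If `f'' ≥ min f 0` on `[a, 0)`, `f 0 ≥ 0` and `f' 0 ≤ 0`, then `f' ≤ 0` on `[a, 0]`. -/
theorem deriv_nonpos_of_min_le_second_deriv {a : ℝ} {f f' f'' : ℝ → ℝ}
    (hf : ∀ x ∈ Icc a 0, HasDerivWithinAt f (f' x) (Icc a 0) x)
    (hf'c : ContinuousOn f' (Icc a 0))
    (hf' : ∀ x ∈ Ioo a 0, HasDerivWithinAt f' (f'' x) (Icc a 0) x)
    (hineq : ∀ x ∈ Ioo a 0, min (f x) 0 ≤ f'' x)
    (h0 : 0 ≤ f 0) (h0' : f' 0 ≤ 0) :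
    ∀ x ∈ Icc a 0, f' x ≤ 0 := by
  have hE : ∀ x : ℝ, HasDerivAt (fun y ↦ Real.exp (-2 * y)) (-2 * Real.exp (-2 * x)) x := by
    intro x
    have := ((hasDerivAt_id x).const_mul (-2)).exp
    simpa [mul_comm] using this
  have barrier : ∀ ε > 0, ∀ x ∈ Icc a 0, f' x - 2 * ε * Real.exp (-2 * x) < 0 := by
    intro ε hε
    by_contra! hcon
    have hgc : ContinuousOn (fun x ↦ f' x - 2 * ε * Real.exp (-2 * x)) (Icc a 0) := by
      fun_prop
    obtain ⟨T, ⟨hT, hTpos⟩, hTmax⟩ : ∃ T,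
        IsGreatest (Icc a 0 ∩ (fun x ↦ f' x - 2 * ε * Real.exp (-2 * x)) ⁻¹' Ici 0) T :=
      (isCompact_Icc.of_isClosed_subset (hgc.preimage_isClosed_of_isClosed isClosed_Icc isClosed_Ici)
        inter_subset_left).exists_isGreatest (by
          obtain ⟨x, hx, hx0⟩ := hcon
          exact ⟨x, hx, hx0⟩)
    replace hTpos : 0 ≤ f' T - 2 * ε * Real.exp (-2 * T) := hTpos
    have hneg : ∀ x ∈ Ioc T 0, f' x - 2 * ε * Real.exp (-2 * x) < 0 := by
      intro x hx
      by_contra! h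
      exact absurd (hTmax ⟨⟨hT.1.trans hx.1.le, hx.2⟩, h⟩) (not_le.2 hx.1)
    have hend : f' 0 - 2 * ε * Real.exp (-2 * 0) < 0 := by
      have := Real.exp_pos (-2 * 0)
      nlinarith [mul_pos hε this]
    have hT0 : T < 0 := by
      rcases hT.2.lt_or_eq with h | h
      · exact h
      · rw [h] at hTpos
        linarith
    have hsub : Icc T 0 ⊆ Icc a 0 := Icc_subset_Icc_left hT.1
    have hfε : ∀ x ∈ Icc T 0, 0 < f x + ε * Real.exp (-2 * x) := by
      have hanti : AntitoneOn (fun x ↦ f x + ε * Real.exp (-2 * x)) (Icc T 0) := by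
        refine antitoneOn_of_hasDerivWithinAt_nonpos (convex_Icc T 0)
          (f' := fun x ↦ f' x + ε * (-2 * Real.exp (-2 * x))) ?_ ?_ ?_
        · exact ContinuousOn.add (fun x hx ↦ (hf x (hsub hx)).continuousWithinAt.mono hsub)
            (by fun_prop)
        · intro x hx
          exact ((hf x (hsub (interior_subset hx))).mono (interior_subset.trans hsub)).add
            ((hE x).const_mul ε).hasDerivWithinAt
        · intro x hx
          rw [interior_Icc] at hx
          linarith [hneg x ⟨hx.1, hx.2.le⟩]
      intro x hx
      have := hanti hx (right_mem_Icc.2 hT.2) hx.2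
      have := mul_pos hε (Real.exp_pos (-2 * 0))
      simp only at *
      linarith
    have hmono : StrictMonoOn (fun x ↦ f' x - 2 * ε * Real.exp (-2 * x)) (Icc T 0) := by
      refine strictMonoOn_of_hasDerivWithinAt_pos (convex_Icc T 0) (hgc.mono hsub)
        (f' := fun x ↦ f'' x - 2 * ε * (-2 * Real.exp (-2 * x))) ?_ ?_
      · intro x hx
        have hx' := hx
        rw [interior_Icc] at hx'
        exact ((hf' x ⟨hT.1.trans_lt hx'.1, hx'.2⟩).mono (interior_subset.trans hsub)).sub
          ((hE x).const_mul (2 * ε)).hasDerivWithinAt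
      · intro x hx
        rw [interior_Icc] at hx
        have h1 := hineq x ⟨hT.1.trans_lt hx.1, hx.2⟩
        have h2 := hfε x ⟨hx.1.le, hx.2.le⟩
        have h3 := mul_pos hε (Real.exp_pos (-2 * x))
        rcases min_cases (f x) 0 with h | h <;> linarith
    have := hmono (left_mem_Icc.2 hT.2) (right_mem_Icc.2 hT.2) hT0
    simp only at this
    linarith
  intro x hx
  by_contra! h
  have hpos := Real.exp_pos (-2 * x)
  have := barrier (f' x / (2 * Real.exp (-2 * x))) (by positivity) x hx
  field_simp at this
  linarith


/-- Theorem A.1 (Futer–Kalfagianni–Purcell), part (c):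
under the differential inequality `φ'' ≥ k·φ` on a closed interval `I ∋ 0`
with `0 ≤ k ≤ 1`, `φ(0) ≥ 0`, `φ'(0) = 0`, if `φ''(x₀) > 0` at some
`x₀ ∈ I` with `x₀ < 0`, then `φ(x) > 0` and `φ'(x) < 0` for all `x ∈ I`
with `x < x₀`. -/
theorem stmt_1 (I : Set ℝ) (hIclosed : IsClosed I) (hIconn : I.OrdConnected)
    (h0I : (0 : ℝ) ∈ I)
    (k φ φ' φ'' : ℝ → ℝ)
    (hk : ∀ x ∈ I, 0 ≤ k x ∧ k x ≤ 1)
    (hderiv : ∀ x ∈ I, HasDerivWithinAt φ (φ' x) I x)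
    (hC1 : ContinuousOn φ' I)
    (hderiv2 : ∀ x ∈ I, x ≠ 0 → HasDerivWithinAt φ' (φ'' x) I x)
    (hineq : ∀ x ∈ I, x ≠ 0 → k x * φ x ≤ φ'' x)
    (hφ0 : 0 ≤ φ 0) (hφ'0 : φ' 0 = 0)
    (x₀ : ℝ) (hx₀I : x₀ ∈ I) (hx₀neg : x₀ < 0) (hx₀pos : 0 < φ'' x₀) :
    ∀ x ∈ I, x < x₀ → 0 < φ x ∧ φ' x < 0 := by
  intro x hxI hxx₀
  have hsub : Set.Icc x 0 ⊆ I := hIconn.out hxI h0I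
  have hx0 : x < 0 := hxx₀.trans hx₀neg
  have hnonpos : ∀ y ∈ Set.Icc x 0, φ' y ≤ 0 := by
    refine deriv_nonpos_of_min_le_second_deriv (f'' := φ'')
      (fun y hy ↦ (hderiv y (hsub hy)).mono hsub) (hC1.mono hsub)
      (fun y hy ↦ (hderiv2 y (hsub (Set.Ioo_subset_Icc_self hy)) hy.2.ne).mono hsub) ?_ hφ0 hφ'0.le
    intro y hy
    have hyI := hsub (Set.Ioo_subset_Icc_self hy)
    obtain ⟨hk0, hk1⟩ := hk y hyI
    refine le_trans ?_ (hineq y hyI hy.2.ne)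
    rcases min_cases (φ y) 0 with h | h <;> nlinarith
  have hφc : ContinuousOn φ (Set.Icc x 0) :=
    fun y hy ↦ (hderiv y (hsub hy)).continuousWithinAt.mono hsub
  have hanti : AntitoneOn φ (Set.Icc x 0) :=
    antitoneOn_of_hasDerivWithinAt_nonpos (convex_Icc x 0) hφc
      (fun y hy ↦ (hderiv y (hsub (interior_subset hy))).mono (interior_subset.trans hsub))
      (fun y hy ↦ hnonpos y (interior_subset hy))
  have hnonneg : ∀ y ∈ Set.Icc x 0, 0 ≤ φ y := fun y hy ↦
    hφ0.trans (hanti hy (Set.right_mem_Icc.2 hx0.le) hy.2)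
  have hmono : MonotoneOn φ' (Set.Icc x 0) := by
    refine monotoneOn_of_hasDerivWithinAt_nonneg (convex_Icc x 0) (hC1.mono hsub) (f' := φ'') ?_ ?_
    · intro y hy
      have hy' := hy
      rw [interior_Icc] at hy'
      exact (hderiv2 y (hsub (interior_subset hy)) hy'.2.ne).mono (interior_subset.trans hsub)
    · intro y hy
      have hyc := interior_subset hy
      rw [interior_Icc] at hy
      exact (mul_nonneg (hk y (hsub hyc)).1 (hnonneg y hyc)).trans (hineq y (hsub hyc) hy.2.ne)
  have hx₀c : x₀ ∈ Set.Icc x 0 := ⟨hxx₀.le, hx₀neg.le⟩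
  have hneg : ∀ y ∈ Set.Ico x x₀, φ' y < 0 := by
    intro y hy
    have hyc : y ∈ Set.Icc x 0 := ⟨hy.1, hy.2.le.trans hx₀neg.le⟩
    refine (hnonpos y hyc).lt_of_ne fun hy0 ↦ hx₀pos.ne' ?_
    -- If `φ' y = 0`, then `φ'` vanishes on `[y, 0]`, hence so does `φ''` at `x₀`.
    have hzero : φ' =ᶠ[nhds x₀] fun _ ↦ 0 := by
      filter_upwards [Ioo_mem_nhds hy.2 hx₀neg] with z hz
      have hzc : z ∈ Set.Icc x 0 := ⟨hy.1.trans hz.1.le, hz.2.le⟩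
      exact le_antisymm (hnonpos z hzc) (hy0 ▸ hmono hyc hzc hz.1.le)
    have hd : HasDerivAt φ' (φ'' x₀) x₀ :=
      ((hderiv2 x₀ hx₀I hx₀neg.ne).mono hsub).hasDerivAt (Icc_mem_nhds hxx₀ hx₀neg)
    exact hd.unique ((hasDerivAt_const x₀ (0 : ℝ)).congr_of_eventuallyEq hzero)
  refine ⟨?_, hneg x ⟨le_rfl, hxx₀⟩⟩
  have hsub' : Set.Icc x x₀ ⊆ Set.Icc x 0 := Set.Icc_subset_Icc_right hx₀neg.le
  have hstrict : StrictAntiOn φ (Set.Icc x x₀) :=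
    strictAntiOn_of_hasDerivWithinAt_neg (convex_Icc x x₀) (hφc.mono hsub')
      (fun y hy ↦ (hderiv y (hsub (hsub' (interior_subset hy)))).mono
        (interior_subset.trans (hsub'.trans hsub)))
      (fun y hy ↦ hneg y (by
        rw [interior_Icc] at hy
        exact Set.Ioo_subset_Ico_self hy))
  exact (hnonneg x₀ hx₀c).trans_lt
    (hstrict (Set.left_mem_Icc.2 hxx₀.le) (Set.right_mem_Icc.2 hxx₀.le) hxx₀)
end

section
/- Let I ⊆ ℝ be a closed interval containing 0, let k : I → ℝ satisfy 0 ≤ k(x) ≤ 1 for all x ∈ I, and let φ : I → ℝ be a C¹ function such that φ''(x) exists for every x ∈ I with x ≠ 0 and satisfies φ''(x) ≥ k(x)·φ(x) for all x ≠ 0. Assume φ(0) ≥ 0 and φ'(0) = 0. If φ''(x₀) > 0 for some x₀ ∈ I with x₀ > 0, then φ(x) > 0 and φ'(x) > 0 for every x ∈ I with x > x₀. -/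
lemma monotoneOn_and_deriv_of_second_deriv_nonneg {b : ℝ} {f f' f'' : ℝ → ℝ}
    (hf : ∀ x ∈ Set.Icc 0 b, HasDerivWithinAt f (f' x) (Set.Icc 0 b) x)
    (hf'c : ContinuousOn f' (Set.Icc 0 b))
    (hf' : ∀ x ∈ Set.Ioo 0 b, HasDerivWithinAt f' (f'' x) (Set.Icc 0 b) x)
    (hnn : ∀ x ∈ Set.Ioo 0 b, 0 ≤ f'' x) (h0 : 0 ≤ f' 0) :
    MonotoneOn f' (Set.Icc 0 b) ∧ MonotoneOn f (Set.Icc 0 b) := by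
  have hm : MonotoneOn f' (Set.Icc 0 b) := by
    refine monotoneOn_of_hasDerivWithinAt_nonneg (f' := f'') (convex_Icc 0 b) hf'c ?_ ?_
    · intro x hx
      exact (hf' x (by rwa [interior_Icc] at hx)).mono interior_subset
    · intro x hx
      exact hnn x (by rwa [interior_Icc] at hx)
  refine ⟨hm, monotoneOn_of_hasDerivWithinAt_nonneg (f' := f') (convex_Icc 0 b)
    (fun x hx => (hf x hx).continuousWithinAt) ?_ ?_⟩
  · intro x hx
    exact (hf x (interior_subset hx)).mono interior_subset
  · intro x hx
    have hx' := interior_subset hx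
    exact h0.trans (hm ⟨le_rfl, hx'.1.trans hx'.2⟩ hx' hx'.1)

lemma pos_of_mul_le_second_deriv {b : ℝ} {k f f' f'' : ℝ → ℝ}
    (hk : ∀ x ∈ Set.Icc 0 b, 0 ≤ k x)
    (hf : ∀ x ∈ Set.Icc 0 b, HasDerivWithinAt f (f' x) (Set.Icc 0 b) x)
    (hf'c : ContinuousOn f' (Set.Icc 0 b))
    (hf' : ∀ x ∈ Set.Ioo 0 b, HasDerivWithinAt f' (f'' x) (Set.Icc 0 b) x)
    (hineq : ∀ x ∈ Set.Ioo 0 b, k x * f x ≤ f'' x) (h0 : 0 < f 0) (h0' : 0 ≤ f' 0) :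
    ∀ x ∈ Set.Icc 0 b, 0 < f x := by
  by_contra! hcon
  obtain ⟨y, hy, hfy⟩ := hcon
  have hfc : ContinuousOn f (Set.Icc 0 b) := fun x hx => (hf x hx).continuousWithinAt
  have hcl : IsClosed (Set.Icc 0 b ∩ f ⁻¹' Set.Iic 0) :=
    hfc.preimage_isClosed_of_isClosed isClosed_Icc isClosed_Iic
  obtain ⟨c, ⟨hc, hfc0⟩, hmin⟩ :=
    (isCompact_Icc.of_isClosed_subset hcl Set.inter_subset_left).exists_isLeast ⟨y, hy, hfy⟩
  have hsub : Set.Icc 0 c ⊆ Set.Icc 0 b := Set.Icc_subset_Icc_right hc.2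
  have hsub' : Set.Ioo 0 c ⊆ Set.Ioo 0 b := Set.Ioo_subset_Ioo_right hc.2
  have hm := (monotoneOn_and_deriv_of_second_deriv_nonneg (f'' := f'')
    (fun x hx => (hf x (hsub hx)).mono hsub) (hf'c.mono hsub)
    (fun x hx => (hf' x (hsub' hx)).mono hsub) (fun x hx => ?_) h0').2
  · have := hm ⟨le_rfl, hc.1⟩ ⟨hc.1, le_rfl⟩ hc.1
    have h2 : f c ≤ 0 := hfc0
    linarith
  · have hxb := hsub (Set.Ioo_subset_Icc_self hx)
    have hpos : 0 < f x := by
      by_contra! hle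
      exact absurd (hmin ⟨hxb, hle⟩) (not_le.2 hx.2)
    exact (mul_nonneg (hk x hxb) hpos.le).trans (hineq x (hsub' hx))

lemma nonneg_of_mul_le_second_deriv {b : ℝ} {k f f' f'' : ℝ → ℝ}
    (hk : ∀ x ∈ Set.Icc 0 b, 0 ≤ k x ∧ k x ≤ 1)
    (hf : ∀ x ∈ Set.Icc 0 b, HasDerivWithinAt f (f' x) (Set.Icc 0 b) x)
    (hf'c : ContinuousOn f' (Set.Icc 0 b))
    (hf' : ∀ x ∈ Set.Ioo 0 b, HasDerivWithinAt f' (f'' x) (Set.Icc 0 b) x)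
    (hineq : ∀ x ∈ Set.Ioo 0 b, k x * f x ≤ f'' x) (h0 : 0 ≤ f 0) (h0' : 0 ≤ f' 0) :
    ∀ x ∈ Set.Icc 0 b, 0 ≤ f x := by
  intro x hx
  have key : ∀ ε > 0, 0 < f x + ε * Real.exp x := by
    intro ε hε
    have hexp : ∀ y, HasDerivWithinAt (fun y => ε * Real.exp y) (ε * Real.exp y)
        (Set.Icc 0 b) y := fun y => ((Real.hasDerivAt_exp y).const_mul ε).hasDerivWithinAt
    refine pos_of_mul_le_second_deriv (k := k) (f := fun y => f y + ε * Real.exp y)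
      (f' := fun y => f' y + ε * Real.exp y) (f'' := fun y => f'' y + ε * Real.exp y)
      (fun y hy => (hk y hy).1) (fun y hy => (hf y hy).add (hexp y))
      (hf'c.add (by fun_prop)) (fun y hy => (hf' y hy).add (hexp y)) ?_ ?_ ?_ x hx
    · intro y hy
      have h1 := hineq y hy
      have h2 := mul_le_mul_of_nonneg_right (hk y (Set.Ioo_subset_Icc_self hy)).2
        (by positivity : 0 ≤ ε * Real.exp y)
      linarith
    · have := Real.exp_pos 0
      positivity
    · have := Real.exp_pos 0
      positivity
  by_contra! hneg
  have h := key (-f x / Real.exp x) (div_pos (neg_pos.2 hneg) (Real.exp_pos x))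
  rw [div_mul_cancel₀ _ (Real.exp_pos x).ne'] at h
  linarith

/-- Theorem A.1 (Futer–Kalfagianni–Purcell), part (d):
under the differential inequality `φ'' ≥ k·φ` on a closed interval `I ∋ 0`
with `0 ≤ k ≤ 1`, `φ(0) ≥ 0`, `φ'(0) = 0`, if `φ''(x₀) > 0` at some
`x₀ ∈ I` with `x₀ > 0`, then `φ(x) > 0` and `φ'(x) > 0` for all `x ∈ I`
with `x > x₀`. -/
theorem stmt_2 (I : Set ℝ) (hIclosed : IsClosed I) (hIconn : I.OrdConnected)
    (h0I : (0 : ℝ) ∈ I)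
    (k φ φ' φ'' : ℝ → ℝ)
    (hk : ∀ x ∈ I, 0 ≤ k x ∧ k x ≤ 1)
    (hderiv : ∀ x ∈ I, HasDerivWithinAt φ (φ' x) I x)
    (hC1 : ContinuousOn φ' I)
    (hderiv2 : ∀ x ∈ I, x ≠ 0 → HasDerivWithinAt φ' (φ'' x) I x)
    (hineq : ∀ x ∈ I, x ≠ 0 → k x * φ x ≤ φ'' x)
    (hφ0 : 0 ≤ φ 0) (hφ'0 : φ' 0 = 0)
    (x₀ : ℝ) (hx₀I : x₀ ∈ I) (hx₀pos' : 0 < x₀) (hx₀pos : 0 < φ'' x₀) :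
    ∀ x ∈ I, x₀ < x → 0 < φ x ∧ 0 < φ' x := by
  intro x hxI hx
  have hsub : Set.Icc 0 x ⊆ I := hIconn.out h0I hxI
  have hioo : Set.Ioo 0 x ⊆ I := Set.Ioo_subset_Icc_self.trans hsub
  have hd : ∀ y ∈ Set.Icc 0 x, HasDerivWithinAt φ (φ' y) (Set.Icc 0 x) y :=
    fun y hy => (hderiv y (hsub hy)).mono hsub
  have hd2 : ∀ y ∈ Set.Ioo 0 x, HasDerivWithinAt φ' (φ'' y) (Set.Icc 0 x) y :=
    fun y hy => (hderiv2 y (hioo hy) hy.1.ne').mono hsub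
  have hq : ∀ y ∈ Set.Ioo 0 x, k y * φ y ≤ φ'' y :=
    fun y hy => hineq y (hioo hy) hy.1.ne'
  have hnn := nonneg_of_mul_le_second_deriv (fun y hy => hk y (hsub hy)) hd (hC1.mono hsub)
    hd2 hq hφ0 hφ'0.ge
  obtain ⟨hm', -⟩ := monotoneOn_and_deriv_of_second_deriv_nonneg hd (hC1.mono hsub) hd2
    (fun y hy => (mul_nonneg (hk y (hioo hy)).1
      (hnn y (Set.Ioo_subset_Icc_self hy))).trans (hq y hy)) hφ'0.ge
  have hx₀ : x₀ ∈ Set.Icc 0 x := ⟨hx₀pos'.le, hx.le⟩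
  have hφ'x₀ : 0 ≤ φ' x₀ := hφ'0.ge.trans (hm' ⟨le_rfl, hx₀.1.trans hx₀.2⟩ hx₀ hx₀.1)
  have hpos : ∀ y ∈ Set.Ioc x₀ x, 0 < φ' y := by
    intro y hy
    by_contra! hle
    -- otherwise `φ'` is constant on `[x₀, y]`, so its derivative at `x₀` vanishes
    have hsy : Set.Icc x₀ y ⊆ Set.Icc 0 x := Set.Icc_subset_Icc hx₀.1 hy.2
    have hconst : ∀ z ∈ Set.Icc x₀ y, φ' z = 0 := fun z hz => le_antisymm
      ((hm' (hsy hz) (hsy ⟨hy.1.le, le_rfl⟩) hz.2).trans hle)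
      (hφ'x₀.trans (hm' hx₀ (hsy hz) hz.1))
    have hmem : x₀ ∈ Set.Icc x₀ y := ⟨le_rfl, hy.1.le⟩
    have h1 : HasDerivWithinAt φ' (φ'' x₀) (Set.Icc x₀ y) x₀ :=
      (hd2 x₀ ⟨hx₀pos', hx⟩).mono hsy
    have h2 : HasDerivWithinAt φ' 0 (Set.Icc x₀ y) x₀ :=
      (hasDerivWithinAt_const x₀ (Set.Icc x₀ y) (0 : ℝ)).congr hconst (hconst x₀ hmem)
    exact hx₀pos.ne' ((uniqueDiffOn_Icc hy.1 x₀ hmem).eq_deriv _ h1 h2)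
  refine ⟨(hnn x₀ hx₀).trans_lt ?_, hpos x ⟨hx, le_rfl⟩⟩
  have hs : Set.Icc x₀ x ⊆ Set.Icc 0 x := Set.Icc_subset_Icc_left hx₀.1
  have hstrict : StrictMonoOn φ (Set.Icc x₀ x) := by
    refine strictMonoOn_of_hasDerivWithinAt_pos (f' := φ') (convex_Icc x₀ x)
      (fun y hy => ((hd y (hs hy)).mono hs).continuousWithinAt) ?_ ?_
    · intro y hy
      exact (hd y (hs (interior_subset hy))).mono (interior_subset.trans hs)
    · intro y hy
      rw [interior_Icc] at hy
      exact hpos y ⟨hy.1, hy.2.le⟩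
  exact hstrict ⟨le_rfl, hx.le⟩ ⟨hx.le, le_rfl⟩ hx
end

section
/- Let I ⊆ ℝ be a closed interval containing 0, let k : I → ℝ satisfy 0 ≤ k(x) ≤ 1 for all x ∈ I, and let ψ : I → ℝ be a C¹ function such that ψ''(x) exists for every x ∈ I with x ≠ 0 and satisfies ψ''(x) ≥ k(x)·ψ(x) for all x ≠ 0. Assume ψ(0) ≥ 0 and ψ'(0) ≥ 0. Then ψ(x) ≥ 0 and ψ'(x) ≥ 0 for all x ∈ [0,1] ∩ I, and ψ''(x) ≥ 0 for all x ∈ [0,1] ∩ I with x ≠ 0. -/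
/-- If `f' ≥ g'` on the interior of `[a, b]`, then `f a - g a ≤ f x - g x` for `x ∈ [a, b]`. -/
lemma sub_le_sub_of_hasDerivWithinAt_le {a b : ℝ} {f f' g g' : ℝ → ℝ}
    (hf : ContinuousOn f (Set.Icc a b)) (hg : ContinuousOn g (Set.Icc a b))
    (hf' : ∀ x ∈ Set.Ioo a b, HasDerivWithinAt f (f' x) (Set.Ioo a b) x)
    (hg' : ∀ x ∈ Set.Ioo a b, HasDerivWithinAt g (g' x) (Set.Ioo a b) x)
    (hle : ∀ x ∈ Set.Ioo a b, g' x ≤ f' x) {x : ℝ} (hx : x ∈ Set.Icc a b) :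
    f a - g a ≤ f x - g x := by
  have hmono : MonotoneOn (fun y => f y - g y) (Set.Icc a b) := by
    refine monotoneOn_of_hasDerivWithinAt_nonneg (f' := fun y => f' y - g' y)
      (convex_Icc a b) (hf.sub hg) ?_ ?_ <;> rw [interior_Icc] <;> intro y hy
    · exact (hf' y hy).sub (hg' y hy)
    · exact sub_nonneg.2 (hle y hy)
  exact hmono ⟨le_rfl, hx.1.trans hx.2⟩ hx hx.1


/-- Lemma A.2 (Futer–Kalfagianni–Purcell), part (a):
if `ψ'' ≥ k·ψ` on a closed interval `I ∋ 0` (away from `0`), with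
`0 ≤ k ≤ 1`, `ψ(0) ≥ 0` and `ψ'(0) ≥ 0`, then `ψ ≥ 0` and `ψ' ≥ 0` on
`[0,1] ∩ I`, and `ψ'' ≥ 0` on `([0,1] ∩ I) \ {0}`. -/
theorem stmt_3 (I : Set ℝ) (hIclosed : IsClosed I) (hIconn : I.OrdConnected)
    (h0I : (0 : ℝ) ∈ I)
    (k ψ ψ' ψ'' : ℝ → ℝ)
    (hk : ∀ x ∈ I, 0 ≤ k x ∧ k x ≤ 1)
    (hderiv : ∀ x ∈ I, HasDerivWithinAt ψ (ψ' x) I x)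
    (hC1 : ContinuousOn ψ' I)
    (hderiv2 : ∀ x ∈ I, x ≠ 0 → HasDerivWithinAt ψ' (ψ'' x) I x)
    (hineq : ∀ x ∈ I, x ≠ 0 → k x * ψ x ≤ ψ'' x)
    (hψ0 : 0 ≤ ψ 0) (hψ'0 : 0 ≤ ψ' 0) :
    (∀ x ∈ Set.Icc (0 : ℝ) 1 ∩ I, 0 ≤ ψ x ∧ 0 ≤ ψ' x) ∧
    (∀ x ∈ Set.Icc (0 : ℝ) 1 ∩ I, x ≠ 0 → 0 ≤ ψ'' x) := by
  have hsub : ∀ {b : ℝ}, b ∈ I → Set.Icc 0 b ⊆ I := fun hb => hIconn.out h0I hb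
  have hsub' : ∀ {b : ℝ}, b ∈ I → Set.Ioo 0 b ⊆ I :=
    fun hb => Set.Ioo_subset_Icc_self.trans (hsub hb)
  have hψc : ContinuousOn ψ I := fun x hx => (hderiv x hx).continuousWithinAt
  have lower : ∀ m : ℝ, ∀ b ∈ I, (∀ x ∈ Set.Ioo 0 b, -m ≤ ψ'' x) →
      ∀ x ∈ Set.Icc 0 b, -m * x ≤ ψ' x := by
    intro m b hb hm x hx
    have h := sub_le_sub_of_hasDerivWithinAt_le (g := fun y => -m * y) (g' := fun _ => -m)
      (hC1.mono (hsub hb)) (by fun_prop)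
      (fun y hy => (hderiv2 y (hsub' hb hy) hy.1.ne').mono (hsub' hb))
      (fun y _ => by simpa using ((hasDerivAt_id y).const_mul (-m)).hasDerivWithinAt) hm hx
    simp only [mul_zero, sub_zero] at h
    linarith
  have hψ : ∀ x ∈ Set.Icc (0 : ℝ) 1 ∩ I, 0 ≤ ψ x := by
    rintro b ⟨hb, hbI⟩
    obtain ⟨c, hc, hmin⟩ := isCompact_Icc.exists_isMinOn
      (Set.nonempty_Icc.2 hb.1) (hψc.mono (hsub hbI))
    have hmin' : ∀ x ∈ Set.Icc 0 b, ψ c ≤ ψ x := fun x hx => hmin hx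
    refine le_trans ?_ (hmin' b ⟨hb.1, le_rfl⟩)
    by_contra! hneg
    have hψ'' : ∀ x ∈ Set.Ioo 0 b, -(-ψ c) ≤ ψ'' x := by
      intro x hx
      have hxI := hsub' hbI hx
      obtain ⟨hk0, hk1⟩ := hk x hxI
      have h1 := hineq x hxI hx.1.ne'
      have h2 := mul_le_mul_of_nonneg_left (hmin' x ⟨hx.1.le, hx.2.le⟩) hk0
      nlinarith
    have hψ' := lower (-ψ c) b hbI hψ''
    have h := sub_le_sub_of_hasDerivWithinAt_le (g := fun y => ψ c / 2 * y ^ 2)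
      (g' := fun y => ψ c * y) (hψc.mono (hsub hbI)) (by fun_prop)
      (fun y hy => (hderiv y (hsub' hbI hy)).mono (hsub' hbI))
      (fun y _ => (((hasDerivAt_pow 2 y).const_mul (ψ c / 2)).congr_deriv
        (by norm_num; ring)).hasDerivWithinAt)
      (fun y hy => by simpa using hψ' y ⟨hy.1.le, hy.2.le⟩) hc
    have hc2 : c ^ 2 ≤ 1 := pow_le_one₀ hc.1 (hc.2.trans hb.2)
    norm_num at h
    nlinarith
  have hψ'' : ∀ x ∈ Set.Icc (0 : ℝ) 1 ∩ I, x ≠ 0 → 0 ≤ ψ'' x := fun x hx hx0 =>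
    (mul_nonneg (hk x hx.2).1 (hψ x hx)).trans (hineq x hx.2 hx0)
  refine ⟨fun b hb => ⟨hψ b hb, ?_⟩, hψ''⟩
  simpa using lower 0 b hb.2 (fun x hx => by
    simpa using hψ'' x ⟨⟨hx.1.le, hx.2.le.trans hb.1.2⟩, hsub' hb.2 hx⟩ hx.1.ne') b
    ⟨hb.1.1, le_rfl⟩
end

section
/- Let I ⊆ ℝ be a closed interval containing 0, let k : I → ℝ satisfy 0 ≤ k(x) ≤ 1 for all x ∈ I, and let ψ : I → ℝ be a C¹ function such that ψ''(x) exists for every x ∈ I with x ≠ 0 and satisfies ψ''(x) ≥ k(x)·ψ(x) for all x ≠ 0. Assume ψ(0) ≥ 0 and ψ'(0) ≥ 0. If ψ''(x₀) > 0 or ψ'(x₀) > 0 for some x₀ ∈ [0,1) ∩ I, then ψ(x) > 0 and ψ'(x) > 0 for every x ∈ (x₀, 1] ∩ I. -/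
/-- If `f'' ≥ k·f` on `(0, b)` with `0 ≤ k ≤ 1` and `b ≤ 1`, and `f` and `f'` are nonnegative
at `0`, then `f' ≥ 0` on `[0, b]`. -/
theorem deriv_nonneg_of_mul_le_second_deriv {b : ℝ} (hb1 : b ≤ 1)
    {k f f' f'' : ℝ → ℝ}
    (hk : ∀ x ∈ Set.Ioo 0 b, 0 ≤ k x ∧ k x ≤ 1)
    (hf : ∀ x ∈ Set.Icc 0 b, HasDerivWithinAt f (f' x) (Set.Icc 0 b) x)
    (hf' : ContinuousOn f' (Set.Icc 0 b))
    (hf'' : ∀ x ∈ Set.Ioo 0 b, HasDerivWithinAt f' (f'' x) (Set.Icc 0 b) x)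
    (hineq : ∀ x ∈ Set.Ioo 0 b, k x * f x ≤ f'' x)
    (h0 : 0 ≤ f 0) (h0' : 0 ≤ f' 0) :
    ∀ x ∈ Set.Icc 0 b, 0 ≤ f' x := by
  intro c hc
  have hb0 : 0 ≤ b := hc.1.trans hc.2
  have h0mem : (0 : ℝ) ∈ Set.Icc 0 b := ⟨le_rfl, hb0⟩
  obtain ⟨a, ha, hmin⟩ := isCompact_Icc.exists_isMinOn ⟨0, h0mem⟩ hf'
  have hmin' : ∀ y ∈ Set.Icc 0 b, f' a ≤ f' y := fun y hy => hmin hy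
  refine le_trans ?_ (hmin' c hc)
  by_contra! hneg
  have hlow : ∀ y ∈ Set.Icc 0 b, f' a * y ≤ f y := by
    have hmono : MonotoneOn (fun y => f y - f' a * y) (Set.Icc 0 b) := by
      refine monotoneOn_of_hasDerivWithinAt_nonneg (f' := fun y => f' y - f' a * 1)
        (convex_Icc 0 b) ?_ ?_ ?_
      · exact ContinuousOn.sub (fun y hy => (hf y hy).continuousWithinAt) (by fun_prop)
      · intro y hy
        have hy' := interior_subset hy
        exact ((hf y hy').mono interior_subset).sub ((hasDerivWithinAt_id y _).const_mul _)
      · intro y hy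
        linarith [hmin' y (interior_subset hy)]
    intro y hy
    have := hmono h0mem hy hy.1
    simp only [mul_zero] at this
    linarith
  have hmono : MonotoneOn (fun y => f' y - f' a / 2 * y ^ 2) (Set.Icc 0 b) := by
    refine monotoneOn_of_hasDerivWithinAt_nonneg (f' := fun y => f'' y - f' a * y)
      (convex_Icc 0 b) ?_ ?_ ?_
    · exact hf'.sub (by fun_prop)
    · intro y hy
      have hy' : y ∈ Set.Ioo 0 b := by rwa [interior_Icc] at hy
      have h := ((hasDerivAt_pow 2 y).const_mul (f' a / 2)).hasDerivWithinAt
        (s := interior (Set.Icc 0 b))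
      refine (((hf'' y hy').mono interior_subset).sub h).congr_deriv ?_
      norm_num
      ring
    · intro y hy
      have hy' : y ∈ Set.Ioo 0 b := by rwa [interior_Icc] at hy
      have h1 := hlow y (interior_subset hy)
      have h2 := hineq y hy'
      obtain ⟨hk0, hk1⟩ := hk y hy'
      have h3 : f' a * y ≤ 0 := mul_nonpos_of_nonpos_of_nonneg hneg.le hy'.1.le
      have h4 : k y * (f' a * y) ≤ k y * f y := mul_le_mul_of_nonneg_left h1 hk0
      nlinarith
  have h := hmono h0mem ha ha.1
  simp only [ne_eq, OfNat.ofNat_ne_zero, not_false_eq_true, zero_pow, mul_zero, sub_zero] at h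
  have ha2 : a ^ 2 ≤ 1 := pow_le_one₀ ha.1 (ha.2.trans hb1)
  nlinarith


/-- Lemma A.2 (Futer–Kalfagianni–Purcell), part (b):
if `ψ'' ≥ k·ψ` on a closed interval `I ∋ 0` (away from `0`), with
`0 ≤ k ≤ 1`, `ψ(0) ≥ 0` and `ψ'(0) ≥ 0`, and if `ψ''(x₀) > 0` (with the
second derivative existing at `x₀`) or `ψ'(x₀) > 0` for some
`x₀ ∈ [0,1) ∩ I`, then `ψ > 0` and `ψ' > 0` on `(x₀, 1] ∩ I`. -/
theorem stmt_4 (I : Set ℝ) (hIclosed : IsClosed I) (hIconn : I.OrdConnected)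
    (h0I : (0 : ℝ) ∈ I)
    (k ψ ψ' ψ'' : ℝ → ℝ)
    (hk : ∀ x ∈ I, 0 ≤ k x ∧ k x ≤ 1)
    (hderiv : ∀ x ∈ I, HasDerivWithinAt ψ (ψ' x) I x)
    (hC1 : ContinuousOn ψ' I)
    (hderiv2 : ∀ x ∈ I, x ≠ 0 → HasDerivWithinAt ψ' (ψ'' x) I x)
    (hineq : ∀ x ∈ I, x ≠ 0 → k x * ψ x ≤ ψ'' x)
    (hψ0 : 0 ≤ ψ 0) (hψ'0 : 0 ≤ ψ' 0)
    (x₀ : ℝ) (hx₀ : x₀ ∈ Set.Ico (0 : ℝ) 1 ∩ I)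
    (hcase : (HasDerivWithinAt ψ' (ψ'' x₀) I x₀ ∧ 0 < ψ'' x₀) ∨ 0 < ψ' x₀) :
    ∀ x ∈ Set.Ioc x₀ 1 ∩ I, 0 < ψ x ∧ 0 < ψ' x := by
  rintro x ⟨⟨hx0x, hx1⟩, hxI⟩
  obtain ⟨⟨hx₀0, -⟩, hx₀I⟩ := hx₀
  have hsub : Set.Icc 0 x ⊆ I := hIconn.out h0I hxI
  have h0mem : (0 : ℝ) ∈ Set.Icc 0 x := ⟨le_rfl, hx₀0.trans hx0x.le⟩
  have hx₀mem : x₀ ∈ Set.Icc 0 x := ⟨hx₀0, hx0x.le⟩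
  have hxmem : x ∈ Set.Icc 0 x := ⟨h0mem.2, le_rfl⟩
  have hioo : ∀ y ∈ Set.Ioo 0 x, y ∈ I := fun y hy => hsub (Set.Ioo_subset_Icc_self hy)
  have hψ : ContinuousOn ψ (Set.Icc 0 x) :=
    fun y hy => ((hderiv y (hsub hy)).mono hsub).continuousWithinAt
  have hnonneg' : ∀ y ∈ Set.Icc 0 x, 0 ≤ ψ' y :=
    deriv_nonneg_of_mul_le_second_deriv hx1 (fun y hy => hk y (hioo y hy))
      (fun y hy => (hderiv y (hsub hy)).mono hsub) (hC1.mono hsub)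
      (fun y hy => (hderiv2 y (hioo y hy) hy.1.ne').mono hsub)
      (fun y hy => hineq y (hioo y hy) hy.1.ne') hψ0 hψ'0
  have hmono : MonotoneOn ψ (Set.Icc 0 x) :=
    monotoneOn_of_hasDerivWithinAt_nonneg (convex_Icc 0 x) hψ
      (fun y hy => (hderiv y (hsub (interior_subset hy))).mono (interior_subset.trans hsub))
      (fun y hy => hnonneg' y (interior_subset hy))
  have hnonneg : ∀ y ∈ Set.Icc 0 x, 0 ≤ ψ y := fun y hy => hψ0.trans (hmono h0mem hy hy.1)
  have hmono' : MonotoneOn ψ' (Set.Icc 0 x) := by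
    refine monotoneOn_of_hasDerivWithinAt_nonneg (f' := ψ'') (convex_Icc 0 x) (hC1.mono hsub)
      ?_ ?_ <;> intro y hy <;> rw [interior_Icc] at hy
    · rw [interior_Icc]
      exact (hderiv2 y (hioo y hy) hy.1.ne').mono hioo
    · exact (mul_nonneg (hk y (hioo y hy)).1 (hnonneg y (Set.Ioo_subset_Icc_self hy))).trans
        (hineq y (hioo y hy) hy.1.ne')
  have hpos' : ∀ y ∈ Set.Ioc x₀ x, 0 < ψ' y := by
    intro y hy
    have hymem : y ∈ Set.Icc 0 x := ⟨hx₀0.trans hy.1.le, hy.2⟩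
    rcases hcase with ⟨hd, hpos⟩ | hpos
    · by_contra! hle
      have hsub' : Set.Icc x₀ y ⊆ Set.Icc 0 x := Set.Icc_subset_Icc hx₀0 hy.2
      have hzero : ∀ z ∈ Set.Icc x₀ y, ψ' z = 0 := fun z hz =>
        le_antisymm ((hmono' (hsub' hz) hymem hz.2).trans hle) (hnonneg' z (hsub' hz))
      have hconst : HasDerivWithinAt ψ' 0 (Set.Icc x₀ y) x₀ :=
        (hasDerivWithinAt_const x₀ (Set.Icc x₀ y) (0 : ℝ)).congr hzero
          (hzero x₀ ⟨le_rfl, hy.1.le⟩)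
      have huniq := (uniqueDiffOn_Icc hy.1 x₀ ⟨le_rfl, hy.1.le⟩).eq_deriv _
        (hd.mono (hsub'.trans hsub)) hconst
      exact hpos.ne' huniq
    · exact hpos.trans_le (hmono' hx₀mem hymem hy.1.le)
  have hsub₀ : Set.Icc x₀ x ⊆ Set.Icc 0 x := Set.Icc_subset_Icc_left hx₀0
  have hstrict : StrictMonoOn ψ (Set.Icc x₀ x) := by
    refine strictMonoOn_of_hasDerivWithinAt_pos (f' := ψ') (convex_Icc x₀ x) (hψ.mono hsub₀)
      ?_ ?_ <;> intro y hy
    · exact (hderiv y (hsub (hsub₀ (interior_subset hy)))).mono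
        (interior_subset.trans (hsub₀.trans hsub))
    · rw [interior_Icc] at hy
      exact hpos' y ⟨hy.1, hy.2.le⟩
  exact ⟨(hnonneg x₀ hx₀mem).trans_lt (hstrict ⟨le_rfl, hx0x.le⟩ ⟨hx0x.le, le_rfl⟩ hx0x),
    hpos' x ⟨hx0x, le_rfl⟩⟩
end

section
/- Let ℓ₁ > 0 and let k₁, k₂ : ℝ → ℝ satisfy 0 ≤ k₁(r) ≤ k₂(r) ≤ 1 for all r ∈ ℝ. For i = 1, 2, let fᵢ : ℝ → ℝ be a C¹ function, twice differentiable on ℝ, with fᵢ''(r) = kᵢ(r)·fᵢ(r) for all r and fᵢ(0) = fᵢ'(0) = ℓ₁. Suppose r₀ < 0 is such that f₂(r) > 0 for all r ∈ (r₀, 0]. Then f₁(r) ≤ f₂(r) and f₁'(r) ≥ f₂'(r) for all r ∈ [r₀, 0]. Moreover, if k₁(x₀) < k₂(x₀) for some x₀ ∈ (r₀, 0), then f₁(r) < f₂(r) and f₁'(r) > f₂'(r) for all r ∈ [r₀, x₀). -/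
open Set

/-- A function with positive value and nonpositive slope at the right endpoint of an
interval, and which is convex wherever it is positive, stays positive on the interval. -/
lemma pos_of_convex_where_pos {g g' g'' : ℝ → ℝ} {a b : ℝ}
    (hg : ∀ r, HasDerivAt g (g' r) r) (hg' : ∀ r, HasDerivAt g' (g'' r) r)
    (hb : 0 < g b) (hb' : g' b ≤ 0) (hconv : ∀ r ∈ Ioo a b, 0 < g r → 0 ≤ g'' r) :
    ∀ r ∈ Icc a b, 0 < g r := by
  by_contra! ⟨t, ht, hgt⟩
  have hcont : Continuous g := continuous_iff_continuousAt.2 fun x => (hg x).continuousAt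
  have hcont' : Continuous g' := continuous_iff_continuousAt.2 fun x => (hg' x).continuousAt
  have hcomp : IsCompact (Icc a b ∩ {x | g x ≤ 0}) :=
    isCompact_Icc.inter_right (isClosed_le hcont continuous_const)
  obtain ⟨s, ⟨hs, hgs⟩, hmax⟩ := hcomp.exists_isGreatest ⟨t, ht, hgt⟩
  have hpos : ∀ x ∈ Ioo s b, 0 < g x := by
    intro x hx
    by_contra! h
    exact absurd (hmax ⟨⟨hs.1.trans hx.1.le, hx.2.le⟩, h⟩) (not_le.2 hx.1)
  have hmono : MonotoneOn g' (Icc s b) := by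
    refine monotoneOn_of_hasDerivWithinAt_nonneg (convex_Icc s b) hcont'.continuousOn
      (fun x _ => (hg' x).hasDerivWithinAt) fun x hx => ?_
    rw [interior_Icc] at hx
    exact hconv x ⟨hs.1.trans_lt hx.1, hx.2⟩ (hpos x hx)
  have hanti : AntitoneOn g (Icc s b) := by
    refine antitoneOn_of_hasDerivWithinAt_nonpos (convex_Icc s b) hcont.continuousOn
      (fun x _ => (hg x).hasDerivWithinAt) fun x hx => ?_
    exact (hmono (interior_subset hx) (right_mem_Icc.2 hs.2) (interior_subset hx).2).trans hb'
  have := hanti (left_mem_Icc.2 hs.2) (right_mem_Icc.2 hs.2) hs.2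
  exact absurd (hb.trans_le this) (not_lt.2 hgs)

/-- If `h'' ≥ k * h` with `0 ≤ k ≤ 1` on `(a, 0)` and `h` vanishes to first order at `0`, then `h`
is nonnegative on `[a, 0]`. -/
lemma nonneg_of_second_deriv_ge_mul {h h' h'' k : ℝ → ℝ} {a : ℝ}
    (hh : ∀ r, HasDerivAt h (h' r) r) (hh' : ∀ r, HasDerivAt h' (h'' r) r)
    (hk : ∀ r, 0 ≤ k r ∧ k r ≤ 1) (h0 : h 0 = 0) (h0' : h' 0 = 0)
    (hge : ∀ r ∈ Ioo a 0, k r * h r ≤ h'' r) :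
    ∀ r ∈ Icc a 0, 0 ≤ h r := by
  intro r hr
  have hexp : ∀ x : ℝ, HasDerivAt (fun y => Real.exp (-y)) (-Real.exp (-x)) x := fun x => by
    simpa using (hasDerivAt_neg x).exp
  have key : ∀ ε > 0, 0 < h r + ε * Real.exp (-r) := by
    intro ε hε
    refine pos_of_convex_where_pos (g := fun x => h x + ε * Real.exp (-x))
      (g' := fun x => h' x + ε * -Real.exp (-x)) (g'' := fun x => h'' x + ε * - -Real.exp (-x))
      (fun x => (hh x).add ((hexp x).const_mul ε))
      (fun x => (hh' x).add ((hexp x).neg.const_mul ε)) ?_ ?_ ?_ r hr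
    · simpa [h0] using hε
    · simpa [h0'] using hε.le
    · intro x hx hgx
      have hE : 0 < ε * Real.exp (-x) := by positivity
      nlinarith [hge x hx, mul_nonneg (hk x).1 hgx.le, mul_nonneg (sub_nonneg.2 (hk x).2) hE.le]
  by_contra! hneg
  have := key (-h r / Real.exp (-r)) (div_pos (neg_pos.2 hneg) (Real.exp_pos _))
  rw [div_mul_cancel₀ _ (Real.exp_pos _).ne'] at this
  linarith


/-- Lemma 2.6 (a)/(b) of Futer–Kalfagianni–Purcell (monotonicity of solutions
in the coefficient function): if `0 ≤ k₁ ≤ k₂ ≤ 1`, `fᵢ'' = kᵢ·fᵢ`,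
`fᵢ(0) = fᵢ'(0) = ℓ₁`, and `f₂ > 0` on `(r₀, 0]` for some `r₀ < 0`, then
`f₁ ≤ f₂` and `f₁' ≥ f₂'` on `[r₀, 0]`, with strict inequalities on
`[r₀, x₀)` if `k₁(x₀) < k₂(x₀)` for some `x₀ ∈ (r₀, 0)`. -/
theorem stmt_6 (ℓ₁ : ℝ) (hℓ : 0 < ℓ₁)
    (k₁ k₂ f₁ f₂ f₁' f₂' : ℝ → ℝ)
    (hk : ∀ r, 0 ≤ k₁ r ∧ k₁ r ≤ k₂ r ∧ k₂ r ≤ 1)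
    (hf₁ : ∀ r, HasDerivAt f₁ (f₁' r) r)
    (hf₁' : ∀ r, HasDerivAt f₁' (k₁ r * f₁ r) r)
    (hf₂ : ∀ r, HasDerivAt f₂ (f₂' r) r)
    (hf₂' : ∀ r, HasDerivAt f₂' (k₂ r * f₂ r) r)
    (hf₁0 : f₁ 0 = ℓ₁) (hf₁'0 : f₁' 0 = ℓ₁)
    (hf₂0 : f₂ 0 = ℓ₁) (hf₂'0 : f₂' 0 = ℓ₁)
    (r₀ : ℝ) (hr₀ : r₀ < 0) (hpos : ∀ r ∈ Set.Ioc r₀ (0 : ℝ), 0 < f₂ r) :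
    (∀ r ∈ Set.Icc r₀ (0 : ℝ), f₁ r ≤ f₂ r ∧ f₂' r ≤ f₁' r) ∧
    (∀ x₀ ∈ Set.Ioo r₀ (0 : ℝ), k₁ x₀ < k₂ x₀ →
      ∀ r ∈ Set.Ico r₀ x₀, f₁ r < f₂ r ∧ f₂' r < f₁' r) := by
  have hh : ∀ r, HasDerivAt (fun x => f₂ x - f₁ x) (f₂' r - f₁' r) r := fun r =>
    (hf₂ r).sub (hf₁ r)
  have hh' : ∀ r, HasDerivAt (fun x => f₂' x - f₁' x) (k₂ r * f₂ r - k₁ r * f₁ r) r := fun r =>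
    (hf₂' r).sub (hf₁' r)
  have hcont := continuous_iff_continuousAt.2 fun x => (hh x).continuousAt
  have hcont' := continuous_iff_continuousAt.2 fun x => (hh' x).continuousAt
  have hnonneg : ∀ r ∈ Icc r₀ 0, 0 ≤ f₂ r - f₁ r := by
    refine nonneg_of_second_deriv_ge_mul hh hh'
      (fun r => ⟨(hk r).1, (hk r).2.1.trans (hk r).2.2⟩) (by simp [hf₁0, hf₂0])
      (by simp [hf₁'0, hf₂'0]) fun r hr => ?_
    nlinarith [mul_nonneg (sub_nonneg.2 (hk r).2.1) (hpos r ⟨hr.1, hr.2.le⟩).le]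
  have hmono : MonotoneOn (fun x => f₂' x - f₁' x) (Icc r₀ 0) := by
    refine monotoneOn_of_hasDerivWithinAt_nonneg (convex_Icc r₀ 0) hcont'.continuousOn
      (fun x _ => (hh' x).hasDerivWithinAt) fun x hx => ?_
    rw [interior_Icc] at hx
    nlinarith [mul_nonneg (sub_nonneg.2 (hk x).2.1) (hpos x ⟨hx.1, hx.2.le⟩).le,
      mul_nonneg (hk x).1 (hnonneg x ⟨hx.1.le, hx.2.le⟩)]
  have hnonpos : ∀ r ∈ Icc r₀ 0, f₂' r - f₁' r ≤ 0 := fun r hr => by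
    simpa [hf₁'0, hf₂'0] using hmono hr (right_mem_Icc.2 hr₀.le) hr.2
  refine ⟨fun r hr => ⟨sub_nonneg.1 (hnonneg r hr), sub_nonpos.1 (hnonpos r hr)⟩, ?_⟩
  intro x₀ hx₀ hlt
  have hneg : ∀ r ∈ Ico r₀ x₀, f₂' r - f₁' r < 0 := by
    intro r hr
    have hr' : r ∈ Icc r₀ 0 := ⟨hr.1, (hr.2.trans hx₀.2).le⟩
    refine (hnonpos r hr').lt_of_ne fun heq => ?_
    have hzero : (fun x => f₂' x - f₁' x) =ᶠ[nhds x₀] fun _ => 0 := by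
      filter_upwards [Ioo_mem_nhds hr.2 hx₀.2] with x hx
      have hx' : x ∈ Icc r₀ 0 := ⟨hr.1.trans hx.1.le, hx.2.le⟩
      exact (hnonpos x hx').antisymm (heq.symm.trans_le (hmono hr' hx' hx.1.le))
    have hd := (hh' x₀).unique ((hasDerivAt_const x₀ (0 : ℝ)).congr_of_eventuallyEq hzero)
    nlinarith [mul_pos (sub_pos.2 hlt) (hpos x₀ ⟨hx₀.1, hx₀.2.le⟩),
      mul_nonneg (hk x₀).1 (hnonneg x₀ ⟨hx₀.1.le, hx₀.2.le⟩)]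
  intro r hr
  refine ⟨sub_pos.1 ?_, sub_neg.1 (hneg r hr)⟩
  have hanti : StrictAntiOn (fun x => f₂ x - f₁ x) (Icc r x₀) := by
    refine strictAntiOn_of_hasDerivWithinAt_neg (convex_Icc r x₀) hcont.continuousOn
      (fun x _ => (hh x).hasDerivWithinAt) fun x hx => ?_
    rw [interior_Icc] at hx
    exact hneg x ⟨hr.1.trans hx.1.le, hx.2⟩
  exact (hnonneg x₀ ⟨hx₀.1.le, hx₀.2.le⟩).trans_lt
    (hanti (left_mem_Icc.2 hr.2.le) (right_mem_Icc.2 hr.2.le) hr.2)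
end

section
/- Let ℓ₁ > 0 and let k : ℝ → ℝ satisfy 0 ≤ k(r) ≤ 1 for all r ∈ ℝ. Let f : ℝ → ℝ be a C¹ function, twice differentiable on ℝ, satisfying f''(r) = k(r)·f(r) for all r and f(0) = f'(0) = ℓ₁. Then f'(r) > 0 for every r ∈ ℝ. -/
/-- Lemma 2.6 (c) of Futer–Kalfagianni–Purcell: if `0 ≤ k ≤ 1`,
`f'' = k·f` on `ℝ`, and `f(0) = f'(0) = ℓ₁ > 0`, then `f' > 0` everywhere. -/
theorem stmt_7 (ℓ₁ : ℝ) (hℓ : 0 < ℓ₁)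
    (k f f' : ℝ → ℝ)
    (hk : ∀ r, 0 ≤ k r ∧ k r ≤ 1)
    (hf : ∀ r, HasDerivAt f (f' r) r)
    (hf' : ∀ r, HasDerivAt f' (k r * f r) r)
    (hf0 : f 0 = ℓ₁) (hf'0 : f' 0 = ℓ₁) :
    ∀ r, 0 < f' r := by
  have cf : Continuous f := continuous_iff_continuousAt.2 fun r => (hf r).continuousAt
  have cf' : Continuous f' := continuous_iff_continuousAt.2 fun r => (hf' r).continuousAt
  have product_mono : Monotone (fun r => f r * f' r) :=
    monotone_of_hasDerivAt_nonneg (fun r => (hf r).mul (hf' r)) fun r => by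
      have := mul_nonneg (hk r).1 (sq_nonneg (f r))
      show 0 ≤ f' r * f' r + f r * (k r * f r)
      nlinarith [sq_nonneg (f' r)]
  have energy_anti : Antitone (fun r => Real.exp (-2 * r) * (f r ^ 2 + f' r ^ 2)) :=
    antitone_of_hasDerivAt_nonpos
      (fun r => (((hasDerivAt_id r).const_mul (-2)).exp).mul
        (((hf r).pow 2).add ((hf' r).pow 2))) fun r => by
      have h : 2 * (1 + k r) * (f r * f' r) ≤ 2 * (f r ^ 2 + f' r ^ 2) := by
        have h₁ := mul_nonneg (sub_nonneg.2 (hk r).2)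
          (add_nonneg (sq_nonneg (f r)) (sq_nonneg (f' r)))
        have h₂ := mul_nonneg (add_nonneg zero_le_one (hk r).1) (sq_nonneg (f r - f' r))
        linarith
      have := mul_nonneg (Real.exp_pos (-2 * r)).le (sub_nonneg.2 h)
      simp only [Pi.zero_apply, id]
      push_cast
      linarith
  have ne_zero : ∀ c, f' c ≠ 0 := by
    intro c hc
    have c_neg : c < 0 := by
      by_contra! h
      have := product_mono h
      simp only [hc, hf0, hf'0, mul_zero] at this
      nlinarith
    by_cases hpos : ∀ x ∈ Set.Icc c 0, 0 < f x
    · have anti : AntitoneOn (fun r => Real.exp r * (f' r - f r)) (Set.Icc c 0) := by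
        refine antitoneOn_of_hasDerivWithinAt_nonpos (convex_Icc c 0) (by fun_prop)
          (fun x _ => ((Real.hasDerivAt_exp x).mul
            ((hf' x).sub (hf x))).hasDerivWithinAt) fun x hx => ?_
        have h := mul_nonneg (sub_nonneg.2 (hk x).2) (hpos x (interior_subset hx)).le
        have := mul_nonneg (Real.exp_pos x).le h
        simp only [Pi.sub_apply]
        linarith
      have := anti (Set.left_mem_Icc.2 c_neg.le) (Set.right_mem_Icc.2 c_neg.le) c_neg.le
      simp only [hc, hf0, hf'0, sub_self, mul_zero] at this
      nlinarith [mul_pos (Real.exp_pos c) (hpos c (Set.left_mem_Icc.2 c_neg.le))]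
    · push Not at hpos
      obtain ⟨x, hx, hfx⟩ := hpos
      obtain ⟨d, hd, hfd⟩ := intermediate_value_Icc hx.2 cf.continuousOn
        (show (0 : ℝ) ∈ Set.Icc (f x) (f 0) from ⟨hfx, hf0 ▸ hℓ.le⟩)
      have sq_mono : MonotoneOn (fun r => f r ^ 2) (Set.Ici c) := by
        refine monotoneOn_of_hasDerivWithinAt_nonneg (convex_Ici c) (by fun_prop)
          (fun y _ => ((hf y).pow 2).hasDerivWithinAt) fun y hy => ?_
        have h := product_mono (interior_subset hy : c ≤ y)
        simp only [hc, mul_zero] at h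
        push_cast
        linarith
      have hcd : c ≤ d := hx.1.trans hd.1
      have h := sq_mono Set.self_mem_Ici hcd hcd
      simp only [hfd] at h
      have hfc : f c = 0 := by nlinarith
      have h := energy_anti c_neg.le
      simp only [hfc, hc, hf0, hf'0, mul_zero, Real.exp_zero] at h
      nlinarith
  intro r
  by_contra! hr
  obtain ⟨c, hc⟩ := mem_range_of_exists_le_of_exists_ge cf' ⟨r, hr⟩ ⟨0, hf'0 ▸ hℓ.le⟩
  exact ne_zero c hc
end

section
/- Let ℓ₁ > 0, t ∈ (0,1) and ε ≥ 0, and let k : ℝ → ℝ be a bump function with parameters (t, ε). Let f : ℝ → ℝ be a C¹ function with f(0) = f'(0) = ℓ₁ that is twice differentiable with f''(r) = k(r)·f(r) at every r at which k is continuous. Then f has exactly one zero r₀ in ℝ, and r₀ < min(−ε/2, −1). -/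
/-- A continuous function whose derivative, at every continuity point of a monotone function `k`,
equals `p + k * q` with `p` and `q` continuous, is nondecreasing across an interval on which
`p + k * q` is nonnegative. -/
theorem le_of_hasDerivAt_nonneg_of_continuousAt {k F p q : ℝ → ℝ} (hk : Monotone k)
    (hF : Continuous F) (hp : Continuous p) (hq : Continuous q)
    (hd : ∀ r, ContinuousAt k r → HasDerivAt F (p r + k r * q r) r)
    {a b : ℝ} (hab : a ≤ b) (hnn : ∀ r, a ≤ r → r ≤ b → 0 ≤ p r + k r * q r) :
    F a ≤ F b := by
  have hint : IntervalIntegrable (fun r => p r + k r * q r) MeasureTheory.volume a b :=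
    (hp.intervalIntegrable a b).add (hk.intervalIntegrable.mul_continuousOn hq.continuousOn)
  have h := MeasureTheory.integral_eq_of_hasDerivAt_off_countable_of_le F _ hab
    hk.countable_not_continuousAt hF.continuousOn
    (fun x hx => hd x (not_not.mp hx.2)) hint
  have h0 : 0 ≤ ∫ x in a..b, (p x + k x * q x) :=
    intervalIntegral.integral_nonneg hab fun r hr => hnn r hr.1 hr.2
  linarith

/-- A differentiable function is nondecreasing across an interval on which its continuous
derivative is nonnegative. -/
theorem le_of_hasDerivAt_nonneg {F p : ℝ → ℝ} (hp : Continuous p)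
    (hd : ∀ r, HasDerivAt F (p r) r)
    {a b : ℝ} (hab : a ≤ b) (hnn : ∀ r, a ≤ r → r ≤ b → 0 ≤ p r) :
    F a ≤ F b :=
  le_of_hasDerivAt_nonneg_of_continuousAt (k := fun _ => 0) (q := fun _ => 0) monotone_const
    (continuous_iff_continuousAt.mpr fun r => (hd r).continuousAt) hp continuous_const
    (fun r _ => by simpa using hd r) hab (fun r h1 h2 => by simpa using hnn r h1 h2)


/-- Existence and uniqueness of the root of `f_{t,ε}` together with
Lemma 2.9 of Futer–Kalfagianni–Purcell: for a bump function `k` with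
parameters `(t, ε)` and a `C¹` solution `f` of `f'' = k·f` (at every
continuity point of `k`) with `f(0) = f'(0) = ℓ₁ > 0`, the function `f`
has exactly one zero `r₀`, and `r₀ < min(-ε/2, -1)`. -/
theorem stmt_8 (ℓ₁ t ε : ℝ) (hℓ : 0 < ℓ₁) (ht : t ∈ Set.Ioo (0 : ℝ) 1)
    (hε : 0 ≤ ε)
    (k : ℝ → ℝ) (hkmono : Monotone k)
    (hkb : ∀ r, t ≤ k r ∧ k r ≤ 1)
    (hkl : ∀ r ≤ -ε, k r = t)
    (hkr : ∀ r, -ε / 2 ≤ r → k r = 1)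
    (f f' : ℝ → ℝ)
    (hf : ∀ r, HasDerivAt f (f' r) r)
    (hC1 : Continuous f')
    (hf0 : f 0 = ℓ₁) (hf'0 : f' 0 = ℓ₁)
    (hode : ∀ r, ContinuousAt k r → HasDerivAt f' (k r * f r) r) :
    ∃ r₀, f r₀ = 0 ∧ (∀ r, f r = 0 → r = r₀) ∧ r₀ < min (-ε / 2) (-1) := by
  obtain ⟨ht0, ht1⟩ := ht
  have hεpos : 0 < ε := by
    rcases hε.lt_or_eq with h | h
    · exact h
    · have h1 := hkl 0 (by simp [← h])
      have h2 := hkr 0 (by simp [← h])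
      linarith
  have hfc : Continuous f := continuous_iff_continuousAt.mpr fun r => (hf r).continuousAt
  -- `H = e^r (f - f')` has derivative `(1 - k) e^r f`
  set H : ℝ → ℝ := fun r => Real.exp r * (f r - f' r) with hHdef
  have hHc : Continuous H := by fun_prop
  have hHd : ∀ r, ContinuousAt k r →
      HasDerivAt H (Real.exp r * f r + k r * (-(Real.exp r * f r))) r := fun r hr => by
    refine ((Real.hasDerivAt_exp r).mul ((hf r).sub (hode r hr))).congr_deriv ?_
    simp only [Pi.sub_apply]
    ring
  have hH0 : H 0 = 0 := by simp [hHdef, hf0, hf'0]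
  have hHmono : ∀ a b, a ≤ b → (∀ r, a ≤ r → r ≤ b → 0 ≤ f r) → H a ≤ H b := by
    intro a b hab hnn
    refine le_of_hasDerivAt_nonneg_of_continuousAt (p := fun r => Real.exp r * f r)
      (q := fun r => -(Real.exp r * f r)) hkmono hHc (by fun_prop) (by fun_prop) hHd hab ?_
    intro r h1 h2
    have := mul_nonneg (mul_nonneg (Real.exp_pos r).le (hnn r h1 h2)) (sub_nonneg.mpr (hkb r).2)
    linarith
  -- `G = e^{-r} f` has derivative `e^{-r} (f' - f)`
  set G : ℝ → ℝ := fun r => Real.exp (-r) * f r with hGdef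
  have hGd : ∀ r, HasDerivAt G (Real.exp (-r) * (f' r - f r)) r := fun r => by
    refine ((hasDerivAt_neg r).exp.mul (hf r)).congr_deriv ?_
    ring
  have hGH : ∀ r, Real.exp (-r) * (f' r - f r) = -(Real.exp (-r) * Real.exp (-r) * H r) := by
    intro r
    have : Real.exp (-r) * Real.exp r = 1 := by rw [← Real.exp_add]; simp
    simp only [hHdef]
    linear_combination (Real.exp (-r) * (f r - f' r)) * this
  have hG0 : G 0 = ℓ₁ := by simp [hGdef, hf0]
  have hGconst : ∀ a b, a ≤ b → (∀ r, a ≤ r → r ≤ b → H r = 0) → G a = G b := by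
    intro a b hab hz
    apply le_antisymm
    · exact le_of_hasDerivAt_nonneg (by fun_prop) hGd hab fun r h1 h2 => by
        rw [hGH, hz r h1 h2]; simp
    · have := le_of_hasDerivAt_nonneg (F := fun r => -G r) (by fun_prop)
        (fun r => (hGd r).neg) hab fun r h1 h2 => by
          rw [hGH, hz r h1 h2]; simp
      simpa using this
  have hfG : ∀ r, f r = G r * Real.exp r := fun r => by
    have : Real.exp (-r) * Real.exp r = 1 := by rw [← Real.exp_add]; simp
    simp only [hGdef]
    linear_combination (-f r) * this
  -- `f = ℓ₁ e^r` where `k = 1`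
  have hHconst : ∀ a b, a ≤ b → -ε / 2 ≤ a → H a = H b := by
    intro a b hab ha
    apply le_antisymm
    · refine le_of_hasDerivAt_nonneg_of_continuousAt (p := fun r => Real.exp r * f r)
        (q := fun r => -(Real.exp r * f r)) hkmono hHc (by fun_prop) (by fun_prop) hHd hab ?_
      intro r h1 h2
      rw [hkr r (by linarith)]
      simp
    · have := le_of_hasDerivAt_nonneg_of_continuousAt (F := fun r => -H r)
        (p := fun r => -(Real.exp r * f r))
        (q := fun r => Real.exp r * f r) hkmono hHc.neg (by fun_prop) (by fun_prop)
        (fun r hr => by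
          refine (hHd r hr).neg.congr_deriv ?_
          ring) hab (fun r h1 h2 => by
          rw [hkr r (by linarith)]
          simp)
      simpa using this
  have hHz : ∀ r, -ε / 2 ≤ r → H r = 0 := by
    intro r hr
    rcases le_total r 0 with h | h
    · rw [hHconst r 0 h hr, hH0]
    · rw [← hHconst 0 r h (by linarith), hH0]
  have hfexp : ∀ r, -ε / 2 ≤ r → f r = ℓ₁ * Real.exp r := by
    intro r hr
    rw [hfG r]
    rcases le_total r 0 with h | h
    · rw [hGconst r 0 h (fun s h1 _ => hHz s (by linarith)), hG0]
    · rw [← hGconst 0 r h (fun s h1 _ => hHz s (by linarith)), hG0]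
  have hfpos : ∀ r, -ε / 2 ≤ r → 0 < f r := fun r hr => by
    rw [hfexp r hr]; positivity
  have hpos_of_ne : ∀ c, (∀ r, c ≤ r → f r ≠ 0) → ∀ r, c ≤ r → 0 < f r := by
    intro c hc r hr
    by_contra! hle
    have hr0 : r ≤ 0 := by
      by_contra! h
      linarith [hfpos r (by linarith)]
    obtain ⟨s, hs, hs0⟩ := intermediate_value_Icc hr0 hfc.continuousOn
      (show (0 : ℝ) ∈ Set.Icc (f r) (f 0) from ⟨hle, by linarith⟩)
    exact hc s (hr.trans hs.1) hs0
  have hex : ∃ r, f r = 0 := by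
    by_contra! hne
    have hfp : ∀ r, 0 < f r := fun r => hpos_of_ne r (fun s _ => hne s) r le_rfl
    have hHm : Monotone H := fun a b hab => hHmono a b hab fun r _ _ => (hfp r).le
    have hstrict : H (-ε - 1) < H (-ε) := by
      refine strictMonoOn_of_deriv_pos (convex_Icc (-ε - 1) (-ε)) hHc.continuousOn ?_
        (Set.left_mem_Icc.mpr (by linarith)) (Set.right_mem_Icc.mpr (by linarith)) (by linarith)
      intro r hr
      rw [interior_Icc] at hr
      have hkc : ContinuousAt k r := by
        refine (continuousAt_const (y := t)).congr ?_
        filter_upwards [Iio_mem_nhds hr.2] with s hs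
        exact (hkl s (le_of_lt hs)).symm
      rw [(hHd r hkc).deriv, hkl r hr.2.le]
      have := mul_pos (mul_pos (Real.exp_pos r) (hfp r)) (sub_pos.mpr ht1)
      linarith
    have hHle : H (-ε) ≤ 0 := hH0 ▸ hHm (by linarith : -ε ≤ 0)
    set c := -H (-ε - 1) with hc
    have hcpos : 0 < c := by linarith
    have hGpos : 0 < G (-ε - 1) := mul_pos (Real.exp_pos _) (hfp _)
    have hx : -ε - 1 - G (-ε - 1) / c ≤ -ε - 1 := by
      have := div_pos hGpos hcpos
      linarith
    have hle := le_of_hasDerivAt_nonneg (F := fun r => G r - c * r)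
      (p := fun r => Real.exp (-r) * (f' r - f r) - c) (by fun_prop)
      (fun r => ((hGd r).sub ((hasDerivAt_id r).const_mul c)).congr_deriv (by simp)) hx
      (fun r _ h2 => by
        rw [hGH]
        have h3 : H r ≤ -c := by rw [hc, neg_neg]; exact hHm h2
        have h4 : 1 ≤ Real.exp (-r) := Real.one_le_exp (by linarith)
        nlinarith [mul_le_mul h4 h4 zero_le_one (by linarith)])
    have h5 : c * (G (-ε - 1) / c) = G (-ε - 1) := mul_div_cancel₀ _ hcpos.ne'
    have h6 : 0 < G (-ε - 1 - G (-ε - 1) / c) := mul_pos (Real.exp_pos _) (hfp _)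
    nlinarith
  -- the largest zero
  have hlt : ∀ r, f r = 0 → r < -ε / 2 := fun r hr => by
    by_contra! h
    linarith [hfpos r h]
  have hbdd : BddAbove {r | f r = 0} := ⟨-ε / 2, fun r hr => (hlt r hr).le⟩
  have hcl : IsClosed {r | f r = 0} := isClosed_eq hfc continuous_const
  obtain ⟨r₀, hr₀, hmax⟩ : ∃ r₀, f r₀ = 0 ∧ ∀ r, f r = 0 → r ≤ r₀ :=
    ⟨_, hcl.csSup_mem hex hbdd, fun r hr => le_csSup hbdd hr⟩
  have hr₀lt := hlt r₀ hr₀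
  have hnn : ∀ r, r₀ ≤ r → 0 ≤ f r := by
    intro r hr
    rcases hr.eq_or_lt with rfl | h
    · exact hr₀.ge
    · refine (hpos_of_ne r (fun s hs hs0 => ?_) r le_rfl).le
      linarith [hmax s hs0]
  have hf'ne : f' r₀ ≠ 0 := by
    intro h0
    have hHr₀ : H r₀ = 0 := by simp [hHdef, hr₀, h0]
    have hG := hGconst r₀ 0 (by linarith) fun r h1 h2 => by
      have e1 := hHmono r₀ r h1 fun s hs _ => hnn s hs
      have e2 := hHmono r 0 h2 fun s hs _ => hnn s (h1.trans hs)
      linarith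
    rw [hG0] at hG
    simp only [hGdef, hr₀, mul_zero] at hG
    linarith
  refine ⟨r₀, hr₀, fun r₁ hr₁ => ?_, lt_min hr₀lt ?_⟩
  · by_contra hne
    have hr₁lt : r₁ < r₀ := lt_of_le_of_ne (hmax r₁ hr₁) hne
    have hu : ∀ r, r ≤ r₀ → f r * f' r ≤ 0 := by
      intro r hr
      have := le_of_hasDerivAt_nonneg_of_continuousAt (F := fun r => f r * f' r)
        (p := fun r => f' r * f' r) (q := fun r => f r * f r) hkmono
        (by fun_prop) (by fun_prop) (by fun_prop)
        (fun r hr => by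
          refine ((hf r).mul (hode r hr)).congr_deriv ?_
          ring) hr
        (fun r _ _ => add_nonneg (mul_self_nonneg _)
          (mul_nonneg (ht0.le.trans (hkb r).1) (mul_self_nonneg _)))
      simpa [hr₀] using this
    have hz : ∀ r ∈ Set.Icc r₁ r₀, f r = 0 := by
      intro r hr
      have := le_of_hasDerivAt_nonneg (F := fun r => -(f r * f r))
        (p := fun r => -(f' r * f r + f r * f' r)) (by fun_prop)
        (fun r => ((hf r).mul (hf r)).neg) hr.1
        (fun s _ h2 => by linarith [hu s (h2.trans hr.2), mul_comm (f s) (f' s)])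
      simp only [hr₁, mul_zero, neg_zero] at this
      exact mul_self_eq_zero.mp (le_antisymm (by linarith) (mul_self_nonneg _))
    have hmem : r₀ ∈ Set.Icc r₁ r₀ := ⟨hr₁lt.le, le_rfl⟩
    exact hf'ne ((uniqueDiffOn_Icc hr₁lt r₀ hmem).eq_deriv _ (hf r₀).hasDerivWithinAt
      ((hasDerivWithinAt_const r₀ _ (0 : ℝ)).congr hz hr₀))
  · have hf'le : ∀ r, r₀ ≤ r → r ≤ 0 → f' r ≤ ℓ₁ := by
      intro r h1 h2
      rw [← hf'0]
      exact le_of_hasDerivAt_nonneg_of_continuousAt (p := fun _ => 0) (q := f) hkmono hC1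
        continuous_const hfc (fun s hs => by simpa using hode s hs) h2
        (fun s hs _ => by
          have := mul_nonneg (ht0.le.trans (hkb s).1) (hnn s (h1.trans hs))
          linarith)
    have hle := le_of_hasDerivAt_nonneg (F := fun r => ℓ₁ * r - f r) (p := fun r => ℓ₁ - f' r)
      (by fun_prop) (fun r => (((hasDerivAt_id r).const_mul ℓ₁).sub (hf r)).congr_deriv (by simp))
      hr₀lt.le (fun r h1 h2 => by linarith [hf'le r h1 (by linarith)])
    simp only [hr₀, sub_zero] at hle
    rw [hfexp _ le_rfl] at hle
    have hexp := Real.add_one_lt_exp (show -ε / 2 ≠ 0 by linarith)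
    nlinarith
end

section
/- Let ℓ₁ > 0 and let k₁, k₂ : ℝ → ℝ satisfy 0 ≤ k₁(r) ≤ k₂(r) ≤ 1 for all r ∈ ℝ. For i = 1, 2, let fᵢ : ℝ → ℝ be a C¹ function, twice differentiable on ℝ, with fᵢ''(r) = kᵢ(r)·fᵢ(r) for all r and fᵢ(0) = fᵢ'(0) = ℓ₁, and suppose each fᵢ has a unique zero rᵢ ∈ ℝ. Then f₁'(r₁) ≥ f₂'(r₂). -/
theorem pos_of_notMem_uIcc {f : ℝ → ℝ} (hf : Continuous f) {a x r : ℝ} (ha : 0 < f a)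
    (hu : ∀ y, f y = 0 → y = r) (hr : r ∉ Set.uIcc a x) : 0 < f x := by
  by_contra! hx
  obtain ⟨y, hy, hy0⟩ := intermediate_value_uIcc (hf.continuousOn (s := Set.uIcc a x))
    (Set.mem_uIcc.2 (Or.inr ⟨hx, ha.le⟩))
  exact hr (hu y hy0 ▸ hy)

theorem monotoneOn_of_hasDerivAt_nonneg {f f' : ℝ → ℝ} {D : Set ℝ} (hD : Convex ℝ D)
    (hf : ∀ x ∈ D, HasDerivAt f (f' x) x) (hf' : ∀ x ∈ interior D, 0 ≤ f' x) :
    MonotoneOn f D :=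
  monotoneOn_of_hasDerivWithinAt_nonneg hD
    (fun x hx => (hf x hx).continuousAt.continuousWithinAt)
    (fun x hx => (hf x (interior_subset hx)).hasDerivWithinAt) hf'

/-- The unique zero of a solution of `f'' = k * f`, `k ≥ 0`, with positive initial data at `0`
is negative. -/
theorem zero_neg_of_hasDerivAt {k f f' : ℝ → ℝ} {r : ℝ} (hk : ∀ x, 0 ≤ k x)
    (hf : ∀ x, HasDerivAt f (f' x) x) (hf' : ∀ x, HasDerivAt f' (k x * f x) x)
    (h0 : 0 < f 0) (h0' : 0 < f' 0) (hr : f r = 0) (hu : ∀ x, f x = 0 → x = r) : r < 0 := by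
  by_contra! hr0
  have hcont : Continuous f := continuous_iff_continuousAt.2 fun x => (hf x).continuousAt
  have hmono' : MonotoneOn f' (Set.Icc 0 r) := by
    refine monotoneOn_of_hasDerivAt_nonneg (convex_Icc 0 r) (fun x _ => hf' x) fun x hx => ?_
    rw [interior_Icc] at hx
    refine mul_nonneg (hk x) (pos_of_notMem_uIcc hcont h0 hu ?_).le
    rw [Set.uIcc_of_le hx.1.le]
    exact fun h => absurd h.2 (not_le.2 hx.2)
  have hmono : MonotoneOn f (Set.Icc 0 r) := by
    refine monotoneOn_of_hasDerivAt_nonneg (convex_Icc 0 r) (fun x _ => hf x) fun x hx => ?_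
    have hx := interior_subset hx
    exact h0'.le.trans (hmono' (Set.left_mem_Icc.2 hr0) hx hx.1)
  have := hmono (Set.left_mem_Icc.2 hr0) (Set.right_mem_Icc.2 hr0) hr0
  linarith

/-- Sturm comparison to the left of `0`, for equal initial data at `0`. -/
theorem le_of_hasDerivAt_of_le {k₁ k₂ f₁ f₂ f₁' f₂' : ℝ → ℝ} {m : ℝ}
    (hk : ∀ x, k₁ x ≤ k₂ x)
    (hf₁ : ∀ x, HasDerivAt f₁ (f₁' x) x) (hf₁' : ∀ x, HasDerivAt f₁' (k₁ x * f₁ x) x)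
    (hf₂ : ∀ x, HasDerivAt f₂ (f₂' x) x) (hf₂' : ∀ x, HasDerivAt f₂' (k₂ x * f₂ x) x)
    (h0 : f₁ 0 = f₂ 0) (h0' : f₁' 0 = f₂' 0)
    (hpos₁ : ∀ x, m < x → 0 < f₁ x) (hpos₂ : ∀ x, m < x → 0 < f₂ x)
    {x : ℝ} (hx : m < x) (hx0 : x ≤ 0) : f₁ x ≤ f₂ x := by
  have hm0 : (0 : ℝ) ∈ Set.Ioc m 0 := ⟨hx.trans_le hx0, le_rfl⟩
  have hW : MonotoneOn (fun y => f₁ y * f₂' y - f₁' y * f₂ y) (Set.Ioc m 0) := by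
    refine monotoneOn_of_hasDerivAt_nonneg (convex_Ioc m 0)
      (fun y _ => ((hf₁ y).mul (hf₂' y)).sub ((hf₁' y).mul (hf₂ y))) fun y hy => ?_
    have hy := interior_subset hy
    have := mul_nonneg (sub_nonneg.2 (hk y)) (mul_pos (hpos₁ y hy.1) (hpos₂ y hy.1)).le
    linarith
  have hquot : MonotoneOn (fun y => f₁ y / f₂ y) (Set.Ioc m 0) := by
    refine monotoneOn_of_hasDerivAt_nonneg (convex_Ioc m 0)
      (fun y hy => (hf₁ y).div (hf₂ y) (hpos₂ y hy.1).ne') fun y hy => ?_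
    have hy := interior_subset hy
    have := hW hy hm0 hy.2
    simp only [h0, h0'] at this
    exact div_nonneg (by linarith) (sq_nonneg _)
  have := hquot ⟨hx, hx0⟩ hm0 hx0
  simp only [h0, div_self (hpos₂ 0 hm0.1).ne'] at this
  exact (div_le_one (hpos₂ x hx)).1 this

/-- Monotonicity of the cone angle `m = f'(r₀)` in the coefficient function
(Lemma 2.10 of Futer–Kalfagianni–Purcell): if `0 ≤ k₁ ≤ k₂ ≤ 1`,
`fᵢ'' = kᵢ·fᵢ`, `fᵢ(0) = fᵢ'(0) = ℓ₁ > 0`, and each `fᵢ` has a unique zero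
`rᵢ`, then `f₁'(r₁) ≥ f₂'(r₂)`. -/
theorem stmt_10 (ℓ₁ : ℝ) (hℓ : 0 < ℓ₁)
    (k₁ k₂ f₁ f₂ f₁' f₂' : ℝ → ℝ)
    (hk : ∀ r, 0 ≤ k₁ r ∧ k₁ r ≤ k₂ r ∧ k₂ r ≤ 1)
    (hf₁ : ∀ r, HasDerivAt f₁ (f₁' r) r)
    (hf₁' : ∀ r, HasDerivAt f₁' (k₁ r * f₁ r) r)
    (hf₂ : ∀ r, HasDerivAt f₂ (f₂' r) r)
    (hf₂' : ∀ r, HasDerivAt f₂' (k₂ r * f₂ r) r)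
    (hf₁0 : f₁ 0 = ℓ₁) (hf₁'0 : f₁' 0 = ℓ₁)
    (hf₂0 : f₂ 0 = ℓ₁) (hf₂'0 : f₂' 0 = ℓ₁)
    (r₁ r₂ : ℝ)
    (hr₁ : f₁ r₁ = 0) (hr₁u : ∀ r, f₁ r = 0 → r = r₁)
    (hr₂ : f₂ r₂ = 0) (hr₂u : ∀ r, f₂ r = 0 → r = r₂) :
    f₂' r₂ ≤ f₁' r₁ := by
  have hc₁ : Continuous f₁ := continuous_iff_continuousAt.2 fun x => (hf₁ x).continuousAt
  have hc₂ : Continuous f₂ := continuous_iff_continuousAt.2 fun x => (hf₂ x).continuousAt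
  have hk₂ : ∀ x, 0 ≤ k₂ x := fun x => (hk x).1.trans (hk x).2.1
  have hneg₁ : r₁ < 0 := zero_neg_of_hasDerivAt (fun x => (hk x).1) hf₁ hf₁'
    (hf₁0 ▸ hℓ) (hf₁'0 ▸ hℓ) hr₁ hr₁u
  have hneg₂ : r₂ < 0 := zero_neg_of_hasDerivAt hk₂ hf₂ hf₂'
    (hf₂0 ▸ hℓ) (hf₂'0 ▸ hℓ) hr₂ hr₂u
  have hpos₁ : ∀ x, r₁ < x → 0 < f₁ x := fun x hx =>
    pos_of_notMem_uIcc hc₁ (hf₁0 ▸ hℓ) hr₁u fun h => absurd h.1 (not_le.2 (lt_min hneg₁ hx))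
  have hpos₂ : ∀ x, r₂ < x → 0 < f₂ x := fun x hx =>
    pos_of_notMem_uIcc hc₂ (hf₂0 ▸ hℓ) hr₂u fun h => absurd h.1 (not_le.2 (lt_min hneg₂ hx))
  have hle : ∀ x ∈ Set.Ioc (max r₁ r₂) 0, f₁ x ≤ f₂ x := fun x hx =>
    le_of_hasDerivAt_of_le (fun y => (hk y).2.1) hf₁ hf₁' hf₂ hf₂' (hf₁0.trans hf₂0.symm)
      (hf₁'0.trans hf₂'0.symm) (fun y hy => hpos₁ y ((le_max_left _ _).trans_lt hy))
      (fun y hy => hpos₂ y ((le_max_right _ _).trans_lt hy)) hx.1 hx.2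
  have hr : r₂ ≤ r₁ := by
    by_contra! hlt
    rw [max_eq_right hlt.le] at hle
    have hmem : r₂ ∈ closure (Set.Ioc r₂ 0) := by
      rw [closure_Ioc hneg₂.ne]
      exact Set.left_mem_Icc.2 hneg₂.le
    have hle₂ : f₁ r₂ ≤ f₂ r₂ := closure_minimal hle (isClosed_le hc₁ hc₂) hmem
    have := hpos₁ r₂ hlt
    linarith
  rw [max_eq_left hr] at hle
  have hdiff : MonotoneOn (fun x => f₂' x - f₁' x) (Set.Icc r₁ 0) := by
    refine monotoneOn_of_hasDerivAt_nonneg (convex_Icc r₁ 0)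
      (fun x _ => (hf₂' x).sub (hf₁' x)) fun x hx => ?_
    rw [interior_Icc] at hx
    exact sub_nonneg.2 (mul_le_mul (hk x).2.1 (hle x ⟨hx.1, hx.2.le⟩) (hpos₁ x hx.1).le (hk₂ x))
  have hmono₂ : MonotoneOn f₂' (Set.Icc r₂ r₁) := by
    refine monotoneOn_of_hasDerivAt_nonneg (convex_Icc r₂ r₁) (fun x _ => hf₂' x) fun x hx => ?_
    rw [interior_Icc] at hx
    exact mul_nonneg (hk₂ x) (hpos₂ x hx.1).le
  have h₁ := hdiff (Set.left_mem_Icc.2 hneg₁.le) (Set.right_mem_Icc.2 hneg₁.le) hneg₁.le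
  have h₂ := hmono₂ (Set.left_mem_Icc.2 hr) (Set.right_mem_Icc.2 hr) hr
  simp only [hf₁'0, hf₂'0] at h₁
  linarith
end

section
/- Let ℓ₁ > 2π, t ∈ (0,1), and ε > 2·ln(ℓ₁/(2π)), and let k : ℝ → ℝ be a bump function with parameters (t, ε). Let f : ℝ → ℝ be a C¹ function with f(0) = f'(0) = ℓ₁ that is twice differentiable with f''(r) = k(r)·f(r) at every r at which k is continuous. Then f has a unique zero r₀ ∈ ℝ and f'(r₀) < 2π. -/
open MeasureTheory Set

/-- Fundamental theorem of calculus for a function whose derivative is `p * k + q` at every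
continuity point of the monotone function `k`. -/
theorem integral_eq_sub_of_hasDerivAt_of_monotone {k p q G : ℝ → ℝ} (hk : Monotone k)
    (hp : Continuous p) (hq : Continuous q) (hG : Continuous G)
    (h : ∀ r, ContinuousAt k r → HasDerivAt G (p r * k r + q r) r) (a b : ℝ) :
    ∫ r in a..b, (p r * k r + q r) = G b - G a := by
  refine integral_eq_of_hasDerivAt_off_countable G _ hk.countable_not_continuousAt
    hG.continuousOn (fun x hx => h x (by simpa using hx.2)) ?_
  exact ((hk.intervalIntegrable).continuousOn_mul hp.continuousOn).add (hq.intervalIntegrable a b)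

/-- If `f'' = k f` at the continuity points of the monotone function `k`, then
`exp (c r) * (f' - c f)` is a primitive of `exp (c r) * (k - c ^ 2) * f`. -/
theorem integral_exp_mul_of_ode {k f f' : ℝ → ℝ} (hk : Monotone k)
    (hf : ∀ r, HasDerivAt f (f' r) r) (hC1 : Continuous f')
    (hode : ∀ r, ContinuousAt k r → HasDerivAt f' (k r * f r) r) (c a b : ℝ) :
    ∫ r in a..b, Real.exp (c * r) * ((k r - c ^ 2) * f r) =
      Real.exp (c * b) * (f' b - c * f b) - Real.exp (c * a) * (f' a - c * f a) := by
  have hfc : Continuous f := continuous_iff_continuousAt.2 fun r => (hf r).continuousAt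
  rw [← integral_eq_sub_of_hasDerivAt_of_monotone (p := fun r => Real.exp (c * r) * f r)
    (q := fun r => -c ^ 2 * (Real.exp (c * r) * f r))
    (G := fun r => Real.exp (c * r) * (f' r - c * f r)) hk (by fun_prop) (by fun_prop)
    (by fun_prop)]
  · congr 1
    ext r
    ring
  · intro r hr
    have he : HasDerivAt (fun r => Real.exp (c * r)) (Real.exp (c * r) * c) r := by
      simpa using ((hasDerivAt_id r).const_mul c).exp
    refine (he.fun_mul ((hode r hr).fun_sub ((hf r).const_mul c))).congr_deriv ?_
    ring

/-- If `f'' = k f` at the continuity points of the monotone nonnegative function `k`, then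
`f * f'` is monotone. -/
theorem monotone_mul_deriv_of_ode {k f f' : ℝ → ℝ} (hk : Monotone k) (hk0 : ∀ r, 0 ≤ k r)
    (hf : ∀ r, HasDerivAt f (f' r) r) (hC1 : Continuous f')
    (hode : ∀ r, ContinuousAt k r → HasDerivAt f' (k r * f r) r) :
    Monotone fun r => f r * f' r := by
  have hfc : Continuous f := continuous_iff_continuousAt.2 fun r => (hf r).continuousAt
  intro a b hab
  have key := integral_eq_sub_of_hasDerivAt_of_monotone (p := fun r => f r ^ 2)
    (q := fun r => f' r ^ 2) (G := fun r => f r * f' r) hk (by fun_prop) (by fun_prop)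
    (by fun_prop) (fun r hr => by
      refine ((hf r).fun_mul (hode r hr)).congr_deriv ?_
      ring) a b
  have hnn : 0 ≤ ∫ r in a..b, (f r ^ 2 * k r + f' r ^ 2) :=
    intervalIntegral.integral_nonneg hab fun r _ =>
      add_nonneg (mul_nonneg (sq_nonneg _) (hk0 r)) (sq_nonneg _)
  simp only at key ⊢
  linarith


/-- Part of the proof of Lemma 2.2 of Futer–Kalfagianni–Purcell: if
`ℓ₁ > 2π` and `ε > 2·ln(ℓ₁/2π)`, then the cone angle of the solution
`f_{t,ε}` is less than `2π`; i.e. `f` has a unique zero `r₀` and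
`f'(r₀) < 2π`. -/
theorem stmt_11 (ℓ₁ t ε : ℝ) (hℓ : 2 * Real.pi < ℓ₁)
    (ht : t ∈ Set.Ioo (0 : ℝ) 1)
    (hε : 2 * Real.log (ℓ₁ / (2 * Real.pi)) < ε)
    (k : ℝ → ℝ) (hkmono : Monotone k)
    (hkb : ∀ r, t ≤ k r ∧ k r ≤ 1)
    (hkl : ∀ r ≤ -ε, k r = t)
    (hkr : ∀ r, -ε / 2 ≤ r → k r = 1)
    (f f' : ℝ → ℝ)
    (hf : ∀ r, HasDerivAt f (f' r) r)
    (hC1 : Continuous f')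
    (hf0 : f 0 = ℓ₁) (hf'0 : f' 0 = ℓ₁)
    (hode : ∀ r, ContinuousAt k r → HasDerivAt f' (k r * f r) r) :
    ∃ r₀, f r₀ = 0 ∧ (∀ r, f r = 0 → r = r₀) ∧ f' r₀ < 2 * Real.pi := by
  obtain ⟨ht0, ht1⟩ := ht
  have hπ := Real.pi_pos
  have hℓ0 : 0 < ℓ₁ := by linarith
  have hε0 : 0 < ε := by
    have := Real.log_pos ((one_lt_div (by positivity)).2 hℓ)
    linarith
  have hfc : Continuous f := continuous_iff_continuousAt.2 fun r => (hf r).continuousAt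
  have hW := integral_exp_mul_of_ode hkmono hf hC1 hode
  have hmono := monotone_mul_deriv_of_ode hkmono (fun r => ht0.le.trans (hkb r).1) hf hC1 hode
  have hexp : ∀ r, -ε / 2 ≤ r → r ≤ 0 → f r = ℓ₁ * Real.exp r ∧ f' r = ℓ₁ * Real.exp r := by
    intro r hr hr0
    have hzero : ∀ c : ℝ, c ^ 2 = 1 →
        ∫ x in r..0, Real.exp (c * x) * ((k x - c ^ 2) * f x) = 0 := by
      intro c hc
      refine intervalIntegral.integral_zero_ae (.of_forall fun x hx => ?_)
      rw [uIoc_of_le hr0] at hx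
      rw [hkr x (hr.trans hx.1.le), hc]
      ring
    have h1 := hW 1 r 0
    have h2 := hW (-1) r 0
    rw [hzero _ (by norm_num), hf0, hf'0] at h1 h2
    simp only [mul_zero, Real.exp_zero, one_mul, neg_mul, sub_neg_eq_add, sub_self, zero_sub,
      zero_eq_neg, mul_eq_zero, Real.exp_ne_zero, false_or] at h1 h2
    have h3 : f' r = f r := by linarith
    rw [h3, Real.exp_neg] at h2
    have h4 : f r = ℓ₁ * Real.exp r := by
      have := Real.exp_pos r
      field_simp at h2
      linarith
    exact ⟨h4, h3.trans h4⟩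
  -- A lower bound for `f'` to the left of `0`, as long as `f` stays nonnegative.
  have hle : ∀ a ≤ 0, (∀ x ∈ Icc a 0, 0 ≤ f x) → ∀ c : ℝ, c ^ 2 = 1 →
      ℓ₁ - c * ℓ₁ ≤ Real.exp (c * a) * (f' a - c * f a) := by
    intro a ha hpos c hc
    have h1 := hW c a 0
    have h2 : 0 ≤ ∫ x in a..0, -(Real.exp (c * x) * ((k x - c ^ 2) * f x)) := by
      refine intervalIntegral.integral_nonneg ha fun x hx => ?_
      rw [hc, neg_nonneg]
      exact mul_nonpos_of_nonneg_of_nonpos (Real.exp_pos _).le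
        (mul_nonpos_of_nonpos_of_nonneg (by linarith [(hkb x).2]) (hpos x hx))
    rw [intervalIntegral.integral_neg, h1, hf0, hf'0] at h2
    simp only [mul_zero, Real.exp_zero, one_mul] at h2
    linarith
  have hivt : ∀ a ≤ 0, f a ≤ 0 → ∃ x ∈ Icc a 0, f x = 0 := fun a ha hfa =>
    intermediate_value_Icc ha hfc.continuousOn ⟨hfa, by rw [hf0]; exact hℓ0.le⟩
  have hne : {r | f r = 0}.Nonempty := by
    by_contra hcon
    have hpos : ∀ r ≤ 0, 0 < f r := by
      intro r hr
      by_contra! h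
      obtain ⟨x, -, hx⟩ := hivt r hr h
      exact hcon ⟨x, hx⟩
    set a := Real.sqrt t
    have ha0 : 0 ≤ a := Real.sqrt_nonneg t
    have ha2 : a ^ 2 = t := Real.sq_sqrt ht0.le
    have ha1 : a < 1 := by nlinarith
    have hF := hpos (-ε) (by linarith)
    have hF' : f (-ε) ≤ f' (-ε) := by
      have := hle (-ε) (by linarith) (fun x hx => (hpos x hx.2).le) 1 (by norm_num)
      have h2 := Real.exp_pos (1 * -ε)
      by_contra! hlt
      nlinarith
    have hderiv : ∀ r ≤ -ε, (1 - a) * f (-ε) ≤ f' r := by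
      intro r hr
      have h1 := hW a r (-ε)
      rw [intervalIntegral.integral_zero_ae (.of_forall fun x hx => by
        rw [uIoc_of_le hr] at hx
        rw [hkl x hx.2, ha2]
        ring)] at h1
      have h2 : Real.exp (a * r) ≤ Real.exp (a * -ε) :=
        Real.exp_le_exp.2 (mul_le_mul_of_nonneg_left hr ha0)
      have h3 := Real.exp_pos (a * r)
      have h4 := hpos r (by linarith)
      have h5 : 0 < (1 - a) * f (-ε) := mul_pos (by linarith) hF
      have h6 : Real.exp (a * r) * ((1 - a) * f (-ε)) ≤ Real.exp (a * r) * (f' r - a * f r) :=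
        calc _ ≤ Real.exp (a * -ε) * ((1 - a) * f (-ε)) := by gcongr
          _ ≤ Real.exp (a * -ε) * (f' (-ε) - a * f (-ε)) := by gcongr; linarith
          _ = _ := by linarith
      have h7 := le_of_mul_le_mul_left h6 h3
      have := mul_nonneg ha0 h4.le
      linarith
    have hx : 0 < 1 / (1 - a) := by
      have : 0 < 1 - a := by linarith
      positivity
    obtain ⟨y, hy, hys⟩ := exists_hasDerivAt_eq_slope f f'
      (show -ε - 1 / (1 - a) < -ε by linarith) hfc.continuousOn fun x _ => hf x
    have h1 := hderiv y hy.2.le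
    have h2 := hpos (-ε - 1 / (1 - a)) (by linarith)
    have h3 : 1 - a ≠ 0 := by linarith
    rw [hys, sub_sub_cancel, le_div_iff₀ hx] at h1
    have h4 : (1 - a) * f (-ε) * (1 / (1 - a)) = f (-ε) := by field_simp
    linarith
  have hbdd : ∀ r, f r = 0 → r < 0 := by
    intro r hr
    by_contra! h
    have := hmono h
    simp only [hr, hf0, hf'0, zero_mul] at this
    nlinarith
  have hclosed : IsClosed {r | f r = 0} := isClosed_eq hfc continuous_const
  have hBA : BddAbove {r | f r = 0} := ⟨0, fun r hr => (hbdd r hr).le⟩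
  have hz : f (sSup {r | f r = 0}) = 0 := hclosed.csSup_mem hne hBA
  have hmax : ∀ r, f r = 0 → r ≤ sSup {r | f r = 0} := fun r hr => le_csSup hBA hr
  generalize sSup {r | f r = 0} = r₀ at hz hmax
  have hr0 : r₀ < 0 := hbdd r₀ hz
  have hnn : ∀ x ∈ Icc r₀ 0, 0 ≤ f x := by
    intro x hx
    by_contra! h
    obtain ⟨y, hy, hy0⟩ := hivt x hx.2 h.le
    have : x = r₀ := le_antisymm (hy.1.trans (hmax y hy0)) hx.1
    rw [this, hz] at h
    exact h.false
  have hf'pos : 0 < f' r₀ := by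
    have := hle r₀ hr0.le hnn (-1) (by norm_num)
    rw [hz] at this
    exact pos_of_mul_pos_right (b := f' r₀) (a := Real.exp (-1 * r₀))
      (by linarith) (Real.exp_pos _).le
  refine ⟨r₀, hz, fun s hs => ?_, ?_⟩
  · by_contra hsne
    have hlt : s < r₀ := lt_of_le_of_ne (hmax s hs) hsne
    obtain ⟨δ, hδ, hδ'⟩ := Metric.eventually_nhds_iff.1
      (hC1.continuousAt.eventually (lt_mem_nhds hf'pos))
    have hpos : ∀ y, r₀ - δ / 2 ≤ y → y ≤ r₀ → 0 < f' y := fun y hy hy' => hδ' (by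
      rw [Real.dist_eq, abs_lt]
      constructor <;> linarith)
    have hx1 := le_max_left s (r₀ - δ / 2)
    have hx2 := le_max_right s (r₀ - δ / 2)
    have hx3 : max s (r₀ - δ / 2) < r₀ := max_lt hlt (by linarith)
    generalize max s (r₀ - δ / 2) = x at hx1 hx2 hx3
    obtain ⟨y, hy, hys⟩ := exists_hasDerivAt_eq_slope f f' hx3 hfc.continuousOn fun x _ => hf x
    have h1 := hpos y (hx2.trans hy.1.le) hy.2.le
    rw [hys, hz, lt_div_iff₀ (by linarith)] at h1
    have h2 := hmono hx1
    simp only [hs, zero_mul] at h2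
    nlinarith [hpos x hx2 hx3.le]
  · have hr : r₀ < -ε / 2 := by
      by_contra! h
      have h1 := (hexp r₀ h hr0.le).1
      rw [hz] at h1
      have := mul_pos hℓ0 (Real.exp_pos r₀)
      linarith
    have h1 := hW 0 r₀ (-ε / 2)
    have h2 : 0 ≤ ∫ x in r₀..(-ε / 2), Real.exp (0 * x) * ((k x - 0 ^ 2) * f x) := by
      refine intervalIntegral.integral_nonneg hr.le fun x hx => ?_
      refine mul_nonneg (Real.exp_pos _).le (mul_nonneg ?_ (hnn x ⟨hx.1, by linarith [hx.2]⟩))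
      linarith [(hkb x).1]
    rw [h1, (hexp (-ε / 2) le_rfl (by linarith)).2] at h2
    simp only [zero_mul, Real.exp_zero, one_mul, sub_zero] at h2
    have h3 : ℓ₁ / (2 * Real.pi) < Real.exp (ε / 2) :=
      (Real.log_lt_iff_lt_exp (by positivity)).1 (by linarith)
    rw [div_lt_iff₀ (by positivity)] at h3
    have h4 : ℓ₁ * Real.exp (-ε / 2) < 2 * Real.pi := by
      rw [neg_div, Real.exp_neg, ← div_eq_mul_inv, div_lt_iff₀ (Real.exp_pos _)]
      linarith
    linarith
end

section
/- Let J ⊆ ℝ be an open interval, let t ∈ (0,1), and let k : J → ℝ be a differentiable nondecreasing function with t ≤ k(r) ≤ 1 for all r ∈ J. Let f : J → ℝ be twice differentiable with f''(r) = k(r)·f(r), f(r) > 0, and f'(r) > 0 for all r ∈ J. Let g : J → ℝ be a positive differentiable function satisfying g'(r)/g(r) = k(r)·f(r)/f'(r) for all r ∈ J. Then g is twice differentiable on J, and for all r ∈ J one has g''(r)/g(r) = k(r) + (f(r)/f'(r))·k'(r), and in particular g''(r)/g(r) ≥ t. -/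
/-- Lemma 2.3 of Futer–Kalfagianni–Purcell (curvature bound `-g''/g ≤ -t`):
on an open interval `J`, if `k` is differentiable, nondecreasing, with
`t ≤ k ≤ 1`, `f'' = k·f` with `f, f' > 0`, and `g > 0` satisfies
`g'/g = k·f/f'`, then `g` is twice differentiable with
`g''/g = k + (f/f')·k'` and `g''/g ≥ t`. -/
theorem stmt_12 (J : Set ℝ) (hJopen : IsOpen J) (hJconn : J.OrdConnected)
    (t : ℝ) (ht : t ∈ Set.Ioo (0 : ℝ) 1)
    (k k' f f' g g' : ℝ → ℝ)
    (hkdiff : ∀ r ∈ J, HasDerivAt k (k' r) r)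
    (hkmono : MonotoneOn k J)
    (hkb : ∀ r ∈ J, t ≤ k r ∧ k r ≤ 1)
    (hfd : ∀ r ∈ J, HasDerivAt f (f' r) r)
    (hfd' : ∀ r ∈ J, HasDerivAt f' (k r * f r) r)
    (hfpos : ∀ r ∈ J, 0 < f r) (hf'pos : ∀ r ∈ J, 0 < f' r)
    (hgpos : ∀ r ∈ J, 0 < g r)
    (hgd : ∀ r ∈ J, HasDerivAt g (g' r) r)
    (hgode : ∀ r ∈ J, g' r / g r = k r * f r / f' r) :
    ∀ r ∈ J, DifferentiableAt ℝ g' r ∧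
      deriv g' r / g r = k r + (f r / f' r) * k' r ∧
      t ≤ deriv g' r / g r := by
  intro r hr
  have hf' := (hf'pos r hr).ne'
  have hg := (hgpos r hr).ne'
  have hode : g' r = g r * (k r * f r / f' r) := by
    rw [← hgode r hr]
    field_simp
  have heq : g' =ᶠ[nhds r] fun x ↦ g x * (k x * f x / f' x) := by
    filter_upwards [hJopen.mem_nhds hr] with x hx
    rw [← hgode x hx]
    have := (hgpos x hx).ne'
    field_simp
  have hder : HasDerivAt g' (g r * (k r + (f r / f' r) * k' r)) r := by
    have h := ((hgd r hr).fun_mul (((hkdiff r hr).fun_mul (hfd r hr)).fun_div (hfd' r hr) hf'))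
    refine (h.congr_of_eventuallyEq heq).congr_deriv ?_
    rw [hode]
    field_simp
    ring
  have hk' : 0 ≤ k' r := by
    rw [← (hkdiff r hr).deriv, ← derivWithin_of_isOpen hJopen hr]
    exact hkmono.derivWithin_nonneg
  have hquot : deriv g' r / g r = k r + (f r / f' r) * k' r := by
    rw [hder.deriv, mul_div_cancel_left₀ _ hg]
  refine ⟨hder.differentiableAt, hquot, ?_⟩
  rw [hquot]
  exact le_add_of_le_of_nonneg (hkb r hr).1
    (mul_nonneg (div_pos (hfpos r hr) (hf'pos r hr)).le hk')
end

section
/- Let ℓ₁ > 0 and t_lim ∈ (0,1). Let (t_i) be a sequence in (0,1) with t_i → t_lim and (ε_i) a sequence of positive reals with ε_i → 0. For each i, let k_i : ℝ → ℝ be a continuous bump function with parameters (t_i, ε_i), and let f_i : ℝ → ℝ be a C² function with f_i''(r) = k_i(r)·f_i(r) for all r and f_i(0) = f_i'(0) = ℓ₁. Define f_lim : ℝ → ℝ by f_lim(r) = ℓ₁·e^r for r ≥ 0 and f_lim(r) = ℓ₁·cosh(r·√t_lim) + (ℓ₁/√t_lim)·sinh(r·√t_lim) for r < 0. Then f_i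 → f_lim and f_i' → f_lim' uniformly on every compact subset of ℝ. -/
/-- Grönwall estimate for the second-order equation `p'' = k p + w` with `|k| ≤ 1`. -/
theorem abs_le_of_second_order_perturbation {p q k w : ℝ → ℝ} {a b δ η : ℝ}
    (hp : ∀ x, HasDerivAt p (q x) x) (hq : ∀ x, HasDerivAt q (k x * p x + w x) x)
    (hk : ∀ x ∈ Set.Ico a b, |k x| ≤ 1) (hw : ∀ x ∈ Set.Ico a b, |w x| ≤ η)
    (hη : 0 ≤ η) (hpa : |p a| ≤ δ) (hqa : |q a| ≤ δ) :
    ∀ x ∈ Set.Icc a b,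
      |p x| ≤ δ * Real.exp (x - a) + η * (Real.exp (x - a) - 1) ∧
      |q x| ≤ δ * Real.exp (x - a) + η * (Real.exp (x - a) - 1) := by
  intro x hx
  have hpq : ∀ y, HasDerivAt (fun y => (p y, q y)) (q y, k y * p y + w y) y :=
    fun y => (hp y).prodMk (hq y)
  have key := norm_le_gronwallBound_of_norm_deriv_right_le (f := fun y => (p y, q y))
    (f' := fun y => (q y, k y * p y + w y)) (δ := δ) (K := 1) (ε := η) (a := a) (b := b)
    (fun y _ => (hpq y).continuousAt.continuousWithinAt)
    (fun y _ => (hpq y).hasDerivWithinAt)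
    (by simpa [Prod.norm_def] using ⟨hpa, hqa⟩)
    (fun y hy => by
      have h₁ : |p y| ≤ max |p y| |q y| := le_max_left _ _
      have h₂ : |q y| ≤ max |p y| |q y| := le_max_right _ _
      have h₃ : |k y * p y + w y| ≤ |p y| + η := by
        refine (abs_add_le _ _).trans (add_le_add ?_ (hw y hy))
        rw [abs_mul]
        exact mul_le_of_le_one_left (abs_nonneg _) (hk y hy)
      simp only [Prod.norm_def, Real.norm_eq_abs, one_mul]
      exact max_le (by linarith) (by linarith)) x hx
  rw [gronwallBound_of_K_ne_0 one_ne_zero] at key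
  simp only [Prod.norm_def, Real.norm_eq_abs, one_mul, div_one] at key
  exact max_le_iff.mp key

/-- A solution of `f'' = k f` with `k = 1` on `[0, ∞)` and `f 0 = f' 0 = ℓ` is `ℓ * exp` there. -/
theorem eq_mul_exp_of_deriv_deriv_eq {f k : ℝ → ℝ} {ℓ : ℝ} (hf : ContDiff ℝ 2 f)
    (hode : ∀ r, deriv (deriv f) r = k r * f r) (hk : ∀ r, 0 ≤ r → k r = 1)
    (hf0 : f 0 = ℓ) (hf'0 : deriv f 0 = ℓ) {r : ℝ} (hr : 0 ≤ r) :
    f r = ℓ * Real.exp r ∧ deriv f r = ℓ * Real.exp r := by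
  have hf₁ : ∀ x, HasDerivAt f (deriv f x) x :=
    fun x => (hf.differentiable (by norm_num) x).hasDerivAt
  have hf₂ : ∀ x, HasDerivAt (deriv f) (k x * f x) x :=
    fun x => hode x ▸ (hf.differentiable_deriv_two x).hasDerivAt
  have he : ∀ x, HasDerivAt (fun x => ℓ * Real.exp x) (ℓ * Real.exp x) x :=
    fun x => (Real.hasDerivAt_exp x).const_mul ℓ
  have key := abs_le_of_second_order_perturbation (k := k)
    (p := fun x => f x - ℓ * Real.exp x) (q := fun x => deriv f x - ℓ * Real.exp x)
    (w := fun x => (k x - 1) * (ℓ * Real.exp x)) (a := 0) (b := r) (δ := 0) (η := 0)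
    (fun x => (hf₁ x).sub (he x))
    (fun x => ((hf₂ x).sub (he x)).congr_deriv (by ring))
    (fun x hx => by simp [hk x hx.1]) (fun x hx => by simp [hk x hx.1]) le_rfl
    (by simp [hf0]) (by simp [hf'0]) r ⟨hr, le_rfl⟩
  simpa [sub_eq_zero] using key

/-- Distance on `[-R, 0]` between a solution of `f'' = k f`, where `k = τ` on `(-∞, -ε]`, and the
solution of `g'' = s² g` with the same initial data. -/
theorem abs_sub_le_of_deriv_deriv_eq {f k : ℝ → ℝ} {ℓ s τ ε R M : ℝ} (hs : s ∈ Set.Ioo 0 1)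
    (hf : ContDiff ℝ 2 f) (hode : ∀ r, deriv (deriv f) r = k r * f r)
    (hk : ∀ r, k r ∈ Set.Icc 0 1) (hkl : ∀ r ≤ -ε, k r = τ) (hε : 0 < ε)
    (hf0 : f 0 = ℓ) (hf'0 : deriv f 0 = ℓ)
    (hM : ∀ r ∈ Set.Icc (-R) 0,
      |ℓ * Real.cosh (r * s) + ℓ / s * Real.sinh (r * s)| ≤ M)
    {r : ℝ} (hr : r ∈ Set.Icc (-R) 0) :
    |f r - (ℓ * Real.cosh (r * s) + ℓ / s * Real.sinh (r * s))| ≤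
        (M * (Real.exp ε - 1) + M * |τ - s ^ 2|) * Real.exp R ∧
    |deriv f r - (ℓ * s * Real.sinh (r * s) + ℓ * Real.cosh (r * s))| ≤
        (M * (Real.exp ε - 1) + M * |τ - s ^ 2|) * Real.exp R := by
  have hs0 : s ≠ 0 := hs.1.ne'
  have hM0 : 0 ≤ M := (abs_nonneg _).trans (hM r hr)
  set g : ℝ → ℝ := fun r => ℓ * Real.cosh (r * s) + ℓ / s * Real.sinh (r * s) with hg
  set g' : ℝ → ℝ := fun r => ℓ * s * Real.sinh (r * s) + ℓ * Real.cosh (r * s) with hg'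
  have hf₁ : ∀ x, HasDerivAt f (deriv f x) x :=
    fun x => (hf.differentiable (by norm_num) x).hasDerivAt
  have hf₂ : ∀ x, HasDerivAt (deriv f) (k x * f x) x :=
    fun x => hode x ▸ (hf.differentiable_deriv_two x).hasDerivAt
  have hlin : ∀ x, HasDerivAt (fun x : ℝ => x * s) s x := fun x => hasDerivAt_mul_const s
  have hg₁ : ∀ x, HasDerivAt g (g' x) x := fun x =>
    (((hlin x).cosh.const_mul ℓ).add ((hlin x).sinh.const_mul (ℓ / s))).congr_deriv
      (by simp only [hg']; field_simp)
  have hg₂ : ∀ x, HasDerivAt g' (s ^ 2 * g x) x := fun x =>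
    (((hlin x).sinh.const_mul (ℓ * s)).add ((hlin x).cosh.const_mul ℓ)).congr_deriv
      (by simp only [hg]; field_simp)
  have hp : ∀ x, HasDerivAt (fun x => f (-x) - g (-x)) (-(deriv f (-x) - g' (-x))) x := fun x =>
    (((hf₁ (-x)).comp x (hasDerivAt_neg x)).sub
      ((hg₁ (-x)).comp x (hasDerivAt_neg x))).congr_deriv (by ring)
  have hq : ∀ x, HasDerivAt (fun x => -(deriv f (-x) - g' (-x)))
      (k (-x) * (f (-x) - g (-x)) + (k (-x) - s ^ 2) * g (-x)) x := fun x =>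
    (((hf₂ (-x)).comp x (hasDerivAt_neg x)).sub
      ((hg₂ (-x)).comp x (hasDerivAt_neg x))).neg.congr_deriv
      (by ring)
  have hk₁ : ∀ x, |k x| ≤ 1 := fun x => abs_le.mpr ⟨by linarith [(hk x).1], (hk x).2⟩
  have hs2 : s ^ 2 ≤ 1 := pow_le_one₀ hs.1.le hs.2.le
  have hks : ∀ x, |k x - s ^ 2| ≤ 1 := fun x =>
    abs_le.mpr ⟨by linarith [(hk x).1], by linarith [(hk x).2, sq_nonneg s]⟩
  have near : ∀ x ∈ Set.Icc 0 (min ε R),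
      |f (-x) - g (-x)| ≤ M * (Real.exp ε - 1) ∧
      |-(deriv f (-x) - g' (-x))| ≤ M * (Real.exp ε - 1) := by
    intro x hx
    have h := abs_le_of_second_order_perturbation (k := fun x => k (-x)) (δ := 0) (η := M) hp hq
      (fun y _ => hk₁ _) (fun y hy => by
        rw [abs_mul]
        have := hM (-y) ⟨by linarith [hy.2, min_le_right ε R], by linarith [hy.1]⟩
        exact (mul_le_of_le_one_left (abs_nonneg _) (hks _)).trans this) hM0
      (by simp [hf0, hg]) (by simp [hf'0, hg']) x hx
    have hexp : M * (Real.exp (x - 0) - 1) ≤ M * (Real.exp ε - 1) := by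
      gcongr
      linarith [hx.2, min_le_left ε R]
    constructor <;> linarith [h.1, h.2]
  have h0 : 0 ≤ M * (Real.exp ε - 1) :=
    mul_nonneg hM0 (by linarith [Real.add_one_le_exp ε])
  have h1 : 0 ≤ M * |τ - s ^ 2| := by positivity
  have hR : 0 ≤ R := by linarith [hr.1, hr.2]
  suffices h : |f (- -r) - g (- -r)| ≤ (M * (Real.exp ε - 1) + M * |τ - s ^ 2|) * Real.exp R ∧
      |-(deriv f (- -r) - g' (- -r))| ≤ (M * (Real.exp ε - 1) + M * |τ - s ^ 2|) * Real.exp R by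
    simpa only [neg_neg, abs_neg] using h
  rcases le_total (-r) ε with hrε | hrε
  · have h := near (-r) ⟨by linarith [hr.2], le_min hrε (by linarith [hr.1])⟩
    have hle : M * (Real.exp ε - 1) ≤
        (M * (Real.exp ε - 1) + M * |τ - s ^ 2|) * Real.exp R :=
      (le_add_of_nonneg_right h1).trans
        (le_mul_of_one_le_right (add_nonneg h0 h1) (Real.one_le_exp hR))
    exact ⟨h.1.trans hle, h.2.trans hle⟩
  · have hεR : ε ≤ R := by linarith [hr.1]
    have hε' := near ε ⟨hε.le, le_min le_rfl hεR⟩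
    have h := abs_le_of_second_order_perturbation (k := fun x => k (-x)) (a := ε) (b := R)
      (η := M * |τ - s ^ 2|) hp hq
      (fun y _ => hk₁ _) (fun y hy => by
        rw [abs_mul, hkl (-y) (by linarith [hy.1]), mul_comm]
        have := hM (-y) ⟨by linarith [hy.2], by linarith [hy.1]⟩
        gcongr) h1
      hε'.1 hε'.2 (-r) ⟨hrε, by linarith [hr.1]⟩
    have hexp : Real.exp (-r - ε) ≤ Real.exp R := Real.exp_le_exp.mpr (by linarith [hr.1])
    have hle := mul_le_mul_of_nonneg_left hexp (add_nonneg h0 h1)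
    constructor <;> linarith [h.1, h.2]


/-- Theorem 4.1 (`Theorem thm:f-regular`) of Futer–Kalfagianni–Purcell, in
the critical case `ε → 0`: the solutions `f_i` of `f_i'' = k_i·f_i` for
continuous bump functions `k_i` with parameters `(t_i, ε_i)`, where
`t_i → t_lim` and `ε_i → 0`, converge (together with their derivatives)
uniformly on compact sets to the explicit limit solution `f_lim`. -/
theorem stmt_15 (ℓ₁ tlim : ℝ) (hℓ : 0 < ℓ₁) (htlim : tlim ∈ Set.Ioo (0 : ℝ) 1)
    (t ε : ℕ → ℝ)
    (ht : ∀ i, t i ∈ Set.Ioo (0 : ℝ) 1)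
    (htconv : Filter.Tendsto t Filter.atTop (nhds tlim))
    (hε : ∀ i, 0 < ε i)
    (hεconv : Filter.Tendsto ε Filter.atTop (nhds 0))
    (k : ℕ → ℝ → ℝ)
    (hkcont : ∀ i, Continuous (k i))
    (hkmono : ∀ i, Monotone (k i))
    (hkb : ∀ i r, t i ≤ k i r ∧ k i r ≤ 1)
    (hkl : ∀ i, ∀ r ≤ -ε i, k i r = t i)
    (hkr : ∀ i r, -ε i / 2 ≤ r → k i r = 1)
    (f : ℕ → ℝ → ℝ)
    (hfC2 : ∀ i, ContDiff ℝ 2 (f i))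
    (hode : ∀ i r, deriv (deriv (f i)) r = k i r * f i r)
    (hf0 : ∀ i, f i 0 = ℓ₁) (hf'0 : ∀ i, deriv (f i) 0 = ℓ₁)
    (flim flim' : ℝ → ℝ)
    (hflim : ∀ r, flim r = if 0 ≤ r then ℓ₁ * Real.exp r
      else ℓ₁ * Real.cosh (r * Real.sqrt tlim) +
        (ℓ₁ / Real.sqrt tlim) * Real.sinh (r * Real.sqrt tlim))
    (hflim' : ∀ r, flim' r = if 0 ≤ r then ℓ₁ * Real.exp r
      else ℓ₁ * Real.sqrt tlim * Real.sinh (r * Real.sqrt tlim) +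
        ℓ₁ * Real.cosh (r * Real.sqrt tlim)) :
    ∀ K : Set ℝ, IsCompact K →
      TendstoUniformlyOn (fun i => f i) flim Filter.atTop K ∧
      TendstoUniformlyOn (fun i => deriv (f i)) flim' Filter.atTop K := by
  intro K hK
  obtain ⟨R, hKR⟩ := hK.isBounded.subset_closedBall 0
  rw [Real.closedBall_eq_Icc, zero_sub, zero_add] at hKR
  set s := Real.sqrt tlim
  have hs2 : s ^ 2 = tlim := Real.sq_sqrt htlim.1.le
  have hs : s ∈ Set.Ioo (0 : ℝ) 1 :=
    ⟨Real.sqrt_pos.mpr htlim.1, (Real.sqrt_lt' one_pos).mpr (by simpa using htlim.2)⟩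
  obtain ⟨M, hM⟩ := (isCompact_Icc (a := -R) (b := 0)).exists_bound_of_continuousOn
    (f := fun r => ℓ₁ * Real.cosh (r * s) + ℓ₁ / s * Real.sinh (r * s))
    (Continuous.continuousOn (by fun_prop))
  set B : ℕ → ℝ := fun i => (M * (Real.exp (ε i) - 1) + M * |t i - s ^ 2|) * Real.exp R
  have hB0 : Filter.Tendsto B Filter.atTop (nhds 0) := by
    have h₁ : Filter.Tendsto (fun i => Real.exp (ε i)) Filter.atTop (nhds 1) := by
      simpa [Function.comp_def] using (Real.continuous_exp.tendsto 0).comp hεconv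
    have h₂ : Filter.Tendsto (fun i => |t i - s ^ 2|) Filter.atTop (nhds 0) := by
      simpa [hs2] using (htconv.sub_const tlim).abs
    simpa using (((h₁.sub_const 1).const_mul M).add (h₂.const_mul M)).mul_const (Real.exp R)
  have key : ∀ i, ∀ r ∈ K,
      (f i r = flim r ∧ deriv (f i) r = flim' r) ∨
      (|f i r - flim r| ≤ B i ∧ |deriv (f i) r - flim' r| ≤ B i) := by
    intro i r hr
    rcases le_or_gt 0 r with h0 | h0
    · left
      rw [hflim, hflim', if_pos h0, if_pos h0]
      exact eq_mul_exp_of_deriv_deriv_eq (hfC2 i) (hode i)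
        (fun x hx => hkr i x (by linarith [hε i])) (hf0 i) (hf'0 i) h0
    · right
      rw [hflim, hflim', if_neg h0.not_ge, if_neg h0.not_ge]
      exact abs_sub_le_of_deriv_deriv_eq hs (hfC2 i) (hode i)
        (fun x => ⟨(ht i).1.le.trans (hkb i x).1, (hkb i x).2⟩) (hkl i) (hε i) (hf0 i) (hf'0 i)
        hM ⟨(hKR hr).1, h0.le⟩
  simp only [Metric.tendstoUniformlyOn_iff, dist_comm (flim _), dist_comm (flim' _),
    Real.dist_eq]
  constructor <;> intro e he <;> filter_upwards [hB0.eventually_lt_const he] with i hi r hr <;>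
    rcases key i r hr with h | h
  · simpa [h.1] using he
  · exact h.1.trans_lt hi
  · simpa [h.2] using he
  · exact h.2.trans_lt hi
end

section
/- Let ℓ₁ > 0, ℓ₂ > 0 and t_lim ∈ (0,1). Let (t_i) be a sequence in (0,1) with t_i → t_lim and (ε_i) a sequence of positive reals with ε_i → 0. For each i, let k_i : ℝ → ℝ be a continuous bump function with parameters (t_i, ε_i); let f_i : ℝ → ℝ be a C² function with f_i''(r) = k_i(r)·f_i(r) for all r and f_i(0) = f_i'(0) = ℓ₁; and let g_i : ℝ → ℝ be a positive differentiable function with g_i(0) = ℓ₂ and g_i'(r)/g_i(r) = k_i(r)·f_i(r)/f_i'(r) for all r. Set r₀ = −tanh⁻¹(√t_lim)/√t_lim and define g_lim : ℝ → ℝ by g_lim(r) = ℓ₂·e^r for r ≥ 0 and g_lim(r) = ℓ₂·√(1−t_lim)·cosh(√t_lim·(r − r₀)) for r < 0. Then g_i → g_lim uniformly on every compact subset of ℝ. -/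
/-- The inverse hyperbolic tangent. -/
noncomputable def artanh (x : ℝ) : ℝ := Real.log ((1 + x) / (1 - x)) / 2

theorem sqrt_one_sub_sq_mul_exp_artanh {s : ℝ} (hs : s ∈ Set.Ioo (0 : ℝ) 1) :
    √(1 - s ^ 2) * Real.exp (artanh s) = 1 + s ∧
      √(1 - s ^ 2) * Real.exp (-artanh s) = 1 - s := by
  have hp : 0 < 1 + s := by linarith [hs.1]
  have hq : 0 < 1 - s := by linarith [hs.2]
  have hsq : √(1 - s ^ 2) = √(1 + s) * √(1 - s) := by
    rw [← Real.sqrt_mul hp.le]; ring_nf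
  have hexp : Real.exp (artanh s) = √(1 + s) / √(1 - s) := by
    rw [artanh, Real.exp_half, Real.exp_log (div_pos hp hq), Real.sqrt_div hp.le]
  have hp' := Real.sqrt_pos.2 hp
  have hq' := Real.sqrt_pos.2 hq
  rw [Real.exp_neg, hexp, hsq]
  constructor
  · field_simp
    exact Real.sq_sqrt hp.le
  · field_simp
    exact Real.sq_sqrt hq.le

theorem sqrt_one_sub_sq_mul_cosh_add_artanh {s : ℝ} (hs : s ∈ Set.Ioo (0 : ℝ) 1) (x : ℝ) :
    √(1 - s ^ 2) * Real.cosh (x + artanh s) = Real.cosh x + s * Real.sinh x := by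
  obtain ⟨h₁, h₂⟩ := sqrt_one_sub_sq_mul_exp_artanh hs
  simp only [Real.cosh_eq, Real.sinh_eq, neg_add, Real.exp_add]
  linear_combination Real.exp x / 2 * h₁ + Real.exp (-x) / 2 * h₂

/-- The derivative of the Duhamel combination comparing `f'' = k f` with `F'' = s² F`. -/
theorem hasDerivAt_duhamel {f f' : ℝ → ℝ} {κ : ℝ} (s a r : ℝ) (hf : HasDerivAt f (f' r) r)
    (hf' : HasDerivAt f' (κ * f r) r) :
    HasDerivAt (fun x => f x * (s * Real.sinh (s * (a - x))) + f' x * Real.cosh (s * (a - x)))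
      ((κ - s ^ 2) * f r * Real.cosh (s * (a - r))) r := by
  have hlin : HasDerivAt (fun x => s * (a - x)) (s * (-1)) r :=
    ((hasDerivAt_id r).const_sub a).const_mul s
  refine ((hf.mul (hlin.sinh.const_mul s)).add (hf'.mul hlin.cosh)).congr_deriv ?_
  ring

theorem sq_le_of_linear_ode {f f' k : ℝ → ℝ} (hf : ∀ r, HasDerivAt f (f' r) r)
    (hf' : ∀ r, HasDerivAt f' (k r * f r) r)
    (hk : ∀ r, k r ∈ Set.Icc (0 : ℝ) 1) {r : ℝ} (hr : r ≤ 0) :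
    f r ^ 2 ≤ (f 0 ^ 2 + f' 0 ^ 2) * Real.exp (-2 * r) := by
  have hd : ∀ x, HasDerivAt (fun x => (f x ^ 2 + f' x ^ 2) * Real.exp (2 * x))
      ((2 * f x * f' x * (1 + k x) + 2 * (f x ^ 2 + f' x ^ 2)) * Real.exp (2 * x)) x := by
    intro x
    have hlin : HasDerivAt (fun x : ℝ => 2 * x) (2 * 1) x := (hasDerivAt_id x).const_mul 2
    refine ((((hf x).pow 2).add ((hf' x).pow 2)).mul hlin.exp).congr_deriv ?_
    simp only [Pi.add_apply, Pi.pow_apply]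
    ring
  have hmono : Monotone fun x => (f x ^ 2 + f' x ^ 2) * Real.exp (2 * x) := by
    refine monotone_of_deriv_nonneg (fun x => (hd x).differentiableAt) fun x => ?_
    rw [(hd x).deriv]
    obtain ⟨h₀, h₁⟩ := hk x
    refine mul_nonneg ?_ (Real.exp_pos _).le
    nlinarith [mul_nonneg (by linarith : 0 ≤ 1 + k x) (sq_nonneg (f x + f' x)),
      mul_nonneg (sub_nonneg.2 h₁) (add_nonneg (sq_nonneg (f x)) (sq_nonneg (f' x)))]
  have h := hmono hr
  simp only [mul_zero, Real.exp_zero, mul_one] at h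
  have hprod : Real.exp (2 * r) * Real.exp (-2 * r) = 1 := by
    rw [← Real.exp_add]; simp
  calc f r ^ 2 ≤ f r ^ 2 + f' r ^ 2 := le_add_of_nonneg_right (sq_nonneg _)
    _ = (f r ^ 2 + f' r ^ 2) * Real.exp (2 * r) * Real.exp (-2 * r) := by
      rw [mul_assoc, hprod, mul_one]
    _ ≤ _ := mul_le_mul_of_nonneg_right h (Real.exp_pos _).le

theorem deriv_eq_mul_exp_of_linear_ode {f f' k : ℝ → ℝ} (hf : ∀ r, HasDerivAt f (f' r) r)
    (hf' : ∀ r, HasDerivAt f' (k r * f r) r)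
    {ℓ : ℝ} (hk : ∀ r, 0 ≤ r → k r = 1) (h₀ : f 0 = ℓ)
    (h₀' : f' 0 = ℓ) {a : ℝ} (ha : 0 ≤ a) : f' a = ℓ * Real.exp a := by
  have h := (convex_Icc 0 a).norm_image_sub_le_of_norm_hasDerivWithin_le (C := 0)
    (fun r _ => (hasDerivAt_duhamel 1 a r (hf r) (hf' r)).hasDerivWithinAt)
    (fun r hr => by simp [hk r hr.1]) ⟨le_rfl, ha⟩ ⟨ha, le_rfl⟩
  simp only [zero_mul, norm_le_zero_iff, sub_self, mul_zero, Real.sinh_zero, Real.cosh_zero,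
    zero_add, mul_one, one_mul, sub_zero, h₀, h₀'] at h
  rw [← Real.sinh_add_cosh]
  linear_combination h

theorem abs_deriv_sub_le_of_linear_ode {f f' k : ℝ → ℝ} (hf : ∀ r, HasDerivAt f (f' r) r)
    (hf' : ∀ r, HasDerivAt f' (k r * f r) r)
    {ℓ s t ε M : ℝ} (hℓ : 0 < ℓ) (hs : s ∈ Set.Ioo (0 : ℝ) 1)
    (hε : 0 < ε) (hk : ∀ r, k r ∈ Set.Icc (0 : ℝ) 1) (hkl : ∀ r ≤ -ε, k r = t)
    (h₀ : f 0 = ℓ) (h₀' : f' 0 = ℓ) {a : ℝ} (haM : -M ≤ a) (ha : a ≤ 0) :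
    |f' a - ℓ * (Real.cosh (s * a) + s * Real.sinh (s * a))| ≤
      2 * ℓ * Real.exp M * Real.cosh M * (|t - s ^ 2| * M + ε) := by
  set C := 2 * ℓ * Real.exp M * Real.cosh M with hC
  have hC0 : 0 ≤ C := by positivity
  have hM : 0 ≤ M := by linarith
  have hfb : ∀ r, a ≤ r → r ≤ 0 → |f r * Real.cosh (s * (a - r))| ≤ C := by
    intro r har hr
    have h₁ : |f r| ≤ 2 * ℓ * Real.exp M := by
      refine abs_le_of_sq_le_sq ?_ (by positivity)
      have h := sq_le_of_linear_ode hf hf' hk hr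
      have he : Real.exp (-2 * r) ≤ Real.exp M ^ 2 := by
        rw [← Real.exp_nat_mul]
        exact Real.exp_le_exp.2 (by push_cast; linarith)
      rw [h₀, h₀'] at h
      nlinarith [mul_le_mul_of_nonneg_left he (sq_nonneg ℓ), sq_nonneg (ℓ * Real.exp M)]
    have h₂ : Real.cosh (s * (a - r)) ≤ Real.cosh M := by
      rw [Real.cosh_le_cosh, abs_of_nonneg hM, abs_mul, abs_of_pos hs.1,
        abs_of_nonpos (by linarith)]
      nlinarith [hs.1, hs.2]
    rw [abs_mul, abs_of_pos (Real.cosh_pos _)]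
    exact mul_le_mul h₁ h₂ (Real.cosh_pos _).le (by positivity)
  set P := fun x => f x * (s * Real.sinh (s * (a - x))) + f' x * Real.cosh (s * (a - x)) with hP
  have hPd : ∀ r, HasDerivAt P ((k r - s ^ 2) * f r * Real.cosh (s * (a - r))) r := fun r =>
    hasDerivAt_duhamel s a r (hf r) (hf' r)
  have hs2 : 0 ≤ s ^ 2 ∧ s ^ 2 ≤ 1 := ⟨sq_nonneg s, by nlinarith [hs.1, hs.2]⟩
  set b := max a (-ε) with hb
  have hb0 : b ≤ 0 := max_le ha (by linarith)
  have hab : a ≤ b := le_max_left _ _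
  have hnear : |P b - P 0| ≤ C * ε := by
    have h := (convex_Icc b 0).norm_image_sub_le_of_norm_hasDerivWithin_le (C := C)
      (fun r _ => (hPd r).hasDerivWithinAt) (fun r hr => by
        rw [mul_assoc, Real.norm_eq_abs, abs_mul]
        have h₁ : |k r - s ^ 2| ≤ 1 := by
          rw [abs_le]; constructor <;> linarith [(hk r).1, (hk r).2]
        simpa using mul_le_mul h₁ (hfb r (hab.trans hr.1) hr.2) (abs_nonneg _) zero_le_one)
      ⟨hb0, le_rfl⟩ ⟨le_rfl, hb0⟩
    refine h.trans (mul_le_mul_of_nonneg_left ?_ hC0)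
    rw [Real.norm_eq_abs, sub_zero, abs_of_nonpos hb0]
    linarith [le_max_right a (-ε)]
  have hfar : |P a - P b| ≤ C * (|t - s ^ 2| * M) := by
    rcases le_total a (-ε) with hae | hae
    · have hbe : b = -ε := max_eq_right hae
      have h := (convex_Icc a b).norm_image_sub_le_of_norm_hasDerivWithin_le
        (C := |t - s ^ 2| * C)
        (fun r _ => (hPd r).hasDerivWithinAt) (fun r hr => by
          rw [mul_assoc, Real.norm_eq_abs, abs_mul, hkl r (hr.2.trans hbe.le)]
          exact mul_le_mul_of_nonneg_left (hfb r hr.1 (hr.2.trans hb0)) (abs_nonneg _))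
        ⟨hab, le_rfl⟩ ⟨le_rfl, hab⟩
      calc |P a - P b| ≤ |t - s ^ 2| * C * ‖a - b‖ := h
        _ ≤ |t - s ^ 2| * C * M := by
          refine mul_le_mul_of_nonneg_left ?_ (by positivity)
          rw [Real.norm_eq_abs, abs_of_nonpos (by linarith)]
          linarith
        _ = _ := by ring
    · rw [hb, max_eq_left hae, sub_self, abs_zero]
      positivity
  have hPa : P a = f' a := by simp [hP]
  have hP0 : P 0 = ℓ * (Real.cosh (s * a) + s * Real.sinh (s * a)) := by
    simp only [hP, h₀, h₀', sub_zero]; ring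
  rw [← hPa, ← hP0]
  calc |P a - P 0| ≤ |P a - P b| + |P b - P 0| := abs_sub_le _ _ _
    _ ≤ C * (|t - s ^ 2| * M) + C * ε := add_le_add hfar hnear
    _ = _ := by ring

/-- If `g'/g = f''/f'` on an interval where `f'` does not vanish, then `g` is proportional
to `f'` there. -/
theorem mul_eq_mul_of_logDeriv_eq {h h' g : ℝ → ℝ} {M : ℝ} (hh : ∀ r, HasDerivAt h (h' r) r)
    (hg : Differentiable ℝ g) (hg0 : ∀ r, g r ≠ 0) (hh0 : ∀ r ∈ Set.Icc (-M) M, h r ≠ 0)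
    (hode : ∀ r, deriv g r / g r = h' r / h r) {a : ℝ} (ha : a ∈ Set.Icc (-M) M) :
    g a * h 0 = g 0 * h a := by
  have hM : (0 : ℝ) ∈ Set.Icc (-M) M := by
    constructor <;> linarith [ha.1, ha.2]
  have hconst := (convex_Icc (-M) M).norm_image_sub_le_of_norm_hasDerivWithin_le (C := 0)
    (fun r hr => ((hg r).hasDerivAt.div (hh r) (hh0 r hr)).hasDerivWithinAt)
    (fun r hr => by
      have h := hode r
      rw [div_eq_div_iff (hg0 r) (hh0 r hr)] at h
      rw [h, mul_comm (h' r), sub_self, zero_div, norm_zero]) hM ha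
  simp only [zero_mul, norm_le_zero_iff, sub_eq_zero, Pi.div_apply] at hconst
  exact (div_eq_div_iff (hh0 a ha) (hh0 0 hM)).1 hconst

/-- Theorem 4.5 (`Theorem thm:g-regular`) of Futer–Kalfagianni–Purcell, in
the critical case `ε → 0`: the solutions `g_i` of `g_i'/g_i = k_i·f_i/f_i'`
with `g_i(0) = ℓ₂`, for continuous bump functions `k_i` with parameters
`(t_i, ε_i)` where `t_i → t_lim` and `ε_i → 0`, converge uniformly on
compact sets to the explicit limit `g_lim`. -/
theorem stmt_16 (ℓ₁ ℓ₂ tlim : ℝ) (hℓ₁ : 0 < ℓ₁) (hℓ₂ : 0 < ℓ₂)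
    (htlim : tlim ∈ Set.Ioo (0 : ℝ) 1)
    (t ε : ℕ → ℝ)
    (ht : ∀ i, t i ∈ Set.Ioo (0 : ℝ) 1)
    (htconv : Filter.Tendsto t Filter.atTop (nhds tlim))
    (hε : ∀ i, 0 < ε i)
    (hεconv : Filter.Tendsto ε Filter.atTop (nhds 0))
    (k : ℕ → ℝ → ℝ)
    (hkcont : ∀ i, Continuous (k i))
    (hkmono : ∀ i, Monotone (k i))
    (hkb : ∀ i r, t i ≤ k i r ∧ k i r ≤ 1)
    (hkl : ∀ i, ∀ r ≤ -ε i, k i r = t i)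
    (hkr : ∀ i r, -ε i / 2 ≤ r → k i r = 1)
    (f : ℕ → ℝ → ℝ)
    (hfC2 : ∀ i, ContDiff ℝ 2 (f i))
    (hode : ∀ i r, deriv (deriv (f i)) r = k i r * f i r)
    (hf0 : ∀ i, f i 0 = ℓ₁) (hf'0 : ∀ i, deriv (f i) 0 = ℓ₁)
    (g : ℕ → ℝ → ℝ)
    (hgpos : ∀ i r, 0 < g i r)
    (hgdiff : ∀ i, Differentiable ℝ (g i))
    (hg0 : ∀ i, g i 0 = ℓ₂)
    (hgode : ∀ i r, deriv (g i) r / g i r = k i r * f i r / deriv (f i) r)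
    (r₀ : ℝ) (hr₀ : r₀ = -artanh (Real.sqrt tlim) / Real.sqrt tlim)
    (glim : ℝ → ℝ)
    (hglim : ∀ r, glim r = if 0 ≤ r then ℓ₂ * Real.exp r
      else ℓ₂ * Real.sqrt (1 - tlim) *
        Real.cosh (Real.sqrt tlim * (r - r₀))) :
    ∀ K : Set ℝ, IsCompact K →
      TendstoUniformlyOn (fun i => g i) glim Filter.atTop K := by
  set s := √tlim with hsdef
  have hss : s ^ 2 = tlim := Real.sq_sqrt htlim.1.le
  have hs0 : 0 < s := Real.sqrt_pos.2 htlim.1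
  have hs : s ∈ Set.Ioo (0 : ℝ) 1 := ⟨hs0, by nlinarith [htlim.2]⟩
  have hfd : ∀ i r, HasDerivAt (f i) (deriv (f i) r) r := fun i r =>
    ((hfC2 i).differentiable (by norm_num) r).hasDerivAt
  have hfd' : ∀ i r, HasDerivAt (deriv (f i)) (k i r * f i r) r := fun i r => by
    rw [← hode]
    exact ((hfC2 i).differentiable_deriv_two r).hasDerivAt
  have hk : ∀ i r, k i r ∈ Set.Icc (0 : ℝ) 1 := fun i r =>
    ⟨(ht i).1.le.trans (hkb i r).1, (hkb i r).2⟩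
  have hglim_neg : ∀ r < 0, glim r = ℓ₂ * (Real.cosh (s * r) + s * Real.sinh (s * r)) := by
    intro r hr
    have hx : s * (r - r₀) = s * r + artanh s := by
      rw [hr₀]; field_simp; ring
    rw [hglim, if_neg hr.not_ge, hx, ← hss, mul_assoc, sqrt_one_sub_sq_mul_cosh_add_artanh hs]
  intro K hK
  obtain ⟨M, hKM⟩ := hK.isBounded.subset_closedBall 0
  rw [Real.closedBall_eq_Icc, zero_sub, zero_add] at hKM
  have hdist : ∀ i, ∀ a ∈ Set.Icc (-M) M, |ℓ₂ / ℓ₁ * deriv (f i) a - glim a| ≤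
      2 * ℓ₂ * Real.exp M * Real.cosh M * (|t i - tlim| * M + ε i) := by
    intro i a ha
    have hM : 0 ≤ M := by linarith [ha.1, ha.2]
    have := hε i
    rcases lt_or_ge a 0 with ha0 | ha0
    · have h := abs_deriv_sub_le_of_linear_ode (hfd i) (hfd' i) hℓ₁ hs (hε i) (hk i) (hkl i)
        (hf0 i) (hf'0 i) ha.1 ha0.le
      rw [hss] at h
      rw [hglim_neg a ha0]
      calc _ = |ℓ₂ / ℓ₁ * (deriv (f i) a -
            ℓ₁ * (Real.cosh (s * a) + s * Real.sinh (s * a)))| := by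
            congr 1; field_simp
        _ = ℓ₂ / ℓ₁ * |deriv (f i) a - ℓ₁ * (Real.cosh (s * a) + s * Real.sinh (s * a))| := by
            rw [abs_mul, abs_of_pos (div_pos hℓ₂ hℓ₁)]
        _ ≤ _ := mul_le_mul_of_nonneg_left h (div_pos hℓ₂ hℓ₁).le
        _ = _ := by field_simp
    · rw [deriv_eq_mul_exp_of_linear_ode (hfd i) (hfd' i)
        (fun r hr => hkr i r (by linarith)) (hf0 i) (hf'0 i) ha0, hglim, if_pos ha0,
        div_mul_eq_mul_div, mul_left_comm, mul_div_cancel_left₀ _ hℓ₁.ne', sub_self, abs_zero]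
      positivity
  have hlim : Filter.Tendsto
      (fun i => 2 * ℓ₂ * Real.exp M * Real.cosh M * (|t i - tlim| * M + ε i))
      Filter.atTop (nhds 0) := by
    simpa using (((htconv.sub_const tlim).abs.mul_const M).add hεconv).const_mul
      (2 * ℓ₂ * Real.exp M * Real.cosh M)
  have hsq : 0 < √(1 - tlim) := Real.sqrt_pos.2 (by linarith [htlim.2])
  have hsq1 : √(1 - tlim) ≤ 1 := Real.sqrt_le_one.2 (by linarith [htlim.1])
  have hglim_ge : ∀ a, ℓ₂ * √(1 - tlim) ≤ glim a := by
    intro a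
    rw [hglim]
    split_ifs with ha
    · exact mul_le_mul_of_nonneg_left (hsq1.trans (Real.one_le_exp ha)) hℓ₂.le
    · exact le_mul_of_one_le_right (by positivity) (Real.one_le_cosh _)
  rw [Metric.tendstoUniformlyOn_iff]
  intro δ hδ
  filter_upwards [hlim.eventually_lt_const hδ,
    hlim.eventually_lt_const (mul_pos hℓ₂ hsq)] with i hi hi' a ha
  have hne : ∀ r ∈ Set.Icc (-M) M, deriv (f i) r ≠ 0 := by
    intro r hr h0
    have h := hdist i r hr
    rw [h0, mul_zero, zero_sub, abs_neg] at h
    linarith [hglim_ge r, le_abs_self (glim r)]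
  have hprop := mul_eq_mul_of_logDeriv_eq (hfd' i) (hgdiff i) (fun r => (hgpos i r).ne') hne
    (hgode i) (hKM ha)
  rw [hf'0, hg0] at hprop
  have hg : g i a = ℓ₂ / ℓ₁ * deriv (f i) a := by
    field_simp; exact hprop
  rw [dist_comm, Real.dist_eq, hg]
  exact (hdist i a (hKM ha)).trans_lt hi
end

section
/- Let ℓ₁ > 2π and set h(ℓ₁) = 1 − (2π/ℓ₁)². For t ∈ (0,1) and ε > 0, let f_{t,ε} : ℝ → ℝ denote the C² solution of f''(r) = k_{t,ε}(r)·f(r) with f(0) = f'(0) = ℓ₁ (where k_{t,ε} is the explicit bump function defined in the context), let r₀(t,ε) denote the unique zero of f_{t,ε}, and set m(t,ε) = f_{t,ε}'(r₀(t,ε)). Then for every t ∈ (0, h(ℓ₁)) there exists a unique ε(t) > 0 such that m(t, ε(t)) = 2π; moreover, ε(t) → 0 as t → h(ℓ₁) from below. -/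
/-- The smooth bump profile `z(u) = exp(-1/u² - 1/(u-1)²)` on `(0,1)`,
extended by `0` elsewhere. -/
noncomputable def zfun (u : ℝ) : ℝ :=
  if u ∈ Set.Ioo (0 : ℝ) 1 then Real.exp (-1 / u ^ 2 - 1 / (u - 1) ^ 2) else 0

/-- The explicit bump function `k_{t,ε}` of Futer–Kalfagianni–Purcell:
equal to `t` for `r ≤ -ε`, to `1` for `r ≥ -ε/2`, and interpolating
smoothly in between. -/
noncomputable def kbump (t ε r : ℝ) : ℝ :=
  if r ≤ -ε then t
  else if -ε / 2 ≤ r then 1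
  else t + (1 - t) * (∫ u in (0 : ℝ)..(2 + 2 * r / ε), zfun u) /
    (∫ u in (0 : ℝ)..1, zfun u)

open Set MeasureTheory

lemma mul_sub_le_sub_of_hasDerivAt {φ φ' : ℝ → ℝ} {a b c : ℝ} (hab : a ≤ b)
    (hφ : ∀ x ∈ Icc a b, HasDerivAt φ (φ' x) x) (hc : ∀ x ∈ Ioo a b, c ≤ φ' x) :
    c * (b - a) ≤ φ b - φ a := by
  rcases hab.eq_or_lt with rfl | hlt
  · simp
  obtain ⟨x, hx, hxe⟩ := exists_hasDerivAt_eq_slope φ φ' hlt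
    (fun x hx => (hφ x hx).continuousAt.continuousWithinAt)
    (fun x hx => hφ x (Ioo_subset_Icc_self hx))
  have hx' := hc x hx
  rwa [hxe, le_div_iff₀ (sub_pos.2 hlt)] at hx'

lemma sub_le_mul_sub_of_hasDerivAt {φ φ' : ℝ → ℝ} {a b c : ℝ} (hab : a ≤ b)
    (hφ : ∀ x ∈ Icc a b, HasDerivAt φ (φ' x) x) (hc : ∀ x ∈ Ioo a b, φ' x ≤ c) :
    φ b - φ a ≤ c * (b - a) := by
  have := mul_sub_le_sub_of_hasDerivAt (φ := fun x => -φ x) (φ' := fun x => -φ' x) (c := -c) hab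
    (fun x hx => (hφ x hx).neg) (fun x hx => neg_le_neg (hc x hx))
  linarith

lemma le_of_hasDerivAt_nonneg_s17 {φ φ' : ℝ → ℝ} {a b : ℝ} (hab : a ≤ b)
    (hφ : ∀ x ∈ Icc a b, HasDerivAt φ (φ' x) x) (hc : ∀ x ∈ Ioo a b, 0 ≤ φ' x) : φ a ≤ φ b := by
  have := mul_sub_le_sub_of_hasDerivAt hab hφ hc
  linarith

lemma le_of_hasDerivAt_nonpos {φ φ' : ℝ → ℝ} {a b : ℝ} (hab : a ≤ b)
    (hφ : ∀ x ∈ Icc a b, HasDerivAt φ (φ' x) x) (hc : ∀ x ∈ Ioo a b, φ' x ≤ 0) : φ b ≤ φ a := by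
  have := sub_le_mul_sub_of_hasDerivAt hab hφ hc
  linarith

/-! ### The bump function -/

lemma zfun_nonneg (u : ℝ) : 0 ≤ zfun u := by
  unfold zfun
  split_ifs
  · positivity
  · rfl

lemma zfun_le_one (u : ℝ) : zfun u ≤ 1 := by
  unfold zfun
  split_ifs
  · rw [Real.exp_le_one_iff]
    have h1 : 0 ≤ 1 / u ^ 2 := by positivity
    have h2 : 0 ≤ 1 / (u - 1) ^ 2 := by positivity
    rw [neg_div]
    linarith
  · exact zero_le_one

lemma zfun_pos {u : ℝ} (hu : u ∈ Ioo (0 : ℝ) 1) : 0 < zfun u := by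
  rw [zfun, if_pos hu]
  positivity

lemma zfun_of_notMem {u : ℝ} (hu : u ∉ Ioo (0 : ℝ) 1) : zfun u = 0 := if_neg hu

lemma measurable_zfun : Measurable zfun :=
  Measurable.ite measurableSet_Ioo (by fun_prop) measurable_const

lemma intervalIntegrable_zfun (a b : ℝ) : IntervalIntegrable zfun volume a b := by
  refine (intervalIntegrable_const (c := (1 : ℝ))).mono_fun measurable_zfun.aestronglyMeasurable ?_
  refine Filter.Eventually.of_forall fun u => ?_
  simpa [abs_of_nonneg (zfun_nonneg u)] using zfun_le_one u

lemma integral_zfun_pos {a b : ℝ} (ha : 0 ≤ a) (hab : a < b) (hb : b ≤ 1) :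
    0 < ∫ u in a..b, zfun u :=
  intervalIntegral.intervalIntegral_pos_of_pos_on (intervalIntegrable_zfun a b)
    (fun _ hx => zfun_pos ⟨ha.trans_lt hx.1, hx.2.trans_le hb⟩) hab

lemma integral_zfun_nonneg {a b : ℝ} (hab : a ≤ b) : 0 ≤ ∫ u in a..b, zfun u :=
  intervalIntegral.integral_nonneg hab fun u _ => zfun_nonneg u

lemma integral_zfun_le {a b : ℝ} (hab : a ≤ b) : ∫ u in a..b, zfun u ≤ b - a := by
  have := intervalIntegral.integral_mono_on hab (intervalIntegrable_zfun a b)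
    (intervalIntegrable_const (c := (1 : ℝ))) (fun u _ => zfun_le_one u)
  simpa using this

/-- The normalised primitive of the profile `zfun`. -/
noncomputable def zstep (s : ℝ) : ℝ := (∫ u in (0 : ℝ)..s, zfun u) / ∫ u in (0 : ℝ)..1, zfun u

lemma zstep_sub (a b : ℝ) :
    zstep b - zstep a = (∫ u in a..b, zfun u) / ∫ u in (0 : ℝ)..1, zfun u := by
  rw [zstep, zstep, ← sub_div, intervalIntegral.integral_interval_sub_left
    (intervalIntegrable_zfun _ _) (intervalIntegrable_zfun _ _)]

lemma zstep_mono : Monotone zstep := fun a b hab => by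
  rw [← sub_nonneg, zstep_sub]
  exact div_nonneg (integral_zfun_nonneg hab) (integral_zfun_nonneg zero_le_one)

lemma zstep_sub_le {a b : ℝ} (hab : a ≤ b) :
    zstep b - zstep a ≤ (b - a) / ∫ u in (0 : ℝ)..1, zfun u := by
  rw [zstep_sub]
  exact div_le_div_of_nonneg_right (integral_zfun_le hab) (integral_zfun_nonneg zero_le_one)

lemma zstep_zero : zstep 0 = 0 := by simp [zstep]

lemma zstep_one : zstep 1 = 1 := div_self (integral_zfun_pos le_rfl one_pos le_rfl).ne'

lemma zstep_of_nonpos {s : ℝ} (hs : s ≤ 0) : zstep s = 0 := by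
  have : ∫ u in s..0, zfun u = 0 := by
    rw [intervalIntegral.integral_congr (g := fun _ => (0 : ℝ))]
    · simp
    · intro u hu
      rw [uIcc_of_le hs] at hu
      exact zfun_of_notMem fun h => absurd h.1 hu.2.not_gt
  have h := zstep_sub s 0
  rw [this, zstep_zero] at h
  simpa using h

lemma zstep_of_one_le {s : ℝ} (hs : 1 ≤ s) : zstep s = 1 := by
  have : ∫ u in 1..s, zfun u = 0 := by
    rw [intervalIntegral.integral_congr (g := fun _ => (0 : ℝ))]
    · simp
    · intro u hu
      rw [uIcc_of_le hs] at hu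
      exact zfun_of_notMem fun h => absurd h.2 hu.1.not_gt
  have h := zstep_sub 1 s
  rw [this, zstep_one] at h
  linarith [zero_div (∫ u in (0 : ℝ)..1, zfun u)]

lemma zstep_nonneg (s : ℝ) : 0 ≤ zstep s := by
  rcases le_total s 0 with h | h
  · rw [zstep_of_nonpos h]
  · exact zstep_zero ▸ zstep_mono h

lemma zstep_le_one (s : ℝ) : zstep s ≤ 1 := by
  rcases le_total 1 s with h | h
  · rw [zstep_of_one_le h]
  · exact zstep_one ▸ zstep_mono h

lemma zstep_lt_one {s : ℝ} (hs : s < 1) : zstep s < 1 := by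
  have h : zstep (max s 0) < zstep 1 := by
    rw [← sub_pos, zstep_sub]
    exact div_pos (integral_zfun_pos (le_max_right _ _) (max_lt hs one_pos) le_rfl)
      (integral_zfun_pos le_rfl one_pos le_rfl)
  exact zstep_one ▸ (zstep_mono (le_max_left s 0)).trans_lt h

lemma kbump_eq (t : ℝ) {ε : ℝ} (hε : 0 < ε) (r : ℝ) :
    kbump t ε r = t + (1 - t) * zstep (2 + 2 * r / ε) := by
  unfold kbump
  split_ifs with h1 h2
  · rw [zstep_of_nonpos]
    · ring
    · have : 2 * r / ε ≤ -2 := by rw [div_le_iff₀ hε]; linarith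
      linarith
  · rw [zstep_of_one_le]
    · ring
    · have : -1 ≤ 2 * r / ε := by rw [le_div_iff₀ hε]; linarith
      linarith
  · rw [zstep, mul_div_assoc]

lemma le_kbump {t ε : ℝ} (ht : t ≤ 1) (hε : 0 < ε) (r : ℝ) : t ≤ kbump t ε r := by
  rw [kbump_eq t hε]
  nlinarith [zstep_nonneg (2 + 2 * r / ε)]

lemma kbump_le_one {t ε : ℝ} (ht : t ≤ 1) (hε : 0 < ε) (r : ℝ) : kbump t ε r ≤ 1 := by
  rw [kbump_eq t hε]
  nlinarith [zstep_le_one (2 + 2 * r / ε)]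

lemma kbump_of_le {t ε r : ℝ} (hr : r ≤ -ε) : kbump t ε r = t := if_pos hr

lemma kbump_of_ge {t ε r : ℝ} (hε : 0 < ε) (hr : -ε / 2 ≤ r) : kbump t ε r = 1 := by
  rw [kbump, if_neg (by linarith), if_pos hr]

lemma kbump_lt_one {t ε r : ℝ} (ht : t < 1) (hε : 0 < ε) (hr : r < -ε / 2) :
    kbump t ε r < 1 := by
  rw [kbump_eq t hε]
  have : 2 * r / ε < -1 := by rw [div_lt_iff₀ hε]; linarith
  nlinarith [zstep_lt_one (show 2 + 2 * r / ε < 1 by linarith)]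

lemma two_mul_div_le_of_nonpos {ε₁ ε₂ r : ℝ} (h₁ : 0 < ε₁) (h : ε₁ ≤ ε₂) (hr : r ≤ 0) :
    2 + 2 * r / ε₁ ≤ 2 + 2 * r / ε₂ := by
  have := mul_le_mul_of_nonpos_left (one_div_le_one_div_of_le h₁ h)
    (show 2 * r ≤ 0 by linarith)
  rw [mul_one_div, mul_one_div] at this
  linarith

lemma kbump_mono_right {t ε₁ ε₂ r : ℝ} (ht : t ≤ 1) (h₁ : 0 < ε₁) (h : ε₁ ≤ ε₂) (hr : r ≤ 0) :
    kbump t ε₁ r ≤ kbump t ε₂ r := by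
  rw [kbump_eq t h₁, kbump_eq t (h₁.trans_le h)]
  have := zstep_mono (two_mul_div_le_of_nonpos h₁ h hr)
  have := mul_le_mul_of_nonneg_left this (sub_nonneg.2 ht)
  linarith

lemma kbump_sub_le {t ε₁ ε₂ r a R : ℝ} (ht : 0 ≤ t) (ha : 0 < a) (h₁ : a ≤ ε₁)
    (h : ε₁ ≤ ε₂) (hr : r ≤ 0) (hR : -r ≤ R) :
    kbump t ε₂ r - kbump t ε₁ r ≤
      2 * R / (a ^ 2 * ∫ u in (0 : ℝ)..1, zfun u) * (ε₂ - ε₁) := by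
  have hε₁ : 0 < ε₁ := ha.trans_le h₁
  have hε₂ : 0 < ε₂ := hε₁.trans_le h
  have hZ : 0 < ∫ u in (0 : ℝ)..1, zfun u := integral_zfun_pos le_rfl one_pos le_rfl
  have h2 := zstep_sub_le (two_mul_div_le_of_nonpos hε₁ h hr)
  have h3 := sub_nonneg.2 (zstep_mono (two_mul_div_le_of_nonpos hε₁ h hr))
  have h4 : 2 * r / ε₂ - 2 * r / ε₁ = 2 * (-r) * (ε₂ - ε₁) / (ε₁ * ε₂) := by
    field_simp
    ring
  have h5 : 2 * (-r) * (ε₂ - ε₁) / (ε₁ * ε₂) ≤ 2 * R * (ε₂ - ε₁) / a ^ 2 := by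
    have : 0 ≤ ε₂ - ε₁ := sub_nonneg.2 h
    have : a ^ 2 ≤ ε₁ * ε₂ := by nlinarith
    have : 0 ≤ R := by linarith
    gcongr
  rw [kbump_eq t hε₁, kbump_eq t hε₂]
  calc _ = (1 - t) * (zstep (2 + 2 * r / ε₂) - zstep (2 + 2 * r / ε₁)) := by ring
    _ ≤ 1 * (zstep (2 + 2 * r / ε₂) - zstep (2 + 2 * r / ε₁)) := by gcongr; linarith
    _ ≤ (2 * R * (ε₂ - ε₁) / a ^ 2) / ∫ u in (0 : ℝ)..1, zfun u := by
      rw [one_mul]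
      refine h2.trans (div_le_div_of_nonneg_right ?_ hZ.le)
      linarith
    _ = _ := by
      field_simp

/-! ### Solutions of `f'' = k f` -/

/-- `f` solves `f'' = k f` with `0 ≤ k ≤ 1`, has derivative `g`, satisfies
`f(0) = f'(0) = ℓ > 0`, and has `r₀` as its unique zero. -/
structure IsJacobiSolution (ℓ : ℝ) (k f g : ℝ → ℝ) (r₀ : ℝ) : Prop where
  pos : 0 < ℓ
  hasDerivAt : ∀ r, HasDerivAt f (g r) r
  hasDerivAt' : ∀ r, HasDerivAt g (k r * f r) r
  nonneg : ∀ r, 0 ≤ k r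
  le_one : ∀ r, k r ≤ 1
  apply_zero : f 0 = ℓ
  deriv_zero : g 0 = ℓ
  root : f r₀ = 0
  root_unique : ∀ r, f r = 0 → r = r₀

namespace IsJacobiSolution

variable {ℓ r₀ : ℝ} {k f g : ℝ → ℝ}

lemma continuous (S : IsJacobiSolution ℓ k f g r₀) : Continuous f :=
  continuous_iff_continuousAt.2 fun r => (S.hasDerivAt r).continuousAt

lemma root_neg (S : IsJacobiSolution ℓ k f g r₀) : r₀ < 0 := by
  by_contra! h
  have hpos : ∀ r ∈ Ico 0 r₀, 0 < f r := by
    intro r hr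
    by_contra! hfr
    obtain ⟨x, hx, hx0⟩ := intermediate_value_Icc' hr.1 S.continuous.continuousOn
      ⟨hfr, S.apply_zero ▸ S.pos.le⟩
    have := S.root_unique x hx0
    linarith [hx.2, hr.2]
  have hg : ∀ r ∈ Ioo 0 r₀, 0 ≤ g r := by
    intro r hr
    have : g 0 ≤ g r := le_of_hasDerivAt_nonneg_s17 hr.1.le (fun x _ => S.hasDerivAt' x) fun x hx =>
      mul_nonneg (S.nonneg x) (hpos x ⟨hx.1.le, hx.2.trans hr.2⟩).le
    linarith [S.deriv_zero, S.pos]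
  have := le_of_hasDerivAt_nonneg_s17 h (fun x _ => S.hasDerivAt x) hg
  linarith [S.apply_zero, S.root, S.pos]

lemma apply_pos (S : IsJacobiSolution ℓ k f g r₀) {r : ℝ} (hr : r₀ < r) : 0 < f r := by
  by_contra! hfr
  have h0 : f 0 ∈ Ici (0 : ℝ) := S.apply_zero ▸ S.pos.le
  obtain ⟨x, hx, hx0⟩ := intermediate_value_uIcc (a := r) (b := 0) S.continuous.continuousOn
    (mem_uIcc_of_le hfr h0)
  have := S.root_unique x hx0
  have := (lt_min hr S.root_neg).trans_le hx.1
  linarith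

lemma apply_nonneg (S : IsJacobiSolution ℓ k f g r₀) {r : ℝ} (hr : r₀ ≤ r) : 0 ≤ f r := by
  rcases hr.eq_or_lt with rfl | h
  · exact S.root.ge
  · exact (S.apply_pos h).le

lemma deriv_mono (S : IsJacobiSolution ℓ k f g r₀) {r s : ℝ} (hr : r₀ ≤ r) (hs : r ≤ s) :
    g r ≤ g s :=
  le_of_hasDerivAt_nonneg_s17 hs (fun x _ => S.hasDerivAt' x) fun x hx =>
    mul_nonneg (S.nonneg x) (S.apply_nonneg (hr.trans hx.1.le))

lemma deriv_le (S : IsJacobiSolution ℓ k f g r₀) {r : ℝ} (hr : r₀ ≤ r) (hr' : r ≤ 0) :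
    g r ≤ ℓ := S.deriv_zero ▸ S.deriv_mono hr hr'

lemma deriv_root_nonneg (S : IsJacobiSolution ℓ k f g r₀) : 0 ≤ g r₀ := by
  by_contra! h
  have hev : ∀ᶠ x in nhds r₀, g x < 0 := (S.hasDerivAt' r₀).continuousAt.eventually_lt_const h
  obtain ⟨δ, hδ, hball⟩ := Metric.eventually_nhds_iff.1 hev
  have h1 : f (r₀ + δ / 2) ≤ f r₀ :=
    le_of_hasDerivAt_nonpos (by linarith) (fun x _ => S.hasDerivAt x) fun x hx => by
      refine (hball ?_).le
      rw [Real.dist_eq, abs_of_pos (by linarith [hx.1])]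
      linarith [hx.2]
  have := S.apply_pos (show r₀ < r₀ + δ / 2 by linarith)
  linarith [S.root]

lemma deriv_nonneg (S : IsJacobiSolution ℓ k f g r₀) {r : ℝ} (hr : r₀ ≤ r) : 0 ≤ g r :=
  S.deriv_root_nonneg.trans (S.deriv_mono le_rfl hr)

lemma deriv_root_pos (S : IsJacobiSolution ℓ k f g r₀) : 0 < g r₀ := by
  have h : Real.exp (-0) * (f 0 + g 0) ≤ Real.exp (-r₀) * (f r₀ + g r₀) := by
    refine le_of_hasDerivAt_nonpos (φ := fun r => Real.exp (-r) * (f r + g r)) S.root_neg.le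
      (fun x _ => ((hasDerivAt_neg x).exp.mul ((S.hasDerivAt x).add (S.hasDerivAt' x)))) ?_
    intro x hx
    have h1 := S.apply_nonneg hx.1.le
    have h2 : k x * f x ≤ f x := mul_le_of_le_one_left h1 (S.le_one x)
    have h3 := Real.exp_pos (-x)
    nlinarith
  rw [S.apply_zero, S.deriv_zero, S.root, neg_zero, Real.exp_zero, one_mul, zero_add] at h
  exact pos_of_mul_pos_right (lt_of_lt_of_le (by linarith [S.pos]) h) (Real.exp_pos _).le

lemma apply_mono (S : IsJacobiSolution ℓ k f g r₀) {r s : ℝ} (hr : r₀ ≤ r) (hs : r ≤ s) :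
    f r ≤ f s :=
  le_of_hasDerivAt_nonneg_s17 hs (fun x _ => S.hasDerivAt x) fun _ hx =>
    S.deriv_nonneg (hr.trans hx.1.le)

lemma apply_le (S : IsJacobiSolution ℓ k f g r₀) {r : ℝ} (hr : r₀ ≤ r) (hr' : r ≤ 0) :
    f r ≤ ℓ := S.apply_zero ▸ S.apply_mono hr hr'

lemma le_apply (S : IsJacobiSolution ℓ k f g r₀) {r : ℝ} (hr : r₀ ≤ r) (hr' : r ≤ 0) :
    ℓ * (1 + r) ≤ f r := by
  have := sub_le_mul_sub_of_hasDerivAt hr' (fun x _ => S.hasDerivAt x) fun x hx =>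
    S.deriv_le (hr.trans hx.1.le) hx.2.le
  rw [S.apply_zero] at this
  linarith

lemma neg_root_le (S : IsJacobiSolution ℓ k f g r₀) : -r₀ ≤ ℓ / g r₀ := by
  have := mul_sub_le_sub_of_hasDerivAt S.root_neg.le (fun x _ => S.hasDerivAt x) fun x hx =>
    S.deriv_mono le_rfl hx.1.le
  rw [S.apply_zero, S.root] at this
  rw [le_div_iff₀ S.deriv_root_pos]
  linarith

lemma hasDerivAt_energy (S : IsJacobiSolution ℓ k f g r₀) (c r : ℝ) :
    HasDerivAt (fun r => g r ^ 2 - c * f r ^ 2) (2 * (k r - c) * (f r * g r)) r := by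
  refine (((S.hasDerivAt' r).pow 2).sub (((S.hasDerivAt r).pow 2).const_mul c)).congr_deriv ?_
  push_cast
  ring

lemma deriv_eq_apply (S : IsJacobiSolution ℓ k f g r₀) {s : ℝ} (hk : ∀ r ∈ Ioo s 0, k r = 1)
    (hs : s ≤ 0) : g s = f s := by
  have hd : ∀ x, HasDerivAt (fun r => Real.exp r * (g r - f r))
      (Real.exp x * (k x - 1) * f x) x := fun x => by
    refine ((Real.hasDerivAt_exp x).mul
      ((S.hasDerivAt' x).sub (S.hasDerivAt x))).congr_deriv ?_
    rw [Pi.sub_apply]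
    ring
  have h1 := le_of_hasDerivAt_nonneg_s17 hs (fun x _ => hd x) fun x hx => by simp [hk x hx]
  have h2 := le_of_hasDerivAt_nonpos hs (fun x _ => hd x) fun x hx => by simp [hk x hx]
  have h3 := le_antisymm h1 h2
  rw [S.apply_zero, S.deriv_zero, sub_self, mul_zero] at h3
  linarith [(mul_eq_zero.1 h3).resolve_left (Real.exp_pos s).ne']

lemma apply_eq_exp (S : IsJacobiSolution ℓ k f g r₀) {s : ℝ} (hk : ∀ r ∈ Ioo s 0, k r = 1)
    (hs : s ≤ 0) : f s = ℓ * Real.exp s := by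
  have hd : ∀ x, HasDerivAt (fun r => Real.exp (-r) * f r) (Real.exp (-x) * (g x - f x)) x :=
    fun x => by
      refine ((hasDerivAt_neg x).exp.mul (S.hasDerivAt x)).congr_deriv ?_
      ring
  have hfg : ∀ x ∈ Ioo s 0, g x = f x := fun x hx =>
    S.deriv_eq_apply (fun r hr => hk r ⟨hx.1.trans hr.1, hr.2⟩) hx.2.le
  have h1 := le_of_hasDerivAt_nonneg_s17 hs (fun x _ => hd x) fun x hx => by simp [hfg x hx]
  have h2 := le_of_hasDerivAt_nonpos hs (fun x _ => hd x) fun x hx => by simp [hfg x hx]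
  have h3 := le_antisymm h1 h2
  rw [S.apply_zero, neg_zero, Real.exp_zero, one_mul, Real.exp_neg] at h3
  rw [← h3]
  field_simp

lemma root_lt (S : IsJacobiSolution ℓ k f g r₀) {s : ℝ} (hk : ∀ r ∈ Ioo s 0, k r = 1) :
    r₀ < s := by
  by_contra! h
  have := S.deriv_eq_apply (s := r₀) (fun r hr => hk r ⟨h.trans_lt hr.1, hr.2⟩) S.root_neg.le
  linarith [S.root, S.deriv_root_pos]

lemma sq_deriv_root_le (S : IsJacobiSolution ℓ k f g r₀) {s t : ℝ}
    (hk : ∀ r ∈ Ioo s 0, k r = 1) (hs : s ≤ 0) (ht : ∀ r, t ≤ k r) :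
    g r₀ ^ 2 ≤ (1 - t) * ℓ ^ 2 * Real.exp s ^ 2 := by
  have h := le_of_hasDerivAt_nonneg_s17 (S.root_lt hk).le (fun x _ => S.hasDerivAt_energy t x)
    fun x hx => mul_nonneg (mul_nonneg zero_le_two (sub_nonneg.2 (ht x)))
      (mul_nonneg (S.apply_nonneg hx.1.le) (S.deriv_nonneg hx.1.le))
  rw [S.root, S.deriv_eq_apply hk hs, S.apply_eq_exp hk hs] at h
  linarith

lemma le_sq_deriv_root (S : IsJacobiSolution ℓ k f g r₀) {s t : ℝ}
    (hk : ∀ r < s, k r = t) (hs : s ≤ 0) (hs' : -1 < s) (ht : t ≤ 1) :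
    (1 - t) * (ℓ * (1 + s)) ^ 2 ≤ g r₀ ^ 2 := by
  have hrs : r₀ < s := by
    by_contra! h
    have := S.le_apply le_rfl S.root_neg.le
    rw [S.root] at this
    nlinarith [S.pos]
  have h1 := le_of_hasDerivAt_nonpos hrs.le (fun x _ => S.hasDerivAt_energy t x)
    fun x hx => by simp [hk x hx.2]
  have h2 := le_of_hasDerivAt_nonpos hs (fun x _ => S.hasDerivAt_energy 1 x)
    fun x hx => mul_nonpos_of_nonpos_of_nonneg (by linarith [S.le_one x])
      (mul_nonneg (S.apply_nonneg (hrs.trans hx.1).le) (S.deriv_nonneg (hrs.trans hx.1).le))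
  rw [S.root] at h1
  rw [S.apply_zero, S.deriv_zero] at h2
  have h3 : (ℓ * (1 + s)) ^ 2 ≤ f s ^ 2 :=
    pow_le_pow_left₀ (mul_nonneg S.pos.le (by linarith)) (S.le_apply hrs.le hs) 2
  nlinarith

/-! ### Comparison of two solutions -/

variable {r₁ r₂ : ℝ} {k₁ k₂ f₁ f₂ g₁ g₂ : ℝ → ℝ}

lemma hasDerivAt_wronskian (S₁ : IsJacobiSolution ℓ k₁ f₁ g₁ r₁)
    (S₂ : IsJacobiSolution ℓ k₂ f₂ g₂ r₂) (r : ℝ) :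
    HasDerivAt (fun r => g₁ r * f₂ r - f₁ r * g₂ r) ((k₁ r - k₂ r) * (f₁ r * f₂ r)) r := by
  refine (((S₁.hasDerivAt' r).mul (S₂.hasDerivAt r)).sub
    ((S₁.hasDerivAt r).mul (S₂.hasDerivAt' r))).congr_deriv ?_
  ring

lemma wronskian_nonneg (S₁ : IsJacobiSolution ℓ k₁ f₁ g₁ r₁)
    (S₂ : IsJacobiSolution ℓ k₂ f₂ g₂ r₂) (hk : ∀ r ≤ 0, k₁ r ≤ k₂ r) {r : ℝ} (h₁ : r₁ ≤ r)
    (h₂ : r₂ ≤ r) (hr : r ≤ 0) : 0 ≤ g₁ r * f₂ r - f₁ r * g₂ r := by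
  have := le_of_hasDerivAt_nonpos hr (fun x _ => S₁.hasDerivAt_wronskian S₂ x) fun x hx =>
    mul_nonpos_of_nonpos_of_nonneg (sub_nonpos.2 (hk x hx.2.le))
      (mul_nonneg (S₁.apply_nonneg (h₁.trans hx.1.le)) (S₂.apply_nonneg (h₂.trans hx.1.le)))
  rw [S₁.apply_zero, S₁.deriv_zero, S₂.apply_zero, S₂.deriv_zero] at this
  linarith

lemma root_le_root (S₁ : IsJacobiSolution ℓ k₁ f₁ g₁ r₁)
    (S₂ : IsJacobiSolution ℓ k₂ f₂ g₂ r₂) (hk : ∀ r ≤ 0, k₁ r ≤ k₂ r) : r₂ ≤ r₁ := by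
  by_contra! h
  have := S₁.wronskian_nonneg S₂ hk h.le le_rfl S₂.root_neg.le
  rw [S₂.root] at this
  nlinarith [S₁.apply_pos h, S₂.deriv_root_pos]

lemma apply_le_apply (S₁ : IsJacobiSolution ℓ k₁ f₁ g₁ r₁)
    (S₂ : IsJacobiSolution ℓ k₂ f₂ g₂ r₂) (hk : ∀ r ≤ 0, k₁ r ≤ k₂ r) {r : ℝ} (h₁ : r₁ ≤ r)
    (hr : r ≤ 0) : f₁ r ≤ f₂ r := by
  have hroot := S₁.root_le_root S₂ hk
  rcases h₁.eq_or_lt with rfl | h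
  · rw [S₁.root]
    exact S₂.apply_nonneg hroot
  have hq := le_of_hasDerivAt_nonpos hr
    (fun x hx => (S₂.hasDerivAt x).div (S₁.hasDerivAt x) (S₁.apply_pos (h.trans_le hx.1)).ne')
    fun x hx => div_nonpos_of_nonpos_of_nonneg (by
      linarith [S₁.wronskian_nonneg S₂ hk (h.trans hx.1).le
        (hroot.trans (h.trans hx.1).le) hx.2.le]) (sq_nonneg _)
  simp only [Pi.div_apply] at hq
  rw [S₁.apply_zero, S₂.apply_zero, div_self S₁.pos.ne', one_le_div (S₁.apply_pos h)] at hq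
  exact hq

lemma sub_nonneg_of_le (S₁ : IsJacobiSolution ℓ k₁ f₁ g₁ r₁)
    (S₂ : IsJacobiSolution ℓ k₂ f₂ g₂ r₂) (hk : ∀ r ≤ 0, k₁ r ≤ k₂ r) {r : ℝ} (h₁ : r₁ ≤ r)
    (hr : r ≤ 0) : 0 ≤ k₂ r * f₂ r - k₁ r * f₁ r :=
  sub_nonneg.2 (mul_le_mul (hk r hr) (S₁.apply_le_apply S₂ hk h₁ hr) (S₁.apply_nonneg h₁)
    (S₂.nonneg r))

lemma deriv_sub_mono (S₁ : IsJacobiSolution ℓ k₁ f₁ g₁ r₁)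
    (S₂ : IsJacobiSolution ℓ k₂ f₂ g₂ r₂) (hk : ∀ r ≤ 0, k₁ r ≤ k₂ r) {r s : ℝ} (h₁ : r₁ ≤ r)
    (hrs : r ≤ s) (hs : s ≤ 0) : g₂ r - g₁ r ≤ g₂ s - g₁ s :=
  le_of_hasDerivAt_nonneg_s17 hrs (fun x _ => (S₂.hasDerivAt' x).sub (S₁.hasDerivAt' x)) fun _ hx =>
    S₁.sub_nonneg_of_le S₂ hk (h₁.trans hx.1.le) (hx.2.le.trans hs)

lemma deriv_sub_nonpos (S₁ : IsJacobiSolution ℓ k₁ f₁ g₁ r₁)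
    (S₂ : IsJacobiSolution ℓ k₂ f₂ g₂ r₂) (hk : ∀ r ≤ 0, k₁ r ≤ k₂ r) {r : ℝ} (h₁ : r₁ ≤ r)
    (hr : r ≤ 0) : g₂ r - g₁ r ≤ 0 := by
  have := S₁.deriv_sub_mono S₂ hk h₁ hr le_rfl
  rwa [S₁.deriv_zero, S₂.deriv_zero, sub_self] at this

lemma deriv_root_le_deriv_root (S₁ : IsJacobiSolution ℓ k₁ f₁ g₁ r₁)
    (S₂ : IsJacobiSolution ℓ k₂ f₂ g₂ r₂) (hk : ∀ r ≤ 0, k₁ r ≤ k₂ r) : g₂ r₂ ≤ g₁ r₁ := by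
  have h1 := S₂.deriv_mono le_rfl (S₁.root_le_root S₂ hk)
  have h2 := S₁.deriv_sub_nonpos S₂ hk le_rfl S₁.root_neg.le
  linarith

lemma deriv_root_lt_deriv_root (S₁ : IsJacobiSolution ℓ k₁ f₁ g₁ r₁)
    (S₂ : IsJacobiSolution ℓ k₂ f₂ g₂ r₂) (hk : ∀ r ≤ 0, k₁ r ≤ k₂ r) {s : ℝ}
    (hs : s ∈ Ioo r₁ 0) (hks : k₁ s < k₂ s) : g₂ r₂ < g₁ r₁ := by
  have h1 := S₂.deriv_mono le_rfl (S₁.root_le_root S₂ hk)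
  have h2 := S₁.deriv_sub_nonpos S₂ hk le_rfl S₁.root_neg.le
  by_contra! hle
  have hzero : ∀ x ∈ Ioo r₁ 0, g₂ x - g₁ x = 0 := fun x hx =>
    le_antisymm (S₁.deriv_sub_nonpos S₂ hk hx.1.le hx.2.le) (by
      have := S₁.deriv_sub_mono S₂ hk le_rfl hx.1.le hx.2.le
      linarith)
  have hd := ((S₂.hasDerivAt' s).sub (S₁.hasDerivAt' s)).unique
    ((hasDerivAt_const s (0 : ℝ)).congr_of_eventuallyEq
      (Filter.eventuallyEq_of_mem (Ioo_mem_nhds hs.1 hs.2) hzero))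
  have h3 := S₁.apply_le_apply S₂ hk hs.1.le hs.2.le
  have h4 := S₁.apply_pos hs.1
  have h5 := S₂.nonneg s
  nlinarith

lemma deriv_root_sub_le (S₁ : IsJacobiSolution ℓ k₁ f₁ g₁ r₁)
    (S₂ : IsJacobiSolution ℓ k₂ f₂ g₂ r₂) (hk : ∀ r ≤ 0, k₁ r ≤ k₂ r) {μ δ R : ℝ}
    (hμ : 0 < μ) (hμ₂ : μ ≤ g₂ r₂) (hR : -r₂ ≤ R)
    (hδ : ∀ r ∈ Ioo r₁ 0, k₂ r - k₁ r ≤ δ) :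
    g₁ r₁ - g₂ r₂ ≤ R * (2 * (ℓ ^ 2 * R / μ) + ℓ) * δ := by
  have hroot := S₁.root_le_root S₂ hk
  have hμ₁ : μ ≤ g₁ r₁ := hμ₂.trans (S₁.deriv_root_le_deriv_root S₂ hk)
  have hr₁ := S₁.root_neg
  have hℓ := S₁.pos
  have hRpos : 0 < R := by linarith
  have hδ0 : 0 ≤ δ := by
    have := hδ (r₁ / 2) ⟨by linarith, by linarith⟩
    linarith [hk (r₁ / 2) (by linarith)]
  have hF0 : 0 ≤ f₂ r₁ := S₂.apply_nonneg hroot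
  have hF : f₂ r₁ ≤ ℓ ^ 2 * R / μ * δ := by
    have hW := mul_sub_le_sub_of_hasDerivAt (c := -(δ * ℓ ^ 2)) hr₁.le
      (fun x _ => S₁.hasDerivAt_wronskian S₂ x) fun x hx => by
        have h1 : f₁ x * f₂ x ≤ ℓ * ℓ := mul_le_mul (S₁.apply_le hx.1.le hx.2.le)
          (S₂.apply_le (hroot.trans hx.1.le) hx.2.le) (S₂.apply_nonneg (hroot.trans hx.1.le)) hℓ.le
        have h2 : 0 ≤ f₁ x * f₂ x :=
          mul_nonneg (S₁.apply_nonneg hx.1.le) (S₂.apply_nonneg (hroot.trans hx.1.le))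
        have h3 := mul_le_mul (hδ x hx) h1 h2 hδ0
        linarith
    rw [S₁.apply_zero, S₁.deriv_zero, S₂.apply_zero, S₂.deriv_zero, S₁.root] at hW
    have h1 : μ * f₂ r₁ ≤ g₁ r₁ * f₂ r₁ := mul_le_mul_of_nonneg_right hμ₁ hF0
    have h2 : δ * ℓ ^ 2 * (-r₁) ≤ δ * ℓ ^ 2 * R :=
      mul_le_mul_of_nonneg_left (by linarith) (by positivity)
    rw [div_mul_eq_mul_div, le_div_iff₀ hμ]
    linarith
  have hD : ∀ x ∈ Ioo r₁ 0, f₂ x - f₁ x ≤ f₂ r₁ := fun x hx => by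
    have := le_of_hasDerivAt_nonpos hx.1.le
      (fun x _ => (S₂.hasDerivAt x).sub (S₁.hasDerivAt x)) fun y hy =>
        S₁.deriv_sub_nonpos S₂ hk hy.1.le (hy.2.trans hx.2).le
    simp only [Pi.sub_apply] at this
    linarith [S₁.root]
  have hA := sub_le_mul_sub_of_hasDerivAt (c := f₂ r₁ + δ * ℓ) hr₁.le
    (fun x _ => (S₂.hasDerivAt' x).sub (S₁.hasDerivAt' x)) fun x hx => by
      have h1 : k₂ x * (f₂ x - f₁ x) ≤ f₂ x - f₁ x := mul_le_of_le_one_left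
        (sub_nonneg.2 (S₁.apply_le_apply S₂ hk hx.1.le hx.2.le)) (S₂.le_one x)
      have h2 := mul_le_mul (hδ x hx) (S₁.apply_le hx.1.le hx.2.le) (S₁.apply_nonneg hx.1.le) hδ0
      linarith [hD x hx]
  have hB := sub_le_mul_sub_of_hasDerivAt (c := f₂ r₁) hroot
    (fun x _ => S₂.hasDerivAt' x) fun x hx =>
      (mul_le_of_le_one_left (S₂.apply_nonneg hx.1.le) (S₂.le_one x)).trans
        (S₂.apply_mono hx.1.le hx.2.le)
  simp only [Pi.sub_apply] at hA
  rw [S₁.deriv_zero, S₂.deriv_zero] at hA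
  have hA' : (f₂ r₁ + δ * ℓ) * (0 - r₁) ≤ (f₂ r₁ + δ * ℓ) * R :=
    mul_le_mul_of_nonneg_left (by linarith) (by positivity)
  have hB' : f₂ r₁ * (r₁ - r₂) ≤ f₂ r₁ * R := mul_le_mul_of_nonneg_left (by linarith) hF0
  have hC := mul_le_mul_of_nonneg_left hF hRpos.le
  linarith

end IsJacobiSolution

/-! ### Dependence on the width of the bump -/

section Width

variable {ℓ t : ℝ} {F G : ℝ → ℝ → ℝ} {ρ : ℝ → ℝ}

lemma strictAntiOn_deriv_root (ht : t ∈ Ioo (0 : ℝ) 1)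
    (S : ∀ ε > 0, IsJacobiSolution ℓ (kbump t ε) (F ε) (G ε) (ρ ε)) :
    StrictAntiOn (fun ε => G ε (ρ ε)) (Ioi 0) := by
  intro ε₁ h₁ ε₂ h₂ hlt
  rw [mem_Ioi] at h₁ h₂
  have hroot := (S ε₁ h₁).root_lt (s := -ε₁ / 2) fun r hr => kbump_of_ge h₁ hr.1.le
  obtain ⟨s, hs, hs'⟩ := exists_between
    (max_lt hroot (show -ε₂ / 2 < -ε₁ / 2 by linarith))
  have hs₂ := (le_max_right _ _).trans_lt hs
  refine (S ε₁ h₁).deriv_root_lt_deriv_root (S ε₂ h₂)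
    (fun r hr => kbump_mono_right ht.2.le h₁ hlt.le hr) (s := s)
    ⟨(le_max_left _ _).trans_lt hs, by linarith⟩ ?_
  rw [kbump_of_ge h₂ hs₂.le]
  exact kbump_lt_one ht.2 h₁ hs'

lemma continuousOn_deriv_root (ht : t ∈ Ioo (0 : ℝ) 1)
    (S : ∀ ε > 0, IsJacobiSolution ℓ (kbump t ε) (F ε) (G ε) (ρ ε)) {a b : ℝ} (ha : 0 < a) :
    ContinuousOn (fun ε => G ε (ρ ε)) (Icc a b) := by
  rcases lt_or_ge b a with hba | hab
  · simp [Icc_eq_empty hba.not_ge]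
  have hb : 0 < b := ha.trans_le hab
  have hanti := (strictAntiOn_deriv_root ht S).antitoneOn
  have hℓ : 0 < ℓ := (S b hb).pos
  have hμ : 0 < G b (ρ b) := (S b hb).deriv_root_pos
  set μ := G b (ρ b)
  set R := ℓ / μ with hR
  set Z := ∫ u in (0 : ℝ)..1, zfun u
  have hZ : 0 < Z := integral_zfun_pos le_rfl one_pos le_rfl
  have hRpos : 0 < R := div_pos hℓ hμ
  set C := R * (2 * (ℓ ^ 2 * R / μ) + ℓ) * (2 * R / (a ^ 2 * Z)) with hC
  have hC0 : 0 ≤ C := by positivity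
  have key : ∀ x ∈ Icc a b, ∀ y ∈ Icc a b, x ≤ y →
      dist (G x (ρ x)) (G y (ρ y)) ≤ C * dist x y := by
    intro x hx y hy hxy
    have hx0 : 0 < x := ha.trans_le hx.1
    have hy0 : 0 < y := ha.trans_le hy.1
    have hμy : μ ≤ G y (ρ y) := hanti hy0 hb hy.2
    have hRy : -ρ y ≤ R :=
      (S y hy0).neg_root_le.trans (div_le_div_of_nonneg_left hℓ.le hμ hμy)
    have hmono : ∀ r ≤ 0, kbump t x r ≤ kbump t y r :=
      fun r hr => kbump_mono_right ht.2.le hx0 hxy hr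
    have hroot := (S x hx0).root_le_root (S y hy0) hmono
    have h := (S x hx0).deriv_root_sub_le (S y hy0) hmono hμ hμy hRy
      (δ := 2 * R / (a ^ 2 * Z) * (y - x)) fun r hr =>
        kbump_sub_le ht.1.le ha hx.1 hxy hr.2.le (by linarith [hr.1])
    rw [Real.dist_eq, Real.dist_eq, abs_of_nonneg (sub_nonneg.2 (hanti hx0 hy0 hxy)),
      abs_of_nonpos (sub_nonpos.2 hxy), neg_sub, hC, mul_assoc]
    exact h
  refine LipschitzOnWith.continuousOn (K := C.toNNReal)
    (LipschitzOnWith.of_dist_le_mul fun x hx y hy => ?_)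
  rw [Real.coe_toNNReal C hC0]
  rcases le_total x y with h | h
  · exact key x hx y hy h
  · rw [dist_comm, dist_comm x]
    exact key y hy x hx h

lemma sq_deriv_root_le_exp (ht : t ∈ Ioo (0 : ℝ) 1) {ε r₀ : ℝ} {f g : ℝ → ℝ} (hε : 0 < ε)
    (S : IsJacobiSolution ℓ (kbump t ε) f g r₀) :
    g r₀ ^ 2 ≤ (1 - t) * ℓ ^ 2 * Real.exp (-ε) := by
  have h := S.sq_deriv_root_le (s := -ε / 2) (fun r hr => kbump_of_ge hε hr.1.le) (by linarith)
    (le_kbump ht.2.le hε)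
  rwa [← Real.exp_nat_mul, show ((2 : ℕ) : ℝ) * (-ε / 2) = -ε by push_cast; ring] at h

lemma le_log_of_deriv_root_eq (ht : t ∈ Ioo (0 : ℝ) 1) {ε c r₀ : ℝ} {f g : ℝ → ℝ} (hε : 0 < ε)
    (hc : 0 < c) (S : IsJacobiSolution ℓ (kbump t ε) f g r₀) (h : g r₀ = c) :
    ε ≤ Real.log ((1 - t) * ℓ ^ 2 / c ^ 2) := by
  have h1 := sq_deriv_root_le_exp ht hε S
  have hℓ := S.pos
  have h2 : 0 < 1 - t := sub_pos.2 ht.2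
  rw [Real.le_log_iff_exp_le (by positivity), le_div_iff₀ (by positivity)]
  rw [h, Real.exp_neg, ← div_eq_mul_inv, le_div_iff₀ (Real.exp_pos _)] at h1
  linarith

lemma exists_deriv_root_eq (ht : t ∈ Ioo (0 : ℝ) 1)
    (S : ∀ ε > 0, IsJacobiSolution ℓ (kbump t ε) (F ε) (G ε) (ρ ε)) {c : ℝ} (hc : 0 < c)
    (hlt : c ^ 2 < (1 - t) * ℓ ^ 2) : ∃ ε > 0, G ε (ρ ε) = c := by
  have hℓ : 0 < ℓ := (S 1 one_pos).pos
  have h1t : 0 < 1 - t := sub_pos.2 ht.2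
  obtain ⟨a, ha, ha1, hca⟩ : ∃ a : ℝ, 0 < a ∧ a < 1 ∧ c ^ 2 < (1 - t) * (ℓ * (1 + -a)) ^ 2 := by
    have hcont : Continuous fun a : ℝ => (1 - t) * (ℓ * (1 + -a)) ^ 2 := by fun_prop
    have hev : ∀ᶠ a in nhdsWithin (0 : ℝ) (Ioi 0), c ^ 2 < (1 - t) * (ℓ * (1 + -a)) ^ 2 :=
      (hcont.continuousAt.eventually_const_lt (by simpa using hlt)).filter_mono nhdsWithin_le_nhds
    obtain ⟨a, h1, h2⟩ := (hev.and (Ioo_mem_nhdsGT one_pos)).exists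
    exact ⟨a, h2.1, h2.2, h1⟩
  have hma : c ≤ G a (ρ a) := by
    have h1 := (S a ha).le_sq_deriv_root (s := -a) (fun r hr => kbump_of_le hr.le) (by linarith)
      (by linarith) ht.2.le
    exact (lt_of_pow_lt_pow_left₀ 2 (S a ha).deriv_root_nonneg (hca.trans_le h1)).le
  have hb : 0 < Real.log ((1 - t) * ℓ ^ 2 / c ^ 2) :=
    Real.log_pos ((one_lt_div (by positivity)).2 hlt)
  set b := Real.log ((1 - t) * ℓ ^ 2 / c ^ 2) with hb_def
  have hmb : G b (ρ b) ≤ c := by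
    have h1 := sq_deriv_root_le_exp ht hb (S b hb)
    rw [Real.exp_neg, hb_def, Real.exp_log (by positivity), ← hb_def] at h1
    refine le_of_sq_le_sq (h1.trans (le_of_eq ?_)) hc.le
    field_simp
  obtain ⟨ε, hε, he⟩ := intermediate_value_uIcc (a := a) (b := b)
    (continuousOn_deriv_root ht S (lt_min ha hb)) (mem_uIcc_of_ge hmb hma)
  exact ⟨ε, (lt_min ha hb).trans_le hε.1, he⟩

end Width

/-- Lemma 2.2 (c), (d) of Futer–Kalfagianni–Purcell: let `ℓ₁ > 2π` and
`h(ℓ₁) = 1 - (2π/ℓ₁)²`.  For `t ∈ (0,1)` and `ε > 0`, let `f t ε` be the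
`C²` solution of `f'' = k_{t,ε}·f` with `f(0) = f'(0) = ℓ₁`, with unique
zero `r₀ t ε`, and set `m t ε = f'(r₀ t ε)`.  Then for every
`t ∈ (0, h(ℓ₁))` there is a unique `ε(t) > 0` with `m t (ε(t)) = 2π`, and
`ε(t) → 0` as `t → h(ℓ₁)` from below. -/
theorem stmt_17 (ℓ₁ : ℝ) (hℓ : 2 * Real.pi < ℓ₁)
    (f : ℝ → ℝ → ℝ → ℝ) (r₀ : ℝ → ℝ → ℝ)
    (hfC2 : ∀ t ∈ Set.Ioo (0 : ℝ) 1, ∀ ε > 0, ContDiff ℝ 2 (f t ε))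
    (hode : ∀ t ∈ Set.Ioo (0 : ℝ) 1, ∀ ε > 0,
      ∀ r, deriv (deriv (f t ε)) r = kbump t ε r * f t ε r)
    (hf0 : ∀ t ∈ Set.Ioo (0 : ℝ) 1, ∀ ε > 0, f t ε 0 = ℓ₁)
    (hf'0 : ∀ t ∈ Set.Ioo (0 : ℝ) 1, ∀ ε > 0, deriv (f t ε) 0 = ℓ₁)
    (hroot : ∀ t ∈ Set.Ioo (0 : ℝ) 1, ∀ ε > 0, f t ε (r₀ t ε) = 0)
    (hrootu : ∀ t ∈ Set.Ioo (0 : ℝ) 1, ∀ ε > 0,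
      ∀ r, f t ε r = 0 → r = r₀ t ε)
    (m : ℝ → ℝ → ℝ) (hm : ∀ t ε, m t ε = deriv (f t ε) (r₀ t ε))
    (h : ℝ) (hh : h = 1 - (2 * Real.pi / ℓ₁) ^ 2) :
    ∃ E : ℝ → ℝ,
      (∀ t ∈ Set.Ioo (0 : ℝ) h, 0 < E t ∧ m t (E t) = 2 * Real.pi ∧
        ∀ ε > 0, m t ε = 2 * Real.pi → ε = E t) ∧
      Filter.Tendsto E (nhdsWithin h (Set.Iio h)) (nhds 0) := by
  have hπ : 0 < 2 * Real.pi := Real.two_pi_pos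
  have hℓ0 : 0 < ℓ₁ := hπ.trans hℓ
  have hh1 : h < 1 := by
    rw [hh]
    have : 0 < (2 * Real.pi / ℓ₁) ^ 2 := by positivity
    linarith
  have hh0 : 0 < h := by
    rw [hh, sub_pos]
    exact pow_lt_one₀ (by positivity) ((div_lt_one hℓ0).2 hℓ) two_ne_zero
  have hhℓ : (1 - h) * ℓ₁ ^ 2 = (2 * Real.pi) ^ 2 := by
    rw [hh]
    field_simp
    ring
  have hS : ∀ t ∈ Ioo (0 : ℝ) 1, ∀ ε > 0,
      IsJacobiSolution ℓ₁ (kbump t ε) (f t ε) (deriv (f t ε)) (r₀ t ε) := by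
    intro t ht ε hε
    have hC := hfC2 t ht ε hε
    have hC' : ContDiff ℝ 1 (deriv (f t ε)) := hC.deriv'
    exact
      { pos := hℓ0
        hasDerivAt := fun r => (hC.differentiable (by norm_num) r).hasDerivAt
        hasDerivAt' := fun r => hode t ht ε hε r ▸
          (hC'.differentiable (by norm_num) r).hasDerivAt
        nonneg := fun r => ht.1.le.trans (le_kbump ht.2.le hε r)
        le_one := kbump_le_one ht.2.le hε
        apply_zero := hf0 t ht ε hε
        deriv_zero := hf'0 t ht ε hε
        root := hroot t ht ε hε
        root_unique := hrootu t ht ε hε }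
  have hsub : ∀ t ∈ Ioo (0 : ℝ) h, t ∈ Ioo (0 : ℝ) 1 := fun t ht => ⟨ht.1, ht.2.trans hh1⟩
  have hex : ∀ t, ∃ ε, t ∈ Ioo (0 : ℝ) h → 0 < ε ∧ m t ε = 2 * Real.pi := by
    intro t
    by_cases ht : t ∈ Ioo (0 : ℝ) h
    · obtain ⟨ε, hε, he⟩ := exists_deriv_root_eq (hsub t ht) (hS t (hsub t ht)) hπ
        (hhℓ ▸ mul_lt_mul_of_pos_right (by linarith [ht.2]) (by positivity))
      exact ⟨ε, fun _ => ⟨hε, (hm t ε).trans he⟩⟩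
    · exact ⟨0, fun h => absurd h ht⟩
  choose E hE using hex
  refine ⟨E, fun t ht => ⟨(hE t ht).1, (hE t ht).2, fun ε hε he => ?_⟩, ?_⟩
  · refine (strictAntiOn_deriv_root (hsub t ht) (hS t (hsub t ht))).injOn hε (hE t ht).1 ?_
    rw [← hm, ← hm, he, (hE t ht).2]
  · have hlog : Filter.Tendsto (fun t => Real.log ((1 - t) * ℓ₁ ^ 2 / (2 * Real.pi) ^ 2))
        (nhdsWithin h (Iio h)) (nhds 0) := by
      have hval : (1 - h) * ℓ₁ ^ 2 / (2 * Real.pi) ^ 2 = 1 := by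
        rw [hhℓ, div_self (by positivity)]
      have hc : ContinuousAt (fun t => Real.log ((1 - t) * ℓ₁ ^ 2 / (2 * Real.pi) ^ 2)) h :=
        ContinuousAt.log (by fun_prop) (by rw [hval]; exact one_ne_zero)
      have := hc.tendsto
      rw [hval, Real.log_one] at this
      exact this.mono_left nhdsWithin_le_nhds
    have hmem : Ioo 0 h ∈ nhdsWithin h (Iio h) := Ioo_mem_nhdsLT hh0
    refine squeeze_zero' ?_ ?_ hlog
    · filter_upwards [hmem] with t ht using (hE t ht).1.le
    · filter_upwards [hmem] with t ht
      exact le_log_of_deriv_root_eq (hsub t ht) (hE t ht).1 hπ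
        (hS t (hsub t ht) _ (hE t ht).1) ((hm _ _).symm.trans (hE t ht).2)
end
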